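/- Let d ≥ 1 and set C_d = 2(3e^{1/4} − 2)²(5 + 3/d)². Define the weight w₁(z,t) = |z| (1+|z|²)^{−1/2} (1 + (|z|⁴+t²)^{1/2})^{−1}. Then for every σ ∈ ℂ with Im σ ≠ 0 and every f ∈ 𝒮(ℝ^{2d+1}), ∫ w₁(z,t)² |f(z,t)|² dz dt ≤ C_d² ∫ w₁(z,t)^{−2} |Δ_H f(z,t) + σ f(z,t)|² dz dt (the right-hand side being possibly +∞, in which case the inequality holds trivially). This is the uniform resolvent estimate ‖w₁ (L−σ)^{−1} w₁‖ ≤ C_d, L = −Δ_H, in a priori form on Schwartz functions. -/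

import Mathlib

noncomputable section

open MeasureTheory ENNReal

/-- The Heisenberg group ℍ^d modeled on ℝ^d × ℝ^d × ℝ. -/
abbrev Hd (d : ℕ) : Type := EuclideanSpace ℝ (Fin d) × EuclideanSpace ℝ (Fin d) × ℝ

/-- The left-invariant vector field `X_j = ∂_{x_j} + 2 y_j ∂_t`. -/
def Xop (d : ℕ) (j : Fin d) (f : Hd d → ℂ) (p : Hd d) : ℂ :=
  fderiv ℝ f p (EuclideanSpace.single j 1, 0, 2 * p.2.1 j)

/-- The left-invariant vector field `Y_j = ∂_{y_j} - 2 x_j ∂_t`. -/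
def Yop (d : ℕ) (j : Fin d) (f : Hd d → ℂ) (p : Hd d) : ℂ :=
  fderiv ℝ f p (0, EuclideanSpace.single j 1, -(2 * p.1 j))

/-- The vertical derivative `T = ∂_t`. -/
def Tder (d : ℕ) (f : Hd d → ℂ) (p : Hd d) : ℂ :=
  fderiv ℝ f p (0, 0, 1)

/-- The rotation operator `N = Σ_j (y_j ∂_{x_j} - x_j ∂_{y_j})`. -/
def Nop (d : ℕ) (f : Hd d → ℂ) (p : Hd d) : ℂ :=
  fderiv ℝ f p (p.2.1, -p.1, 0)

/-- The sublaplacian `Δ_H = Σ_j (X_j² + Y_j²)`. -/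
def subLap (d : ℕ) (f : Hd d → ℂ) (p : Hd d) : ℂ :=
  ∑ j : Fin d, (Xop d j (Xop d j f) p + Yop d j (Yop d j f) p)

/-- Squared length of the horizontal gradient: `|∇_H f|² = Σ_j (|X_j f|² + |Y_j f|²)`. -/
def gradHsq (d : ℕ) (f : Hd d → ℂ) (p : Hd d) : ℝ :=
  ∑ j : Fin d, (‖Xop d j f p‖ ^ 2 + ‖Yop d j f p‖ ^ 2)

/-- `|z|² = |x|² + |y|²`. -/
def zsq (d : ℕ) (p : Hd d) : ℝ := ‖p.1‖ ^ 2 + ‖p.2.1‖ ^ 2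

/-- `|z|`. -/
def zn (d : ℕ) (p : Hd d) : ℝ := Real.sqrt (zsq d p)

/-- The weight `w₁(z,t) = |z| (1+|z|²)^{-1/2} (1 + (|z|⁴+t²)^{1/2})⁻¹`. -/
def w1 (d : ℕ) (p : Hd d) : ℝ :=
  zn d p / Real.sqrt (1 + zn d p ^ 2) / (1 + Real.sqrt (zn d p ^ 4 + p.2.2 ^ 2))

/-- The weight `w₂(z,t) = (1+|z|²+t²)^{-1/2}`. -/
def w2 (d : ℕ) (p : Hd d) : ℝ :=
  (Real.sqrt (1 + zsq d p + p.2.2 ^ 2))⁻¹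

/-- The weight `w₄(z,t) = |z| (|z|⁴+t²)^{-1/2}`. -/
def w4 (d : ℕ) (p : Hd d) : ℝ :=
  zn d p / Real.sqrt (zn d p ^ 4 + p.2.2 ^ 2)

section StationaryCurves

variable {E : Type*} [NormedAddCommGroup E] [InnerProductSpace ℂ E]

/-- Two curves are jointly stationary if their mutual inner products are translation invariant. -/
def JointlyStationary (z w : ℝ → E) : Prop :=
  ∀ a s t, inner ℂ (z (s + a)) (w (t + a)) = inner ℂ (z s) (w t)

/-- Bounded continuous curves. -/
def BddCurve (z : ℝ → E) : Prop := Continuous z ∧ ∃ C, ∀ s, ‖z s‖ ≤ C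

/-- The average of the translates of a curve against a kernel. -/
def curveAvg (K : ℝ → ℂ) (z : ℝ → E) (s : ℝ) : E := ∫ u, K u • z (s + u)

lemma BddCurve.integrable {z : ℝ → E} (hz : BddCurve z) {K : ℝ → ℂ} (hK : Integrable K) (s : ℝ) :
    Integrable fun u => K u • z (s + u) := by
  obtain ⟨hc, C, hC⟩ := hz
  exact hK.smul_bdd C (hc.comp (continuous_const.add continuous_id)).aestronglyMeasurable
    (Filter.Eventually.of_forall fun u => hC (s + u))

lemma BddCurve.curveAvg {z : ℝ → E} (hz : BddCurve z) {K : ℝ → ℂ} (hK : Integrable K) :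
    BddCurve (curveAvg K z) := by
  have hi := hz.integrable hK
  obtain ⟨hc, C, hC⟩ := hz
  have hb : ∀ s u, ‖K u • z (s + u)‖ ≤ ‖K u‖ * C := fun s u => by
    rw [norm_smul]; gcongr; exact hC _
  constructor
  · refine continuous_of_dominated (bound := fun u => ‖K u‖ * C)
      (fun s => (hi s).1) (fun s => Filter.Eventually.of_forall (hb s)) (hK.norm.mul_const C) ?_
    exact Filter.Eventually.of_forall fun u => by fun_prop
  · exact ⟨∫ u, ‖K u‖ * C, fun s => norm_integral_le_of_norm_le (hK.norm.mul_const C)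
      (Filter.Eventually.of_forall (hb s))⟩

lemma JointlyStationary.symm {z w : ℝ → E} (h : JointlyStationary z w) :
    JointlyStationary w z := fun a s t => by
  rw [← inner_conj_symm, h a t s, inner_conj_symm]

lemma JointlyStationary.norm_eq {z : ℝ → E} (h : JointlyStationary z z) (s : ℝ) :
    ‖z s‖ = ‖z 0‖ := by
  have := h s 0 0
  rw [zero_add, inner_self_eq_norm_sq_to_K, inner_self_eq_norm_sq_to_K] at this
  have h2 : ‖z s‖ ^ 2 = ‖z 0‖ ^ 2 := by exact_mod_cast this
  exact (pow_left_inj₀ (norm_nonneg _) (norm_nonneg _) two_ne_zero).1 h2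

lemma JointlyStationary.bddCurve {z : ℝ → E} (h : JointlyStationary z z) (hc : Continuous z) :
    BddCurve z := ⟨hc, ‖z 0‖, fun s => (h.norm_eq s).le⟩

variable [CompleteSpace E]

lemma inner_curveAvg_right {z : ℝ → E} (hz : BddCurve z) {K : ℝ → ℂ} (hK : Integrable K)
    (a : E) (s : ℝ) : inner ℂ a (curveAvg K z s) = ∫ u, K u * inner ℂ a (z (s + u)) := by
  rw [curveAvg, ← integral_inner (hz.integrable hK s)]
  simp [inner_smul_right]

lemma inner_curveAvg_left {z : ℝ → E} (hz : BddCurve z) {K : ℝ → ℂ} (hK : Integrable K)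
    (a : E) (s : ℝ) :
    inner ℂ (curveAvg K z s) a = ∫ u, starRingEnd ℂ (K u) * inner ℂ (z (s + u)) a := by
  rw [← inner_conj_symm, inner_curveAvg_right hz hK, ← integral_conj]
  simp

lemma JointlyStationary.curveAvg_right {z w : ℝ → E} (h : JointlyStationary z w)
    (hw : BddCurve w) {K : ℝ → ℂ} (hK : Integrable K) :
    JointlyStationary z (curveAvg K w) := fun a s t => by
  rw [inner_curveAvg_right hw hK, inner_curveAvg_right hw hK]
  congr 1 with u
  rw [← h a s (t + u)]
  ring_nf

lemma JointlyStationary.curveAvg_left {z w : ℝ → E} (h : JointlyStationary z w)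
    (hz : BddCurve z) {K : ℝ → ℂ} (hK : Integrable K) :
    JointlyStationary (curveAvg K z) w := (h.symm.curveAvg_right hz hK).symm

lemma curveAvg_comm {z : ℝ → E} (hz : BddCurve z) {K K' : ℝ → ℂ} (hK : Integrable K)
    (hK' : Integrable K') : curveAvg K (curveAvg K' z) = curveAvg K' (curveAvg K z) := by
  funext s
  simp only [curveAvg]
  simp_rw [← integral_smul]
  rw [integral_integral_swap]
  · congr 1 with v
    congr 1 with u
    rw [smul_comm]
    ring_nf
  · obtain ⟨hc, C, hC⟩ := hz
    have : Integrable fun q : ℝ × ℝ => (K q.1 * K' q.2) • z (s + q.1 + q.2) := by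
      have hm : Continuous fun q : ℝ × ℝ => z (s + q.1 + q.2) := by fun_prop
      exact (hK.mul_prod hK').smul_bdd C hm.aestronglyMeasurable
        (Filter.Eventually.of_forall fun q : ℝ × ℝ => hC (s + q.1 + q.2))
    refine this.congr (Filter.Eventually.of_forall fun q => ?_)
    simp [Function.uncurry, mul_smul]

/-- One-sided modulated exponential. -/
def halfExp (R τ : ℝ) (u : ℝ) : ℂ :=
  (Set.Ioi (0 : ℝ)).indicator (fun u : ℝ => Complex.exp ((-R + τ * Complex.I) * u)) u

/-- Two-sided modulated exponential. -/
def fullExp (R τ : ℝ) (u : ℝ) : ℂ := Real.exp (-R * |u|) * Complex.exp (τ * u * Complex.I)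

lemma integrable_exp_neg_mul_abs {R : ℝ} (hR : 0 < R) :
    Integrable fun u : ℝ => Real.exp (-R * |u|) := by
  have h1 : IntegrableOn (fun u : ℝ => Real.exp (-R * |u|)) (Set.Ioi 0) := by
    refine (exp_neg_integrableOn_Ioi 0 hR).congr_fun (fun u hu => ?_) measurableSet_Ioi
    simp [abs_of_pos (Set.mem_Ioi.1 hu)]
  have h2 : IntegrableOn (fun u : ℝ => Real.exp (-R * |u|)) (Set.Iic 0) := by
    refine (integrableOn_exp_mul_Iic hR 0).congr_fun (fun u hu => ?_) measurableSet_Iic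
    simp [abs_of_nonpos (Set.mem_Iic.1 hu)]
  simpa using h2.union h1

lemma integrable_fullExp {R : ℝ} (hR : 0 < R) (τ : ℝ) : Integrable (fullExp R τ) := by
  refine (integrable_exp_neg_mul_abs hR).mono' ?_ (Filter.Eventually.of_forall fun u => ?_)
  · unfold fullExp
    fun_prop
  · have : ‖Complex.exp (τ * u * Complex.I)‖ = 1 := by
      exact_mod_cast Complex.norm_exp_ofReal_mul_I (τ * u)
    simp only [fullExp, norm_mul, this, mul_one, Complex.norm_real]
    simp

lemma measurable_halfExp (R τ : ℝ) : Measurable (halfExp R τ) := by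
  unfold halfExp
  exact Measurable.indicator (by fun_prop) measurableSet_Ioi

lemma norm_halfExp_le (R τ u : ℝ) : ‖halfExp R τ u‖ ≤ Real.exp (-R * |u|) := by
  unfold halfExp
  by_cases hu : u ∈ Set.Ioi (0 : ℝ)
  · rw [Set.indicator_of_mem hu, Complex.norm_exp, abs_of_pos (Set.mem_Ioi.1 hu)]
    simp
  · rw [Set.indicator_of_notMem hu]
    simp [Real.exp_nonneg]

lemma integrable_halfExp {R : ℝ} (hR : 0 < R) (τ : ℝ) : Integrable (halfExp R τ) :=
  (integrable_exp_neg_mul_abs hR).mono' (measurable_halfExp R τ).aestronglyMeasurable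
    (Filter.Eventually.of_forall fun u => norm_halfExp_le R τ u)

lemma halfExp_autocorrelation {R : ℝ} (hR : 0 < R) (τ d : ℝ) :
    2 * R * ∫ u, starRingEnd ℂ (halfExp R τ u) * halfExp R τ (u + d) = fullExp R τ d := by
  have key : ∀ u, starRingEnd ℂ (halfExp R τ u) * halfExp R τ (u + d) =
      (Set.Ioi (max 0 (-d))).indicator
        (fun u : ℝ => (Real.exp (-(2 * R) * u) : ℂ)) u *
          Complex.exp ((-R + τ * Complex.I) * d) := fun u => by
    unfold halfExp
    by_cases h1 : 0 < u <;> by_cases h2 : 0 < u + d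
    · have h3 : u ∈ Set.Ioi (max 0 (-d)) := by simp [h1]; linarith
      rw [Set.indicator_of_mem (Set.mem_Ioi.2 h1), Set.indicator_of_mem (Set.mem_Ioi.2 h2),
        Set.indicator_of_mem h3, ← Complex.exp_conj, Complex.ofReal_exp, ← Complex.exp_add,
        ← Complex.exp_add]
      congr 1
      simp
      ring
    · have h3 : u ∉ Set.Ioi (max 0 (-d)) := by simp [h1]; linarith
      simp [h2, h3]
    · have h3 : u ∉ Set.Ioi (max 0 (-d)) := by simp [h1]
      simp [h1, h3]
    · have h3 : u ∉ Set.Ioi (max 0 (-d)) := by simp [h1]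
      simp [h1, h3]
  simp_rw [key]
  rw [integral_mul_const, integral_indicator measurableSet_Ioi, integral_complex_ofReal,
    integral_exp_mul_Ioi (by linarith)]
  unfold fullExp
  have e1 : Complex.exp ((-R + τ * Complex.I) * d) =
      (Real.exp (-R * d) : ℂ) * Complex.exp (τ * d * Complex.I) := by
    rw [Complex.ofReal_exp, ← Complex.exp_add]; congr 1; push_cast; ring
  rw [e1, ← mul_assoc, ← mul_assoc]
  congr 1
  have e2 : Real.exp (-R * |d|) = Real.exp (-(2 * R) * max 0 (-d)) * Real.exp (-R * d) := by
    rw [← Real.exp_add]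
    congr 1
    rcases le_total 0 d with h | h
    · rw [abs_of_nonneg h, max_eq_left (by linarith)]; ring
    · rw [abs_of_nonpos h, max_eq_right (by linarith)]; ring
  rw [e2]
  have : (R : ℂ) ≠ 0 := by exact_mod_cast hR.ne'
  push_cast
  field_simp

lemma two_mul_inner_halfExp {R : ℝ} (hR : 0 < R) (τ : ℝ) {z w : ℝ → E} (hz : BddCurve z)
    (hw : BddCurve w) (h : JointlyStationary z w) :
    2 * R * inner ℂ (curveAvg (halfExp R τ) z 0) (curveAvg (halfExp R τ) w 0) =
      ∫ d, fullExp R τ d * inner ℂ (z 0) (w d) := by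
  have hK := integrable_halfExp hR τ
  rw [inner_curveAvg_left hz hK]
  simp_rw [inner_curveAvg_right hw hK, ← integral_const_mul]
  have e1 : ∀ u, ∫ v, starRingEnd ℂ (halfExp R τ u) * (halfExp R τ v *
      inner ℂ (z (0 + u)) (w (0 + v))) =
      ∫ d, starRingEnd ℂ (halfExp R τ u) * halfExp R τ (u + d) * inner ℂ (z 0) (w d) := fun u => by
    rw [← integral_add_left_eq_self _ u]
    congr 1 with d
    rw [← h u 0 d]
    ring_nf
  simp_rw [integral_const_mul] at e1 ⊢
  simp_rw [e1]
  rw [integral_integral_swap]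
  · rw [← integral_const_mul]
    congr 1 with d
    rw [integral_mul_const, ← halfExp_autocorrelation hR]
    ring
  · obtain ⟨hc, C, hC⟩ := hw
    have hC0 : 0 ≤ C := (norm_nonneg _).trans (hC 0)
    have hR2 : 0 < R / 2 := by linarith
    have hb := ((integrable_exp_neg_mul_abs hR2).mul_prod
      (integrable_exp_neg_mul_abs hR2)).mul_const (‖z 0‖ * C)
    refine hb.mono' ?_ (Filter.Eventually.of_forall fun q => ?_)
    · refine Measurable.aestronglyMeasurable ?_
      have := measurable_halfExp R τ
      have h3 : Measurable fun d => inner ℂ (z 0) (w d) := 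
        (Continuous.inner continuous_const hc).measurable
      have h4 : Measurable fun u => starRingEnd ℂ (halfExp R τ u) :=
        Complex.continuous_conj.measurable.comp this
      exact ((h4.comp measurable_fst).mul (this.comp (measurable_fst.add measurable_snd))).mul
        (h3.comp measurable_snd)
    · simp only [Function.uncurry_def, norm_mul, RCLike.norm_conj]
      refine mul_le_mul ?_ ((norm_inner_le_norm _ _).trans (by gcongr; exact hC _)) (norm_nonneg _)
        (by positivity)
      · by_cases h1 : 0 < q.1
        · by_cases h2 : 0 < q.1 + q.2
          · refine (mul_le_mul (norm_halfExp_le _ _ _) (norm_halfExp_le _ _ _) (norm_nonneg _)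
              (Real.exp_nonneg _)).trans ?_
            rw [← Real.exp_add, ← Real.exp_add, Real.exp_le_exp, abs_of_pos h1, abs_of_pos h2]
            rcases le_total 0 q.2 with h | h
            · rw [abs_of_nonneg h]; nlinarith
            · rw [abs_of_nonpos h]; nlinarith
          · simp [halfExp, h2]; positivity
        · simp [halfExp, h1]; positivity

lemma inner_fullExp_right {R : ℝ} (hR : 0 < R) (τ : ℝ) {z w : ℝ → E} (hz : BddCurve z)
    (hw : BddCurve w) (h : JointlyStationary z w) :
    inner ℂ (z 0) (curveAvg (fullExp R τ) w 0) =
      2 * R * inner ℂ (curveAvg (halfExp R τ) z 0) (curveAvg (halfExp R τ) w 0) := by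
  rw [two_mul_inner_halfExp hR τ hz hw h, inner_curveAvg_right hw (integrable_fullExp hR τ)]
  simp

lemma conj_fullExp (R τ u : ℝ) : starRingEnd ℂ (fullExp R τ u) = fullExp R τ (-u) := by
  simp [fullExp, ← Complex.exp_conj]

lemma inner_fullExp_left {R : ℝ} (hR : 0 < R) (τ : ℝ) {z w : ℝ → E} (hz : BddCurve z)
    (hw : BddCurve w) (h : JointlyStationary z w) :
    inner ℂ (curveAvg (fullExp R τ) z 0) (w 0) =
      2 * R * inner ℂ (curveAvg (halfExp R τ) z 0) (curveAvg (halfExp R τ) w 0) := by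
  have := inner_fullExp_right hR τ hw hz h.symm
  rw [← inner_conj_symm, this, map_mul, inner_conj_symm]
  congr 1
  exact_mod_cast Complex.conj_ofReal (2 * R)

lemma inner_fullExp_fullExp {R : ℝ} (hR : 0 < R) (τ τ' : ℝ) {y : ℝ → E} (hy : BddCurve y)
    (h : JointlyStationary y y) :
    inner ℂ (curveAvg (fullExp R τ) y 0) (curveAvg (fullExp R τ') y 0) =
      ((4 * R ^ 2 * ‖curveAvg (halfExp R τ') (curveAvg (halfExp R τ) y) 0‖ ^ 2 : ℝ) : ℂ) := by
  have hV := integrable_halfExp hR τ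
  have hV' := integrable_halfExp hR τ'
  have hP' := integrable_fullExp hR τ'
  have hVy := hy.curveAvg hV
  have hVV : JointlyStationary (curveAvg (halfExp R τ) y) (curveAvg (halfExp R τ) y) :=
    (h.curveAvg_right hy hV).curveAvg_left hy hV
  rw [inner_fullExp_left hR τ hy (hy.curveAvg hP') (h.curveAvg_right hy hP'),
    curveAvg_comm hy hV hP', inner_fullExp_right hR τ' hVy hVy hVV, inner_self_eq_norm_sq_to_K]
  simp only [Complex.coe_algebraMap]
  push_cast
  ring

end StationaryCurves

section HilbertTransform

variable {E : Type*} [NormedAddCommGroup E] [InnerProductSpace ℂ E] [CompleteSpace E]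

lemma integral_poisson {b : ℝ} (hb : 0 < b) :
    Integrable (fun s : ℝ => b / (s ^ 2 + b ^ 2)) ∧ ∫ s : ℝ, b / (s ^ 2 + b ^ 2) = Real.pi := by
  have e : (fun s : ℝ => b / (s ^ 2 + b ^ 2)) = fun s => b⁻¹ * (1 + (s / b) ^ 2)⁻¹ := by
    funext s; field_simp; ring
  rw [e]
  constructor
  · exact (integrable_inv_one_add_sq.comp_div hb.ne').const_mul _
  · rw [integral_const_mul, Measure.integral_comp_div (fun s => (1 + s ^ 2)⁻¹),
      integral_univ_inv_one_add_sq, abs_of_pos hb, smul_eq_mul]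
    field_simp

lemma norm_fullExp (R τ u : ℝ) : ‖fullExp R τ u‖ = Real.exp (-R * |u|) := by
  have : ‖Complex.exp (τ * u * Complex.I)‖ = 1 := by
    exact_mod_cast Complex.norm_exp_ofReal_mul_I (τ * u)
  simp only [fullExp, norm_mul, this, mul_one, Complex.norm_real]
  simp

lemma integral_exp_neg_mul_abs {R : ℝ} (hR : 0 < R) :
    ∫ u : ℝ, Real.exp (-R * |u|) = 2 / R := by
  rw [integral_comp_abs (f := fun x => Real.exp (-R * x)), integral_exp_mul_Ioi (by linarith)]
  simp
  field_simp

lemma integral_laplace_curveAvg {R b : ℝ} (hR : 0 < R) (hb : 0 < b) (ε : ℝ) {y : ℝ → E}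
    (hy : BddCurve y) :
    ∫ τ in Set.Ioi (0 : ℝ), (Real.exp (-b * τ) : ℂ) • curveAvg (fullExp R (ε * τ)) y 0 =
      curveAvg (fun s => fullExp R 0 s * (b - ε * s * Complex.I)⁻¹) y 0 := by
  simp only [curveAvg, ← integral_smul]
  rw [integral_integral_swap]
  · congr 1 with u
    have : ∀ τ : ℝ, (Real.exp (-b * τ) : ℂ) • fullExp R (ε * τ) u • y (0 + u) =
        (fullExp R 0 u * Complex.exp (-(b - ε * u * Complex.I) * τ)) • y (0 + u) := fun τ => by
      rw [smul_smul]
      congr 1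
      simp only [fullExp, Complex.ofReal_zero, zero_mul, Complex.exp_zero, mul_one,
        Complex.ofReal_exp, ← Complex.exp_add]
      congr 1
      push_cast
      ring
    simp_rw [this]
    rw [integral_smul_const, integral_const_mul, integral_exp_mul_complex_Ioi (by simpa using hb)]
    congr 2
    rw [Complex.ofReal_zero, mul_zero, Complex.exp_zero, neg_div_neg_eq, one_div]
  · obtain ⟨hc, C, hC⟩ := hy
    have h1 : Integrable (fun τ : ℝ => Real.exp (-b * τ)) (volume.restrict (Set.Ioi 0)) :=
      exp_neg_integrableOn_Ioi 0 hb
    refine ((h1.mul_prod (integrable_exp_neg_mul_abs hR)).mul_const C).mono' ?_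
      (Filter.Eventually.of_forall fun q => ?_)
    · refine Continuous.aestronglyMeasurable ?_
      simp only [Function.uncurry_def, fullExp]
      fun_prop
    · simp only [Function.uncurry_def, norm_smul, norm_fullExp, Complex.norm_real,
        Real.norm_eq_abs, Real.abs_exp, ← mul_assoc]
      gcongr
      exact hC _

lemma re_inner_integral_nonneg {α : Type*} [MeasurableSpace α] {μ : Measure α} (a : E) {f : α → E}
    (h : ∀ t, 0 ≤ (inner ℂ a (f t)).re) : 0 ≤ (inner ℂ a (∫ t, f t ∂μ)).re := by
  by_cases hf : Integrable f μ
  · rw [← integral_inner hf]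
    have : (∫ t, inner ℂ a (f t) ∂μ).re = ∫ t, (inner ℂ a (f t)).re ∂μ :=
      (integral_re (hf.const_inner (𝕜 := ℂ) a)).symm
    rw [this]
    exact integral_nonneg h
  · simp [integral_undef hf]

lemma re_inner_laplace_nonneg {R b : ℝ} (hR : 0 < R) {y : ℝ → E}
    (hy : BddCurve y) (h : JointlyStationary y y) :
    0 ≤ (inner ℂ
      (∫ τ in Set.Ioi (0 : ℝ), (Real.exp (-b * τ) : ℂ) • curveAvg (fullExp R ((1 : ℝ) * τ)) y 0)
      (∫ τ in Set.Ioi (0 : ℝ),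
        (Real.exp (-b * τ) : ℂ) • curveAvg (fullExp R ((-1 : ℝ) * τ)) y 0)).re := by
  refine re_inner_integral_nonneg _ fun τ' => ?_
  rw [← inner_conj_symm, Complex.conj_re]
  refine re_inner_integral_nonneg _ fun τ => ?_
  rw [inner_smul_left, inner_smul_right, inner_fullExp_fullExp hR _ _ hy h, Complex.conj_ofReal,
    ← Complex.ofReal_mul, ← Complex.ofReal_mul, Complex.ofReal_re]
  positivity

lemma norm_curveAvg_le {y : ℝ → E} (h : JointlyStationary y y) {K : ℝ → ℂ}
    {k : ℝ → ℝ} (hk : Integrable k) (hKk : ∀ s, ‖K s‖ ≤ k s) :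
    ‖curveAvg K y 0‖ ≤ (∫ s, k s) * ‖y 0‖ := by
  rw [← integral_mul_const]
  refine norm_integral_le_of_norm_le (hk.mul_const _) (Filter.Eventually.of_forall fun s => ?_)
  rw [norm_smul, h.norm_eq]
  gcongr
  exact hKk s

lemma norm_hilbert_le {R b : ℝ} (hR : 0 < R) (hb : 0 < b) {y : ℝ → E}
    (hy : BddCurve y) (h : JointlyStationary y y) :
    ‖curveAvg (fun s => fullExp R 0 s * ((s / (s ^ 2 + b ^ 2) : ℝ) : ℂ)) y 0‖ ≤
      Real.pi * ‖y 0‖ := by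
  set K : ℝ → ℝ → ℂ := fun ε s => fullExp R 0 s * (b - ε * s * Complex.I)⁻¹ with hK
  have hne : ∀ ε s : ℝ, (b - ε * s * Complex.I : ℂ) ≠ 0 := fun ε s h0 => by
    have := congrArg Complex.re h0
    simp at this
    exact hb.ne' this
  have hKint : ∀ ε, Integrable (K ε) := fun ε => by
    refine ((integrable_fullExp hR 0).norm.mul_const b⁻¹).mono' ?_
      (Filter.Eventually.of_forall fun s => ?_)
    · refine Continuous.aestronglyMeasurable ?_
      simp only [hK, fullExp]
      exact Continuous.mul (by fun_prop) (Continuous.inv₀ (by fun_prop) (hne ε))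
    · simp only [hK, norm_mul, norm_inv]
      gcongr
      have := Complex.abs_re_le_norm (b - ε * s * Complex.I)
      simp at this
      exact (le_abs_self b).trans this
  set Sp := curveAvg (K 1) y 0
  set Sm := curveAvg (K (-1)) y 0
  have hpos : 0 ≤ (inner ℂ Sp Sm).re := by
    have := re_inner_laplace_nonneg (b := b) hR hy h
    rwa [integral_laplace_curveAvg hR hb 1 hy, integral_laplace_curveAvg hR hb (-1) hy] at this
  have hsq : ∀ s : ℝ, ((s ^ 2 + b ^ 2 : ℝ) : ℂ) ≠ 0 := fun s => by
    have : 0 < s ^ 2 + b ^ 2 := by positivity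
    exact_mod_cast this.ne'
  have hne1 := fun s => hne 1 s
  have hne2 := fun s => hne (-1) s
  simp only [Complex.ofReal_one, Complex.ofReal_neg, one_mul, neg_mul, sub_neg_eq_add]
    at hne1 hne2
  have hI : ∀ s : ℝ, (b - s * Complex.I : ℂ) * (b + s * Complex.I) = ((s ^ 2 + b ^ 2 : ℝ) : ℂ) := by
    intro s
    push_cast
    linear_combination (-(s : ℂ) ^ 2) * Complex.I_sq
  have e1 : Sp - Sm = (2 * Complex.I) •
      curveAvg (fun s => fullExp R 0 s * ((s / (s ^ 2 + b ^ 2) : ℝ) : ℂ)) y 0 := by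
    simp only [Sp, Sm, curveAvg]
    rw [← integral_sub (hy.integrable (hKint 1) 0) (hy.integrable (hKint (-1)) 0), ← integral_smul]
    congr 1 with s
    rw [← sub_smul, smul_smul]
    congr 1
    simp only [hK, Complex.ofReal_one, Complex.ofReal_neg, one_mul, neg_mul, sub_neg_eq_add]
    rw [Complex.ofReal_div, ← hI s]
    have := hne1 s
    have := hne2 s
    field_simp
    ring
  have e2 : Sp + Sm = (2 : ℂ) •
      curveAvg (fun s => fullExp R 0 s * ((b / (s ^ 2 + b ^ 2) : ℝ) : ℂ)) y 0 := by
    simp only [Sp, Sm, curveAvg]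
    rw [← integral_add (hy.integrable (hKint 1) 0) (hy.integrable (hKint (-1)) 0), ← integral_smul]
    congr 1 with s
    rw [← add_smul, smul_smul]
    congr 1
    simp only [hK, Complex.ofReal_one, Complex.ofReal_neg, one_mul, neg_mul, sub_neg_eq_add]
    rw [Complex.ofReal_div, ← hI s]
    have := hne1 s
    have := hne2 s
    field_simp
    ring
  set Ξ := curveAvg (fun s => fullExp R 0 s * ((s / (s ^ 2 + b ^ 2) : ℝ) : ℂ)) y 0
  have hbd : ‖curveAvg (fun s => fullExp R 0 s * ((b / (s ^ 2 + b ^ 2) : ℝ) : ℂ)) y 0‖ ≤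
      Real.pi * ‖y 0‖ := by
    rw [← (integral_poisson hb).2]
    refine norm_curveAvg_le h (integral_poisson hb).1 fun s => ?_
    have h0 : 0 ≤ b / (s ^ 2 + b ^ 2) := by positivity
    rw [norm_mul, norm_fullExp, Complex.norm_real, Real.norm_of_nonneg h0]
    refine mul_le_of_le_one_left h0 (Real.exp_le_one_iff.2 ?_)
    have := abs_nonneg s
    nlinarith
  have n1 : ‖Sp - Sm‖ = 2 * ‖Ξ‖ := by rw [e1, norm_smul]; simp
  have n2 : ‖Sp + Sm‖ ≤ 2 * (Real.pi * ‖y 0‖) := by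
    rw [e2, norm_smul]; simpa using hbd
  have i1 := norm_sub_sq (𝕜 := ℂ) Sp Sm
  have i2 := norm_add_sq (𝕜 := ℂ) Sp Sm
  simp only [RCLike.re_to_complex] at i1 i2
  refine le_of_sq_le_sq ?_ (by positivity)
  have : ‖Sp + Sm‖ ^ 2 ≤ (2 * (Real.pi * ‖y 0‖)) ^ 2 := by gcongr
  rw [n1] at i1
  nlinarith

lemma abs_exp_sub_one_le (s : ℝ) : |Real.exp s - 1| ≤ 2 * |Real.sinh s| := by
  have h : 2 * Real.sinh s = (Real.exp s - 1) * (1 + Real.exp (-s)) := by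
    rw [Real.sinh_eq]
    have : Real.exp s * Real.exp (-s) = 1 := by rw [← Real.exp_add]; simp
    linear_combination -this
  have h2 : 2 * |Real.sinh s| = |Real.exp s - 1| * (1 + Real.exp (-s)) := by
    rw [← abs_of_pos (show (0 : ℝ) < 2 by norm_num), ← abs_mul, h, abs_mul,
      abs_of_pos (show 0 < 1 + Real.exp (-s) by positivity)]
  rw [h2]
  exact le_mul_of_one_le_right (abs_nonneg _) (by linarith [Real.exp_pos (-s)])

lemma sinh_sub_self_le {s : ℝ} (hs : 0 ≤ s) : Real.sinh s - s ≤ s * Real.sinh s := by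
  have h0 := Real.sinh_nonneg_iff.2 hs
  rcases le_or_gt 1 s with h | h
  · nlinarith
  · have h1 : Real.exp s * (1 - s) ≤ 1 := by
      have := Real.add_one_le_exp (-s)
      calc Real.exp s * (1 - s) ≤ Real.exp s * Real.exp (-s) := by gcongr; linarith
        _ = 1 := by rw [← Real.exp_add]; simp
    have h2 := Real.add_one_le_exp (-s)
    rw [Real.sinh_eq]
    nlinarith

lemma abs_sinh_div_sub_le {b : ℝ} (hb : 0 < b) (s : ℝ) :
    |Real.sinh s / (Real.sinh s ^ 2 + b ^ 2) - s / (s ^ 2 + b ^ 2)| ≤ 1 := by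
  wlog hs : 0 ≤ s generalizing s
  · have := this (-s) (by linarith)
    rw [Real.sinh_neg, neg_sq, neg_sq, neg_div, neg_div, ← neg_sub', abs_neg] at this
    exact this
  have h1 := sinh_sub_self_le hs
  have h2 := Real.self_le_sinh_iff.2 hs
  set S := Real.sinh s
  have hS : 0 ≤ S := hs.trans h2
  have hp1 : 0 < S ^ 2 + b ^ 2 := by positivity
  have hp2 : 0 < s ^ 2 + b ^ 2 := by positivity
  rw [div_sub_div _ _ hp1.ne' hp2.ne', abs_div, abs_of_pos (mul_pos hp1 hp2), div_le_one (by positivity)]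
  have e : S * (s ^ 2 + b ^ 2) - (S ^ 2 + b ^ 2) * s = (S - s) * (b ^ 2 - s * S) := by ring
  rw [e, abs_mul, abs_of_nonneg (by linarith : 0 ≤ S - s)]
  have h3 : |b ^ 2 - s * S| ≤ b ^ 2 + s * S := abs_le.2 ⟨by nlinarith [mul_nonneg hs hS], by
    nlinarith [mul_nonneg hs hS]⟩
  calc (S - s) * |b ^ 2 - s * S| ≤ (s * S) * (b ^ 2 + s * S) := by gcongr
    _ ≤ (S ^ 2 + b ^ 2) * (s ^ 2 + b ^ 2) := by
      nlinarith [sq_nonneg (S - s), sq_nonneg b, mul_nonneg hs hS, mul_nonneg (sq_nonneg b) (mul_nonneg hs hS), mul_nonneg (sq_nonneg b) (sq_nonneg (S-s))]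

end HilbertTransform

section ResolventCurve

variable {E : Type*} [NormedAddCommGroup E] [InnerProductSpace ℂ E] [CompleteSpace E]

/-- The multiplier `e^s (e^s - (σ̄)² e^{-s})⁻¹` for unimodular `σ`. -/
def resolventKernel (σ : ℂ) (s : ℝ) : ℂ :=
  σ * Real.exp s / (σ * Real.exp s - starRingEnd ℂ σ * Real.exp (-s))

lemma resolvent_denom (σ : ℂ) (s : ℝ) :
    σ * Real.exp s - starRingEnd ℂ σ * Real.exp (-s) =
      2 * (σ.re * Real.sinh s + σ.im * Real.cosh s * Complex.I) := by
  apply Complex.ext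
  · simp [Real.sinh_eq, -Complex.ofReal_exp]; ring
  · simp [Real.cosh_eq, -Complex.ofReal_exp]; ring

lemma resolvent_denom_ne_zero {σ : ℂ} (hσ : σ.im ≠ 0) (s : ℝ) :
    σ * Real.exp s - starRingEnd ℂ σ * Real.exp (-s) ≠ 0 := fun h => by
  rw [resolvent_denom] at h
  have := congrArg Complex.im h
  simp [-Complex.ofReal_cosh, -Complex.ofReal_sinh] at this
  exact this.elim hσ (Real.cosh_pos s).ne'

lemma resolventKernel_eq {σ : ℂ} (hσ : σ.im ≠ 0) (h1 : ‖σ‖ = 1) (s : ℝ) :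
    resolventKernel σ s = (1 / 2 : ℝ) * ((Real.exp s * Real.sinh s : ℝ) +
      σ.im * (σ.im - σ.re * Complex.I)) / (Real.sinh s ^ 2 + σ.im ^ 2 : ℝ) := by
  have hd := resolvent_denom_ne_zero hσ s
  have hp : 0 < Real.sinh s ^ 2 + σ.im ^ 2 := by positivity
  have hp' : ((Real.sinh s ^ 2 + σ.im ^ 2 : ℝ) : ℂ) ≠ 0 := by exact_mod_cast hp.ne'
  have hn : σ.re ^ 2 + σ.im ^ 2 = 1 := by
    have := Complex.sq_norm σ
    rw [h1, Complex.normSq_apply] at this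
    linarith
  rw [resolventKernel, div_eq_div_iff hd hp', resolvent_denom]
  have hc := Real.cosh_sq s
  have he := Real.sinh_add_cosh s
  rw [← he]
  generalize Real.sinh s = S at *
  generalize Real.cosh s = C at *
  have hS : (σ.re : ℂ) ^ 2 + (σ.im : ℂ) ^ 2 = 1 := by exact_mod_cast hn
  have hC : (C : ℂ) ^ 2 = S ^ 2 + 1 := by exact_mod_cast hc
  have hσ' : σ = σ.re + σ.im * Complex.I := (Complex.re_add_im σ).symm
  generalize σ.re = a at *
  generalize σ.im = c at *
  rw [hσ']
  push_cast
  linear_combination Complex.I * c * S * (hS - hC) + a * c ^ 2 * C * Complex.I_sq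

lemma norm_resolventKernel_sub_le {σ : ℂ} (hσ : σ.im ≠ 0) (h1 : ‖σ‖ = 1) (s : ℝ) :
    ‖resolventKernel σ s - (1 / 2 : ℝ) * (s / (s ^ 2 + |σ.im| ^ 2) : ℝ)‖ ≤
      (1 / 2) * (|σ.im| / (s ^ 2 + |σ.im| ^ 2)) + 3 / 2 := by
  have hb : 0 < |σ.im| := abs_pos.2 hσ
  rw [resolventKernel_eq hσ h1, ← sq_abs σ.im]
  set S := Real.sinh s with hS
  have hSs : s ^ 2 ≤ S ^ 2 := by
    rw [sq_le_sq, hS, Real.abs_sinh]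
    exact Real.self_le_sinh_iff.2 (abs_nonneg s)
  have hp : 0 < S ^ 2 + |σ.im| ^ 2 := by positivity
  have hp' : ((S ^ 2 + |σ.im| ^ 2 : ℝ) : ℂ) ≠ 0 := by exact_mod_cast hp.ne'
  have e : ((1 / 2 : ℝ) * ((Real.exp s * S : ℝ) +
      σ.im * (σ.im - σ.re * Complex.I)) / (S ^ 2 + |σ.im| ^ 2 : ℝ) -
        (1 / 2 : ℝ) * (s / (s ^ 2 + |σ.im| ^ 2) : ℝ) : ℂ) =
      (1 / 2 : ℝ) * (((Real.exp s - 1) * S / (S ^ 2 + |σ.im| ^ 2) : ℝ) +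
        (S / (S ^ 2 + |σ.im| ^ 2) - s / (s ^ 2 + |σ.im| ^ 2) : ℝ) +
        σ.im * (σ.im - σ.re * Complex.I) / (S ^ 2 + |σ.im| ^ 2 : ℝ)) := by
    rw [Complex.ofReal_div _ (S ^ 2 + |σ.im| ^ 2), Complex.ofReal_sub (S / _),
      Complex.ofReal_div S]
    field_simp
    push_cast
    ring
  rw [e, norm_mul]
  have n1 : ‖(((Real.exp s - 1) * S / (S ^ 2 + |σ.im| ^ 2) : ℝ) : ℂ)‖ ≤ 2 := by
    rw [Complex.norm_real, Real.norm_eq_abs, abs_div, abs_of_pos hp, div_le_iff₀ hp, abs_mul]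
    have := abs_exp_sub_one_le s
    calc |Real.exp s - 1| * |S| ≤ 2 * |S| * |S| := by gcongr
      _ = 2 * S ^ 2 := by rw [mul_assoc, ← sq, sq_abs]
      _ ≤ _ := by nlinarith
  have n2 : ‖((S / (S ^ 2 + |σ.im| ^ 2) - s / (s ^ 2 + |σ.im| ^ 2) : ℝ) : ℂ)‖ ≤ 1 := by
    rw [Complex.norm_real, Real.norm_eq_abs]
    exact abs_sinh_div_sub_le hb s
  have n3 : ‖(σ.im * (σ.im - σ.re * Complex.I) / (S ^ 2 + |σ.im| ^ 2 : ℝ) : ℂ)‖ ≤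
      |σ.im| / (s ^ 2 + |σ.im| ^ 2) := by
    have : (σ.im - σ.re * Complex.I : ℂ) = -Complex.I * σ := by
      apply Complex.ext <;> simp
    rw [norm_div, norm_mul, this, norm_mul, h1, Complex.norm_real, Complex.norm_real,
      Real.norm_of_nonneg hp.le]
    simp only [norm_neg, Complex.norm_I, mul_one, Real.norm_eq_abs]
    gcongr
  rw [Complex.norm_real, Real.norm_of_nonneg (by norm_num)]
  have := norm_add₃_le (a := (((Real.exp s - 1) * S / (S ^ 2 + |σ.im| ^ 2) : ℝ) : ℂ))
    (b := ((S / (S ^ 2 + |σ.im| ^ 2) - s / (s ^ 2 + |σ.im| ^ 2) : ℝ) : ℂ))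
    (c := (σ.im * (σ.im - σ.re * Complex.I) / (S ^ 2 + |σ.im| ^ 2 : ℝ) : ℂ))
  linarith

lemma continuous_resolventKernel {σ : ℂ} (hσ : σ.im ≠ 0) : Continuous (resolventKernel σ) := by
  unfold resolventKernel
  exact Continuous.div (by fun_prop) (by fun_prop) (resolvent_denom_ne_zero hσ)

lemma norm_curveAvg_resolventKernel_le {R : ℝ} (hR : 0 < R) {σ : ℂ} (hσ : σ.im ≠ 0)
    (h1 : ‖σ‖ = 1) {y : ℝ → E} (hy : BddCurve y) (h : JointlyStationary y y) :
    Integrable (fun s => fullExp R 0 s * resolventKernel σ s) ∧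
    ‖curveAvg (fun s => fullExp R 0 s * resolventKernel σ s) y 0‖ ≤
      (Real.pi + 3 / R) * ‖y 0‖ := by
  have hb : 0 < |σ.im| := abs_pos.2 hσ
  set b := |σ.im|
  have hcf : Continuous (fullExp R 0) := by unfold fullExp; fun_prop
  have hp : ∀ s : ℝ, s ^ 2 + b ^ 2 ≠ 0 := fun s => by positivity
  set K1 : ℝ → ℂ := fun s => fullExp R 0 s * ((s / (s ^ 2 + b ^ 2) : ℝ) : ℂ) with hK1
  set K2 : ℝ → ℂ := fun s => fullExp R 0 s *
    (resolventKernel σ s - (1 / 2 : ℝ) * ((s / (s ^ 2 + b ^ 2) : ℝ) : ℂ)) with hK2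
  set k2 : ℝ → ℝ := fun s => (1 / 2) * (b / (s ^ 2 + b ^ 2)) + 3 / 2 * Real.exp (-R * |s|)
  have hk2 : Integrable k2 := ((integral_poisson hb).1.const_mul _).add
    ((integrable_exp_neg_mul_abs hR).const_mul _)
  have hc1 : Continuous fun s : ℝ => ((s / (s ^ 2 + b ^ 2) : ℝ) : ℂ) :=
    Complex.continuous_ofReal.comp (Continuous.div (by fun_prop) (by fun_prop) hp)
  have hle : ∀ s, ‖K2 s‖ ≤ k2 s := fun s => by
    have h0 : 0 ≤ b / (s ^ 2 + b ^ 2) := by positivity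
    have hexp : Real.exp (-R * |s|) ≤ 1 := Real.exp_le_one_iff.2 (by nlinarith [abs_nonneg s])
    simp only [hK2, norm_mul, norm_fullExp]
    refine (mul_le_mul_of_nonneg_left (norm_resolventKernel_sub_le hσ h1 s)
      (Real.exp_nonneg _)).trans ?_
    simp only [k2]
    nlinarith
  have hK2i : Integrable K2 := hk2.mono' (Continuous.aestronglyMeasurable (by
    have := continuous_resolventKernel hσ
    fun_prop)) (Filter.Eventually.of_forall hle)
  have hK1i : Integrable K1 := by
    refine ((integrable_exp_neg_mul_abs hR).mul_const (1 / b)).mono'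
      (Continuous.aestronglyMeasurable (by fun_prop)) (Filter.Eventually.of_forall fun s => ?_)
    rw [hK1, norm_mul, norm_fullExp, Complex.norm_real, Real.norm_eq_abs, abs_div,
      abs_of_pos (by positivity : 0 < s ^ 2 + b ^ 2)]
    refine mul_le_mul_of_nonneg_left ?_ (Real.exp_nonneg _)
    rw [div_le_div_iff₀ (by positivity) hb]
    nlinarith [sq_abs s, sq_nonneg (|s| - b), abs_nonneg s]
  have hsum : (fun s => fullExp R 0 s * resolventKernel σ s) =
      fun s => (1 / 2 : ℂ) * K1 s + K2 s := by
    funext s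
    simp only [hK1, hK2]
    push_cast
    ring
  rw [hsum]
  refine ⟨(hK1i.const_mul _).add hK2i, ?_⟩
  have e : curveAvg (fun s => (1 / 2 : ℂ) * K1 s + K2 s) y 0 =
      (1 / 2 : ℂ) • curveAvg K1 y 0 + curveAvg K2 y 0 := by
    simp only [curveAvg, add_smul, mul_smul]
    rw [← integral_smul]
    exact integral_add ((hy.integrable hK1i 0).smul (1 / 2 : ℂ)) (hy.integrable hK2i 0)
  rw [e]
  have n1 := norm_hilbert_le hR hb hy h
  have n2 := norm_curveAvg_le h hk2 hle
  have hk : ∫ s, k2 s = Real.pi / 2 + 3 / R := by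
    simp only [k2]
    rw [integral_add ((integral_poisson hb).1.const_mul _)
      ((integrable_exp_neg_mul_abs hR).const_mul _), integral_const_mul, integral_const_mul,
      (integral_poisson hb).2, integral_exp_neg_mul_abs hR]
    ring
  rw [hk] at n2
  refine (norm_add_le _ _).trans ?_
  rw [norm_smul]
  have : ‖(1 / 2 : ℂ)‖ = 1 / 2 := by simp
  rw [this]
  nlinarith

/-- The backward exponential average of a curve. -/
def pastAvg (R : ℝ) (x : ℝ → E) : ℝ → E := curveAvg (fun u => halfExp R 0 (-u)) x

lemma curveAvg_reflect (K : ℝ → ℂ) (x : ℝ → E) (s : ℝ) :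
    curveAvg K (fun s => x (-s)) s = curveAvg (fun u => K (-u)) x (-s) := by
  simp only [curveAvg]
  rw [← integral_neg_eq_self]
  congr 1 with u
  congr 2
  ring

lemma two_mul_norm_pastAvg_sq {R : ℝ} (hR : 0 < R) {x : ℝ → E} (hx : BddCurve x)
    (h : JointlyStationary x x) :
    ((2 * R * ‖pastAvg R x 0‖ ^ 2 : ℝ) : ℂ) = ∫ d, fullExp R 0 d * inner ℂ (x 0) (x d) := by
  have hx' : BddCurve fun s => x (-s) := ⟨hx.1.comp continuous_neg, hx.2.imp fun C hC s => hC _⟩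
  have h' : JointlyStationary (fun s => x (-s)) (fun s => x (-s)) := fun a s t => by
    have := h (-a) (-s) (-t)
    rwa [← neg_add, ← neg_add] at this
  have e := two_mul_inner_halfExp hR 0 hx' hx' h'
  rw [curveAvg_reflect, inner_self_eq_norm_sq_to_K, ← integral_neg_eq_self] at e
  simp only [neg_zero, neg_neg] at e
  have hf : ∀ d, fullExp R 0 (-d) = fullExp R 0 d := fun d => by simp [fullExp]
  simp_rw [hf] at e
  rw [← e, pastAvg]
  simp only [Complex.coe_algebraMap]
  push_cast
  ring

/-- The curve lemma: a stationary curve whose covariance obeys the resolvent relation has its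
backward average controlled by the representing vector. -/
lemma norm_pastAvg_le {R : ℝ} (hR : 4 ≤ R) {σ : ℂ} (hσ : σ.im ≠ 0) {x : ℝ → E}
    (hc : Continuous x) (h : JointlyStationary x x) (η : E)
    (hrel : ∀ s : ℝ, (σ * Real.exp s - starRingEnd ℂ σ * Real.exp (-s)) * inner ℂ (x 0) (x s) =
      -(σ * (Real.exp s * inner ℂ η (pastAvg R x s)) - starRingEnd ℂ σ *
        (Real.exp (-s) * starRingEnd ℂ (inner ℂ η (pastAvg R x (-s)))))) :
    R * ‖pastAvg R x 0‖ ≤ 4 * ‖η‖ := by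
  wlog h1 : ‖σ‖ = 1 generalizing σ
  · have hσ0 : ‖σ‖ ≠ 0 := fun h0 => hσ (by simp [norm_eq_zero.1 h0])
    have hσ0' : (‖σ‖ : ℂ) ≠ 0 := by exact_mod_cast hσ0
    refine this (σ := σ / ‖σ‖) ?_ (fun s => ?_) (by simp [hσ0])
    · rw [Complex.div_ofReal_im]; exact div_ne_zero hσ hσ0
    · have := hrel s
      rw [map_div₀, Complex.conj_ofReal]
      linear_combination (1 / (‖σ‖ : ℂ)) * this
  have hR0 : 0 < R := by linarith
  have hx := h.bddCurve hc
  have hKb : Integrable fun u => halfExp R 0 (-u) := (integrable_halfExp hR0 0).comp_neg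
  set y := pastAvg R x
  have hy : BddCurve y := hx.curveAvg hKb
  have hyy : JointlyStationary y y := (h.curveAvg_right hx hKb).curveAvg_left hx hKb
  obtain ⟨hmi, hmle⟩ := norm_curveAvg_resolventKernel_le hR0 hσ h1 hy hyy
  set Z : ℝ → ℂ := fun s => fullExp R 0 s * resolventKernel σ s * inner ℂ η (y s)
  have hZ : ∫ s, Z s =
      inner ℂ η (curveAvg (fun s => fullExp R 0 s * resolventKernel σ s) y 0) := by
    rw [inner_curveAvg_right hy hmi]
    simp [Z]
  have hZi : Integrable Z := by
    have := (hy.integrable hmi 0).const_inner (𝕜 := ℂ) η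
    simpa [inner_smul_right] using this
  have hk : ∀ s, fullExp R 0 s * inner ℂ (x 0) (x s) = -(Z s + starRingEnd ℂ (Z (-s))) := fun s => by
    have hd := resolvent_denom_ne_zero hσ s
    have hd' := resolvent_denom_ne_zero hσ (-s)
    have hconj : starRingEnd ℂ (resolventKernel σ (-s)) = -(starRingEnd ℂ σ * Real.exp (-s)) /
        (σ * Real.exp s - starRingEnd ℂ σ * Real.exp (-s)) := by
      simp only [resolventKernel, map_div₀, map_mul, map_sub, Complex.conj_ofReal,
        Complex.conj_conj, neg_neg]
      rw [← neg_sub, neg_div, div_neg]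
    simp only [Z, map_mul, hconj, conj_fullExp, neg_neg]
    rw [resolventKernel]
    have := hrel s
    field_simp
    linear_combination fullExp R 0 s * this
  have e := two_mul_norm_pastAvg_sq hR0 hx h
  simp_rw [hk] at e
  have hZc : ∫ s, starRingEnd ℂ (Z (-s)) = starRingEnd ℂ (∫ s, Z s) := by
    rw [integral_neg_eq_self (fun s => starRingEnd ℂ (Z s)), integral_conj]
  have hZci : Integrable fun s => starRingEnd ℂ (Z (-s)) :=
    (Complex.conjLIE.toContinuousLinearEquiv : ℂ →L[ℝ] ℂ).integrable_comp hZi.comp_neg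
  rw [integral_neg, integral_add hZi hZci, hZc, hZ] at e
  have e2 := congrArg Complex.re e
  rw [Complex.ofReal_re, Complex.neg_re, Complex.add_re, Complex.conj_re] at e2
  have hb := (Complex.abs_re_le_norm _).trans
    ((norm_inner_le_norm η (curveAvg (fun s => fullExp R 0 s * resolventKernel σ s) y 0)).trans
      (mul_le_mul_of_nonneg_left hmle (norm_nonneg _)))
  have hb' := (abs_le.1 hb).1
  have hpi : Real.pi + 3 / R ≤ 4 := by
    have : 3 / R ≤ 3 / 4 := by gcongr
    linarith [Real.pi_lt_d2]
  rcases eq_or_lt_of_le (norm_nonneg (y 0)) with h0 | h0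
  · rw [← h0]; simp
  · have h4 : ‖η‖ * ((Real.pi + 3 / R) * ‖y 0‖) ≤ ‖η‖ * (4 * ‖y 0‖) := by gcongr
    have : R * ‖y 0‖ * ‖y 0‖ ≤ 4 * ‖η‖ * ‖y 0‖ := by nlinarith
    exact le_of_mul_le_mul_right this h0

end ResolventCurve

open LineDeriv in
/-- Directional derivative on Schwartz functions. -/
def dv {d : ℕ} (m : Hd d) : Module.End ℂ (SchwartzMap (Hd d) ℂ) :=
  (lineDerivOpCLM ℂ (SchwartzMap (Hd d) ℂ) m).toLinearMap

/-- Multiplication of Schwartz functions by a real linear functional. -/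
def mu {d : ℕ} (l : Hd d →L[ℝ] ℝ) : Module.End ℂ (SchwartzMap (Hd d) ℂ) :=
  (SchwartzMap.smulLeftCLM ℂ (fun p : Hd d => ((l p : ℝ) : ℂ))).toLinearMap

lemma dv_apply {d : ℕ} (m : Hd d) (f : SchwartzMap (Hd d) ℂ) (p : Hd d) :
    dv m f p = fderiv ℝ f p m := rfl

lemma mu_apply {d : ℕ} (l : Hd d →L[ℝ] ℝ) (f : SchwartzMap (Hd d) ℂ) (p : Hd d) :
    mu l f p = (l p : ℂ) * f p := by
  have : Function.HasTemperateGrowth (fun p : Hd d => ((l p : ℝ) : ℂ)) :=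
    (Complex.ofRealCLM.comp l).hasTemperateGrowth
  simp [mu, SchwartzMap.smulLeftCLM_apply_apply this]

lemma dv_comm {d : ℕ} (m n : Hd d) : dv m * dv n = dv n * dv m := by
  ext f p
  have hs : ContDiff ℝ 2 f := f.smooth 2
  have hd : DifferentiableAt ℝ (fderiv ℝ f) p :=
    ((hs.fderiv_right (m := 1) (by norm_num)).differentiable (by norm_num)) p
  have key : ∀ a b : Hd d, (dv a (dv b f)) p = fderiv ℝ (fderiv ℝ f) p a b := by
    intro a b
    rw [dv_apply]
    have : (⇑(dv b f) : Hd d → ℂ) = fun q => fderiv ℝ f q b := by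
      funext q; rfl
    rw [this]
    rw [fderiv_clm_apply hd (differentiableAt_const b)]
    simp
  show (dv m (dv n f)) p = (dv n (dv m f)) p
  rw [key, key]
  exact (hs.contDiffAt.isSymmSndFDerivAt (by simp)).eq m n

lemma mu_comm {d : ℕ} (l k : Hd d →L[ℝ] ℝ) : mu l * mu k = mu k * mu l := by
  ext f p
  show (mu l (mu k f)) p = (mu k (mu l f)) p
  simp only [mu_apply]; ring

lemma dv_mul_mu {d : ℕ} (m : Hd d) (l : Hd d →L[ℝ] ℝ) :
    dv m * mu l = mu l * dv m + ((l m : ℝ) : ℂ) • 1 := by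
  ext f p
  show (dv m (mu l f)) p = mu l (dv m f) p + (l m : ℂ) * f p
  rw [dv_apply]
  have : (⇑(mu l f) : Hd d → ℂ) = fun q => (Complex.ofRealCLM.comp l) q * f q := by
    funext q; rw [mu_apply]; rfl
  rw [this, fderiv_fun_mul (by fun_prop) f.differentiableAt]
  rw [mu_apply, dv_apply]
  simp [mul_comm]

lemma dv_smul {d : ℕ} (r : ℝ) (n : Hd d) : dv (r • n) = (r : ℂ) • dv n := by
  ext f p
  simp [dv_apply]

instance isAddHaarMeasure_volume_Hd (d : ℕ) : (volume : Measure (Hd d)).IsAddHaarMeasure := by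
  have h : (volume : Measure (EuclideanSpace ℝ (Fin d) × ℝ)).IsAddHaarMeasure :=
    Measure.prod.instIsAddHaarMeasure _ _
  exact Measure.prod.instIsAddHaarMeasure _ _

/-- The embedding of Schwartz functions into `L²`. -/
def toL2 {d : ℕ} : SchwartzMap (Hd d) ℂ →ₗ[ℂ] Lp ℂ 2 (volume : Measure (Hd d)) :=
  (SchwartzMap.toLpCLM ℂ ℂ 2 volume).toLinearMap

lemma inner_toL2 {d : ℕ} (f g : SchwartzMap (Hd d) ℂ) :
    inner ℂ (toL2 f) (toL2 g) = ∫ p, starRingEnd ℂ (f p) * g p := by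
  have := SchwartzMap.inner_toL2_toL2_eq f g volume
  refine this.trans ?_
  congr 1; ext p
  simp [mul_comm]

lemma inner_toL2_dv {d : ℕ} (m : Hd d) (f g : SchwartzMap (Hd d) ℂ) :
    inner ℂ (toL2 (dv m f)) (toL2 g) = - inner ℂ (toL2 f) (toL2 (dv m g)) := by
  have h := SchwartzMap.integral_bilinear_lineDerivOp_right_eq_neg_left (μ := volume) f g
    ((ContinuousLinearMap.mul ℝ ℂ).comp Complex.conjCLE.toContinuousLinearMap) m
  rw [inner_toL2, inner_toL2]
  have h' : ∫ p, starRingEnd ℂ (f p) * (dv m g) p = - ∫ p, starRingEnd ℂ (dv m f p) * g p := h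
  rw [h', neg_neg]

lemma inner_toL2_mu {d : ℕ} (l : Hd d →L[ℝ] ℝ) (f g : SchwartzMap (Hd d) ℂ) :
    inner ℂ (toL2 (mu l f)) (toL2 g) = inner ℂ (toL2 f) (toL2 (mu l g)) := by
  rw [inner_toL2, inner_toL2]
  congr 1; ext p
  simp only [mu_apply, map_mul, Complex.conj_ofReal]; ring

lemma denseRange_toL2 {d : ℕ} : DenseRange (toL2 (d := d)) :=
  SchwartzMap.denseRange_toLpCLM (E := Hd d) (F := ℂ) (p := 2) (μ := volume) (by norm_num)

lemma hasTemperateGrowth_inv_one_sub {E : Type*} [NormedAddCommGroup E] [InnerProductSpace ℝ E]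
    (v : E) : Function.HasTemperateGrowth
      (fun x : E => (1 - 2 * Real.pi * Complex.I * (inner ℝ x v : ℝ))⁻¹) := by
  have h1 : (fun x : ℝ => (1 + ‖x‖^2) ^ (-1:ℝ)).HasTemperateGrowth :=
    Function.hasTemperateGrowth_one_add_norm_sq_rpow ℝ (-1)
  have h2 := h1.comp ((2 * Real.pi) • (innerSL ℝ v)).hasTemperateGrowth
  have h3 := Complex.ofRealCLM.hasTemperateGrowth.comp h2
  have h4 := (Function.HasTemperateGrowth.const (E := E) (1:ℂ)).add
    ((2 * Real.pi * Complex.I) • Complex.ofRealCLM.comp (innerSL ℝ v)).hasTemperateGrowth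
  refine (congrArg Function.HasTemperateGrowth (funext fun x => ?_)).mp (h3.mul h4)
  symm
  have hne : (1 + (2 * Real.pi * inner ℝ v x) ^ 2 : ℝ) ≠ 0 := by positivity
  have hne' : (1 + (2 * Real.pi * inner ℝ v x) ^ 2 : ℂ) ≠ 0 := by exact_mod_cast hne
  have hm : (1 - 2 * Real.pi * Complex.I * (inner ℝ v x : ℝ))
    * (1 + 2 * Real.pi * Complex.I * (inner ℝ v x : ℝ))
      = (1 + (2 * Real.pi * inner ℝ v x) ^ 2 : ℂ) := by
    linear_combination (-(2 * Real.pi * inner ℝ v x) ^ 2 : ℂ) * Complex.I_sq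
  have hl : (1 - 2 * Real.pi * Complex.I * (inner ℝ v x : ℝ)) ≠ 0 := by
    intro h; rw [h, zero_mul] at hm; exact hne' hm.symm
  rw [real_inner_comm]
  simp only [Pi.mul_apply, Function.comp_apply, Complex.ofRealCLM_apply, Pi.add_apply,
    FunLike.coe_smul, Pi.smul_apply, innerSL_apply_apply, smul_eq_mul,
    Real.rpow_neg_one, Real.norm_eq_abs, sq_abs, ContinuousLinearMap.comp_apply]
  push_cast
  rw [inv_eq_iff_eq_inv, mul_inv, inv_inv, ← hm]
  have hr : (1 + 2 * Real.pi * Complex.I * (inner ℝ v x : ℝ)) ≠ 0 := by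
    intro h; rw [h, mul_zero] at hm; exact hne' hm.symm
  field_simp

open LineDeriv FourierTransform SchwartzMap in
/-- `1 - ∂_m` is invertible on Schwartz functions. -/
lemma exists_inv_one_sub_dv {d : ℕ} (m : Hd d) :
    ∃ J : Module.End ℂ (SchwartzMap (Hd d) ℂ), J * (1 - dv m) = 1 ∧ (1 - dv m) * J = 1 := by
  let g := toEuclidean (E := Hd d)
  obtain ⟨s, hsg, hs⟩ : ∃ s : EuclideanSpace ℝ (Fin (Module.finrank ℝ (Hd d))) → ℂ,
      Function.HasTemperateGrowth s ∧
        ∀ x, s x = (1 - 2 * Real.pi * Complex.I * (inner ℝ x (g m) : ℝ))⁻¹ :=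
    ⟨_, hasTemperateGrowth_inv_one_sub (g m), fun _ => rfl⟩
  have hinv : ∀ f : 𝓢(EuclideanSpace ℝ (Fin (Module.finrank ℝ (Hd d))), ℂ), 𝓕⁻ (𝓕 f) = f :=
    fun f => FourierTransform.fourierInv_fourier_eq (F := 𝓢(_, ℂ)) f
  have hin : Function.HasTemperateGrowth (fun x => inner ℝ x (g m) : _ → ℝ) :=
    ((innerSL ℝ).flip (g m)).hasTemperateGrowth
  let A : SchwartzMap (Hd d) ℂ →L[ℂ] _ := compCLMOfContinuousLinearEquiv ℂ g.symm
  let B : _ →L[ℂ] SchwartzMap (Hd d) ℂ := compCLMOfContinuousLinearEquiv ℂ g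
  have hAB : ∀ f, A (B f) = f := by intro f; ext x; simp [A, B]
  have hBA : ∀ f, B (A f) = f := by intro f; ext x; simp [A, B]
  have hB : ∀ f, dv m (B f) = B (∂_{g m} f) := fun f =>
    lineDerivOp_compCLMOfContinuousLinearEquiv ℂ m g f
  have hA : ∀ f, A (dv m f) = ∂_{g m} (A f) := by
    intro f
    conv_lhs => rw [← hBA f, hB, hAB]
  let M := (fourierMultiplierCLM ℂ s)
  have hne : ∀ x : EuclideanSpace ℝ (Fin (Module.finrank ℝ (Hd d))),
      (1 - 2 * Real.pi * Complex.I * (inner ℝ x (g m) : ℝ)) ≠ 0 := by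
    intro x h
    have := congrArg Complex.re h
    simp at this
  have hF : ∀ f : SchwartzMap (EuclideanSpace ℝ (Fin (Module.finrank ℝ (Hd d)))) ℂ,
      𝓕 (f - ∂_{g m} f) = 𝓕 f - (2 * Real.pi * Complex.I) • smulLeftCLM ℂ (inner ℝ · (g m)) (𝓕 f) := by
    intro f
    rw [← fourier_lineDerivOp_eq]
    exact (fourierCLM ℂ 𝓢(_, ℂ)).map_sub _ _
  have h1 : ∀ f, M (f - ∂_{g m} f) = f := by
    intro f
    show fourierMultiplierCLM ℂ s _ = f
    rw [fourierMultiplierCLM_apply, hF]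
    conv_rhs => rw [← hinv f]
    congr 1
    ext x
    rw [smulLeftCLM_apply_apply hsg]
    simp only [sub_apply, smul_apply, smulLeftCLM_apply_apply hin, hs,
      smul_eq_mul, Complex.real_smul]
    field_simp [hne x]
  have h2 : ∀ f, M f - ∂_{g m} (M f) = f := by
    intro f
    have : 𝓕 (M f - ∂_{g m} (M f)) = 𝓕 f := by
      rw [hF]
      show 𝓕 (fourierMultiplierCLM ℂ s f) - (2 * Real.pi * Complex.I) • smulLeftCLM ℂ (inner ℝ · (g m))
        (𝓕 (fourierMultiplierCLM ℂ s f)) = _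
      rw [fourierMultiplierCLM_apply, FourierTransform.fourier_fourierInv_eq]
      ext x
      simp only [sub_apply, smul_apply, smulLeftCLM_apply_apply hin,
        smulLeftCLM_apply_apply hsg, hs, smul_eq_mul, Complex.real_smul]
      field_simp [hne x]
    rw [← hinv (M f - ∂_{g m} (M f)), this, hinv]
  refine ⟨(B.comp (M.comp A)).toLinearMap, ?_, ?_⟩
  · ext1 f
    show B (M (A (f - dv m f))) = f
    rw [map_sub, hA, h1, hBA]
  · ext1 f
    show B (M (A f)) - dv m (B (M (A f))) = f
    rw [hB, ← map_sub, h2, hBA]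

section UniformResolvent

/-- Schwartz functions on the Heisenberg group. -/
abbrev Sc (d : ℕ) : Type := SchwartzMap (Hd d) ℂ

/-- The horizontal coordinate directions. -/
def ev (d : ℕ) : Fin d ⊕ Fin d → Hd d
  | .inl j => (EuclideanSpace.single j 1, 0, 0)
  | .inr j => (0, EuclideanSpace.single j 1, 0)

/-- The vertical direction. -/
def tv (d : ℕ) : Hd d := (0, 0, 1)

/-- The horizontal coordinates. -/
def qf (d : ℕ) : Fin d ⊕ Fin d → (Hd d →L[ℝ] ℝ)
  | .inl j => (EuclideanSpace.proj j).comp (ContinuousLinearMap.fst ℝ _ _)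
  | .inr j => (EuclideanSpace.proj j).comp
      ((ContinuousLinearMap.fst ℝ _ _).comp (ContinuousLinearMap.snd ℝ _ _))

/-- The symplectically conjugate horizontal coordinates. -/
def qc (d : ℕ) : Fin d ⊕ Fin d → (Hd d →L[ℝ] ℝ)
  | .inl j => qf d (.inr j)
  | .inr j => - qf d (.inl j)

/-- The vertical coordinate. -/
def tf (d : ℕ) : Hd d →L[ℝ] ℝ :=
  (ContinuousLinearMap.snd ℝ _ _).comp (ContinuousLinearMap.snd ℝ _ _)

/-- The vertical derivative as an operator. -/
def Tt (d : ℕ) : Module.End ℂ (Sc d) := dv (tv d)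

/-- The left-invariant horizontal fields as operators. -/
def Xk (d : ℕ) (k : Fin d ⊕ Fin d) : Module.End ℂ (Sc d) :=
  dv (ev d k) + (2 : ℂ) • (mu (qc d k) * Tt d)

/-- The generator of dilations. -/
def Dop (d : ℕ) : Module.End ℂ (Sc d) :=
  ∑ k, mu (qf d k) * Xk d k + (2 : ℂ) • (mu (tf d) * Tt d)

/-- The sublaplacian as an operator. -/
def Lap (d : ℕ) : Module.End ℂ (Sc d) := ∑ k, Xk d k * Xk d k

variable {d : ℕ}

lemma qf_ev (k l : Fin d ⊕ Fin d) : qf d k (ev d l) = if l = k then 1 else 0 := by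
  rcases k with k | k <;> rcases l with l | l <;>
    simp [qf, ev, eq_comm]

lemma qf_tv (k : Fin d ⊕ Fin d) : qf d k (tv d) = 0 := by
  rcases k with k | k <;> simp [qf, tv]

lemma qc_tv (k : Fin d ⊕ Fin d) : qc d k (tv d) = 0 := by
  rcases k with k | k <;> simp [qc, qf_tv]

lemma tf_ev (k : Fin d ⊕ Fin d) : tf d (ev d k) = 0 := by
  rcases k with k | k <;> simp [tf, ev]

lemma tf_tv : tf d (tv d) = 1 := by simp [tf, tv]

lemma Tt_mul_mu (l : Hd d →L[ℝ] ℝ) (hl : l (tv d) = 0) : Tt d * mu l = mu l * Tt d := by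
  rw [Tt, dv_mul_mu, hl]; simp

lemma Tt_mul_tf : Tt d * mu (tf d) = mu (tf d) * Tt d + 1 := by
  rw [Tt, dv_mul_mu, tf_tv]; simp

lemma Xk_mul_Tt (k : Fin d ⊕ Fin d) : Xk d k * Tt d = Tt d * Xk d k := by
  have h : Tt d * dv (ev d k) = dv (ev d k) * Tt d := dv_comm _ _
  rw [Xk, add_mul, mul_add, h, smul_mul_assoc, mul_smul_comm, mul_assoc, ← mul_assoc (Tt d),
    Tt_mul_mu _ (qc_tv k), mul_assoc]

lemma Xk_mul_mu (k : Fin d ⊕ Fin d) (l : Hd d →L[ℝ] ℝ) :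
    Xk d k * mu l = mu l * Xk d k + ((l (ev d k) : ℝ) : ℂ) • 1
      + (2 * (l (tv d) : ℝ) : ℂ) • mu (qc d k) := by
  have h : Tt d * mu l = mu l * Tt d + ((l (tv d) : ℝ) : ℂ) • 1 := dv_mul_mu _ _
  rw [Xk, add_mul, dv_mul_mu, smul_mul_assoc, mul_assoc, h, mul_add, ← mul_assoc, mu_comm _ l,
    mul_add, mul_smul_comm, mul_smul_comm, mul_assoc, mul_one]
  module

lemma mu_neg (l : Hd d →L[ℝ] ℝ) : mu (-l) = - mu l := by
  ext f p
  simp [mu_apply]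

lemma Xk_comm (j : Fin d) : Xk d (.inl j) * Xk d (.inr j)
    = Xk d (.inr j) * Xk d (.inl j) - (4 : ℂ) • Tt d := by
  have e1 : Xk d (.inl j) * mu (qf d (.inl j)) = mu (qf d (.inl j)) * Xk d (.inl j) + 1 := by
    rw [Xk_mul_mu, qf_ev, qf_tv]; simp
  have e2 : mu (qf d (.inr j)) * dv (ev d (.inr j)) = dv (ev d (.inr j)) * mu (qf d (.inr j)) - 1 := by
    rw [dv_mul_mu, qf_ev]; simp
  have h1 : dv (ev d (.inl j)) * mu (qf d (.inl j)) = mu (qf d (.inl j)) * dv (ev d (.inl j)) + 1 := by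
    rw [dv_mul_mu, qf_ev]; simp
  have hc := dv_comm (ev d (.inl j)) (ev d (.inr j))
  have hm := mu_comm (qf d (.inl j)) (qf d (.inr j))
  have ht1 : Tt d * dv (ev d (.inl j)) = dv (ev d (.inl j)) * Tt d := dv_comm _ _
  have ht2 : Tt d * dv (ev d (.inr j)) = dv (ev d (.inr j)) * Tt d := dv_comm _ _
  have hq1 := Tt_mul_mu (qf d (.inl j)) (qf_tv (d := d) _)
  have hq2 := Tt_mul_mu (qf d (.inr j)) (qf_tv (d := d) _)
  simp only [Xk, qc, mu_neg]
  generalize dv (ev d (.inl j)) = a at *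
  generalize dv (ev d (.inr j)) = b at *
  generalize mu (qf d (.inl j)) = p at *
  generalize mu (qf d (.inr j)) = q at *
  generalize Tt d = T at *
  have A1 : a * (p * T) = p * (a * T) + T := by
    rw [← mul_assoc, h1, add_mul, one_mul, mul_assoc]
  have A2 : (q * T) * b = (b * q) * T - T := by
    rw [mul_assoc, ht2, ← mul_assoc, e2, sub_mul, one_mul]
  have A3 : (p * T) * a = p * (a * T) := by rw [mul_assoc, ht1]
  have A4 : (q * T) * (p * T) = (p * T) * (q * T) := by
    rw [mul_assoc, ← mul_assoc T, hq1, mul_assoc p, ← mul_assoc q, ← hm, mul_assoc, mul_assoc,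
      ← mul_assoc T, hq2, mul_assoc]
  simp only [add_mul, mul_add, smul_mul_assoc, mul_smul_comm, neg_mul, mul_neg, smul_neg, A1, A2,
    A3, A4, hc, ← mul_assoc b q T]
  module

lemma inner_toL2_Tt (f g : Sc d) : inner ℂ (toL2 (Tt d f)) (toL2 g)
    = - inner ℂ (toL2 f) (toL2 (Tt d g)) := inner_toL2_dv _ _ _

lemma inner_toL2_Xk (k : Fin d ⊕ Fin d) (f g : Sc d) : inner ℂ (toL2 (Xk d k f)) (toL2 g)
    = - inner ℂ (toL2 f) (toL2 (Xk d k g)) := by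
  have h : mu (qc d k) (Tt d g) = Tt d (mu (qc d k) g) := by
    have := Tt_mul_mu (qc d k) (qc_tv k)
    exact (congrArg (fun A : Module.End ℂ (Sc d) => A g) this).symm
  simp only [Xk, LinearMap.add_apply, LinearMap.smul_apply, Module.End.mul_apply, map_add,
    map_smul, inner_add_left, inner_add_right, inner_smul_left, inner_smul_right,
    inner_toL2_dv (ev d k), inner_toL2_mu, inner_toL2_Tt, h, map_ofNat]
  ring

lemma Tt_apply (f : Sc d) (p : Hd d) : Tt d f p = fderiv ℝ f p (0, 0, 1) := rfl

lemma Xk_apply (k : Fin d ⊕ Fin d) (f : Sc d) (p : Hd d) :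
    Xk d k f p = fderiv ℝ f p (ev d k + (2 * qc d k p) • tv d) := by
  show dv (ev d k) f p + 2 * (mu (qc d k) (Tt d f)) p = _
  rw [mu_apply, map_add, map_smul, Tt, dv_apply, dv_apply, Complex.real_smul]
  push_cast; ring

lemma Xk_inl_apply (j : Fin d) (f : Sc d) : ⇑(Xk d (.inl j) f) = Xop d j f := by
  ext p
  rw [Xk_apply, Xop]
  simp [ev, tv, qc, qf]

lemma Xk_inr_apply (j : Fin d) (f : Sc d) : ⇑(Xk d (.inr j) f) = Yop d j f := by
  ext p
  rw [Xk_apply, Yop]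
  simp [ev, tv, qc, qf]

lemma Lap_apply (f : Sc d) (p : Hd d) : Lap d f p = subLap d f p := by
  simp only [Lap, subLap, LinearMap.sum_apply, Fintype.sum_sum_type, Finset.sum_add_distrib,
    sum_apply, Module.End.mul_apply, LinearMap.add_apply, add_apply,
    Xk_inl_apply, Xk_inr_apply]

/-- The resolvent `(1 - T / r)⁻¹` of the vertical derivative. -/
def Jop (d : ℕ) (r : ℝ) : Module.End ℂ (Sc d) := (exists_inv_one_sub_dv (r⁻¹ • tv d)).choose

lemma Jop_mul (r : ℝ) : Jop d r * (1 - ((r : ℂ)⁻¹) • Tt d) = 1 := by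
  have := (exists_inv_one_sub_dv (r⁻¹ • tv d)).choose_spec.1
  have e : ((r : ℂ)⁻¹) • Tt d = dv (r⁻¹ • tv d) := by rw [dv_smul, Tt]; simp
  rw [e]; exact this

lemma mul_Jop (r : ℝ) : (1 - ((r : ℂ)⁻¹) • Tt d) * Jop d r = 1 := by
  have := (exists_inv_one_sub_dv (r⁻¹ • tv d)).choose_spec.2
  have e : ((r : ℂ)⁻¹) • Tt d = dv (r⁻¹ • tv d) := by rw [dv_smul, Tt]; simp
  rw [e]; exact this

/-- Operators commuting with `T` commute with its resolvents. -/
lemma Jop_comm {B : Module.End ℂ (Sc d)} (h : Commute B (Tt d)) (r : ℝ) : Commute B (Jop d r) := by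
  have h' : Commute B (1 - ((r : ℂ)⁻¹) • Tt d) := (Commute.one_right B).sub_right (h.smul_right _)
  exact h'.units_inv_right (u := ⟨_, _, mul_Jop r, Jop_mul r⟩)

lemma Tt_comm_Jop (r : ℝ) : Commute (Tt d) (Jop d r) := Jop_comm (Commute.refl _) r

lemma Tt_mul_Jop {r : ℝ} (hr : r ≠ 0) : Tt d * Jop d r = (r : ℂ) • (Jop d r - 1) := by
  have h := mul_Jop (d := d) r
  rw [sub_mul, one_mul, smul_mul_assoc, sub_eq_iff_eq_add] at h
  have hr' : (r : ℂ) ≠ 0 := by exact_mod_cast hr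
  have h2 : ((r : ℂ)⁻¹) • (Tt d * Jop d r) = Jop d r - 1 := by
    exact (sub_eq_of_eq_add' h).symm
  rw [← h2, smul_smul, mul_inv_cancel₀ hr', one_smul]

lemma Jop_mul_Jop {a b : ℝ} (ha : a ≠ 0) (hb : b ≠ 0) (hab : a ≠ b) :
    Jop d a * Jop d b = (((b - a : ℝ) : ℂ)⁻¹) • ((b : ℂ) • Jop d a - (a : ℂ) • Jop d b) := by
  have h1 : Tt d * Jop d a * Jop d b = (a : ℂ) • (Jop d a * Jop d b - Jop d b) := by
    rw [Tt_mul_Jop ha, smul_mul_assoc, sub_mul, one_mul]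
  have h2 : Tt d * Jop d a * Jop d b = (b : ℂ) • (Jop d a * Jop d b - Jop d a) := by
    rw [(Tt_comm_Jop a).eq, mul_assoc, Tt_mul_Jop hb, mul_smul_comm, mul_sub, mul_one]
  have hne : ((b - a : ℝ) : ℂ) ≠ 0 := by
    exact_mod_cast sub_ne_zero.mpr (Ne.symm hab)
  rw [eq_inv_smul_iff₀ hne]
  have h3 := h1.symm.trans h2
  have e : ((b - a : ℝ) : ℂ) • (Jop d a * Jop d b) - ((b : ℂ) • Jop d a - (a : ℂ) • Jop d b)
    = (b : ℂ) • (Jop d a * Jop d b - Jop d a) - (a : ℂ) • (Jop d a * Jop d b - Jop d b) := by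
    push_cast; module
  rw [← sub_eq_zero, e, ← h3, sub_self]

lemma Jop_mul_tf {r : ℝ} : Jop d r * mu (tf d) = mu (tf d) * Jop d r
    + ((r : ℂ)⁻¹) • (Jop d r * Jop d r) := by
  have h : (1 - ((r : ℂ)⁻¹) • Tt d) * mu (tf d)
      = mu (tf d) * (1 - ((r : ℂ)⁻¹) • Tt d) - ((r : ℂ)⁻¹) • 1 := by
    rw [sub_mul, smul_mul_assoc, Tt_mul_tf, mul_sub, mul_smul_comm]; simp only [one_mul, mul_one]
    module
  have h2 : Jop d r * ((1 - ((r : ℂ)⁻¹) • Tt d) * mu (tf d)) * Jop d r = mu (tf d) * Jop d r := by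
    rw [← mul_assoc (Jop d r), Jop_mul, one_mul]
  rw [h, mul_sub, sub_mul, mul_assoc, mul_assoc, mul_Jop, mul_one, mul_smul_comm, mul_one,
    smul_mul_assoc] at h2
  rw [← h2]; module

/-- `B` is bounded by `c` for the `L²` norm. -/
def BddL2 (B : Module.End ℂ (Sc d)) (c : ℝ) : Prop := ∀ f, ‖toL2 (B f)‖ ≤ c * ‖toL2 f‖

lemma BddL2.mul {A B : Module.End ℂ (Sc d)} {a b : ℝ} (ha : 0 ≤ a) (hA : BddL2 A a)
    (hB : BddL2 B b) : BddL2 (A * B) (a * b) := fun f =>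
  (hA (B f)).trans (by rw [mul_assoc]; exact mul_le_mul_of_nonneg_left (hB f) ha)

lemma BddL2.smul {A : Module.End ℂ (Sc d)} {a : ℝ} (hA : BddL2 A a) (c : ℂ) :
    BddL2 (c • A) (‖c‖ * a) := fun f => by
  rw [LinearMap.smul_apply, map_smul, norm_smul, mul_assoc]
  exact mul_le_mul_of_nonneg_left (hA f) (norm_nonneg _)

lemma BddL2.mono {A : Module.End ℂ (Sc d)} {a b : ℝ} (hA : BddL2 A a) (h : a ≤ b) :
    BddL2 A b := fun f => (hA f).trans (mul_le_mul_of_nonneg_right h (norm_nonneg _))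

lemma re_inner_toL2_Tt (f : Sc d) : (inner ℂ (toL2 f) (toL2 (Tt d f))).re = 0 := by
  have h := inner_toL2_Tt f f
  rw [← inner_conj_symm] at h
  have := congrArg Complex.re h
  simp only [Complex.conj_re, Complex.neg_re] at this
  linarith

lemma norm_sq_Jop (r : ℝ) (f : Sc d) : ‖toL2 f‖ ^ 2
    = ‖toL2 (Jop d r f)‖ ^ 2 + ‖toL2 (f - Jop d r f)‖ ^ 2 := by
  have hf : f = Jop d r f - ((r : ℂ)⁻¹) • Tt d (Jop d r f) := by
    have := congrArg (fun A : Module.End ℂ (Sc d) => A f) (mul_Jop (d := d) r)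
    simpa using this.symm
  have hf2 : f - Jop d r f = - (((r : ℂ)⁻¹) • Tt d (Jop d r f)) := by
    nth_rewrite 1 [hf]; abel
  rw [hf2]
  conv_lhs => rw [hf]
  rw [map_sub, map_neg, norm_neg, @norm_sub_sq ℂ, map_smul, inner_smul_right, ← Complex.ofReal_inv,
    RCLike.re_eq_complex_re, Complex.re_ofReal_mul, re_inner_toL2_Tt]
  ring

lemma bddL2_Jop (r : ℝ) : BddL2 (Jop d r) 1 := fun f => by
  have := norm_sq_Jop r f
  rw [one_mul]
  nlinarith [sq_nonneg ‖toL2 (f - Jop d r f)‖, norm_nonneg (toL2 f), norm_nonneg (toL2 (Jop d r f))]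

lemma bddL2_Jop_sub_one (r : ℝ) : BddL2 (Jop d r - 1) 1 := fun f => by
  have := norm_sq_Jop r f
  rw [one_mul, LinearMap.sub_apply, Module.End.one_apply, map_sub, norm_sub_rev, ← map_sub]
  nlinarith [sq_nonneg ‖toL2 (Jop d r f)‖, norm_nonneg (toL2 f), norm_nonneg (toL2 (f - Jop d r f))]

lemma bddL2_Tt_mul_Jop {r : ℝ} (hr : r ≠ 0) : BddL2 (Tt d * Jop d r) |r| := by
  rw [Tt_mul_Jop hr]
  simpa using (bddL2_Jop_sub_one r).smul (r : ℂ)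

lemma inner_toL2_Jop (r : ℝ) (f g : Sc d) : inner ℂ (toL2 (Jop d (-r) f)) (toL2 g)
    = inner ℂ (toL2 f) (toL2 (Jop d r g)) := by
  have hg : g = Jop d r g - ((r : ℂ)⁻¹) • Tt d (Jop d r g) := by
    have := congrArg (fun A : Module.End ℂ (Sc d) => A g) (mul_Jop (d := d) r)
    simpa using this.symm
  have hf : f = Jop d (-r) f - (((-r : ℝ) : ℂ)⁻¹) • Tt d (Jop d (-r) f) := by
    have := congrArg (fun A : Module.End ℂ (Sc d) => A f) (mul_Jop (d := d) (-r))
    simpa using this.symm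
  conv_lhs => rw [hg]
  conv_rhs => rw [hf]
  rw [map_sub, map_sub, inner_sub_left, inner_sub_right, map_smul, map_smul, inner_smul_right,
    inner_smul_left, inner_toL2_Tt]
  simp [← Complex.ofReal_inv, inv_neg]

/-- The space of square integrable horizontal vector fields. -/
abbrev VL2 (d : ℕ) : Type :=
  PiLp 2 (fun _ : Fin d ⊕ Fin d => Lp ℂ 2 (volume : Measure (Hd d)))

/-- The horizontal gradient, with values in `L²`. -/
def nab : Sc d →ₗ[ℂ] VL2 d :=
  (WithLp.linearEquiv 2 ℂ _).symm.toLinearMap ∘ₗ LinearMap.pi (fun k => toL2 ∘ₗ Xk d k)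

lemma nab_apply (f : Sc d) (k : Fin d ⊕ Fin d) : nab f k = toL2 (Xk d k f) := rfl

lemma norm_nab_sq (f : Sc d) : ‖nab f‖ ^ 2 = ∑ k, ‖toL2 (Xk d k f)‖ ^ 2 := by
  rw [PiLp.norm_sq_eq_of_L2]; rfl

lemma inner_nab (f g : Sc d) : inner ℂ (nab f) (nab g)
    = ∑ k, inner ℂ (toL2 (Xk d k f)) (toL2 (Xk d k g)) := by
  rw [PiLp.inner_apply]; rfl

lemma inner_nab_eq_Lap (f g : Sc d) : inner ℂ (nab f) (nab g)
    = - inner ℂ (toL2 f) (toL2 (Lap d g)) := by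
  simp only [inner_nab, Lap, LinearMap.sum_apply, map_sum, inner_sum, inner_toL2_Xk,
    Module.End.mul_apply, Finset.sum_neg_distrib]

lemma norm_nab_le {B : Module.End ℂ (Sc d)} (hB : ∀ k, Commute (Xk d k) B) {c : ℝ} (hc : 0 ≤ c)
    (h : BddL2 B c) (f : Sc d) : ‖nab (B f)‖ ≤ c * ‖nab f‖ := by
  refine le_of_sq_le_sq ?_ (by positivity)
  rw [mul_pow, norm_nab_sq, norm_nab_sq, Finset.mul_sum]
  refine Finset.sum_le_sum fun k _ => ?_
  have e : Xk d k (B f) = B (Xk d k f) := congrArg (fun A : Module.End ℂ (Sc d) => A f) (hB k).eq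
  rw [e, ← mul_pow]
  exact pow_le_pow_left₀ (norm_nonneg _) (h _) 2

/-- The vertical derivative is controlled by two horizontal gradients. -/
lemma norm_inner_Tt_le (g g' : Sc d) :
    4 * d * ‖inner ℂ (toL2 (Tt d g)) (toL2 g')‖ ≤ ‖nab g‖ * ‖nab g'‖ := by
  have h1 : ∀ j : Fin d, (4 : ℂ) * inner ℂ (toL2 (Tt d g)) (toL2 g')
      = inner ℂ (toL2 (Xk d (.inr j) g)) (toL2 (Xk d (.inl j) g'))
        - inner ℂ (toL2 (Xk d (.inl j) g)) (toL2 (Xk d (.inr j) g')) := by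
    intro j
    have e : (4 : ℂ) • Tt d g = Xk d (.inr j) (Xk d (.inl j) g) - Xk d (.inl j) (Xk d (.inr j) g) := by
      have := congrArg (fun A : Module.End ℂ (Sc d) => A g) (Xk_comm j)
      simp only [Module.End.mul_apply, LinearMap.sub_apply, LinearMap.smul_apply] at this
      rw [this]; abel
    have e2 : (4 : ℂ) * inner ℂ (toL2 (Tt d g)) (toL2 g')
        = inner ℂ (toL2 ((4 : ℂ) • Tt d g)) (toL2 g') := by
      rw [map_smul, inner_smul_left, map_ofNat]
    rw [e2, e, map_sub, inner_sub_left, inner_toL2_Xk (.inr j) (Xk d (.inl j) g) g',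
      inner_toL2_Xk (.inl j) (Xk d (.inr j) g) g']
    ring
  have h2 : (4 * d : ℂ) * inner ℂ (toL2 (Tt d g)) (toL2 g')
      = ∑ j : Fin d, (inner ℂ (toL2 (Xk d (.inr j) g)) (toL2 (Xk d (.inl j) g'))
        - inner ℂ (toL2 (Xk d (.inl j) g)) (toL2 (Xk d (.inr j) g'))) := by
    rw [← Finset.sum_congr rfl (fun j _ => h1 j)]
    simp; ring
  have h3 : 4 * d * ‖inner ℂ (toL2 (Tt d g)) (toL2 g')‖
      = ‖(4 * d : ℂ) * inner ℂ (toL2 (Tt d g)) (toL2 g')‖ := by simp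
  rw [h3, h2]
  have h4 : ‖∑ j : Fin d, (inner ℂ (toL2 (Xk d (.inr j) g)) (toL2 (Xk d (.inl j) g'))
        - inner ℂ (toL2 (Xk d (.inl j) g)) (toL2 (Xk d (.inr j) g')))‖
      ≤ ∑ k, ‖toL2 (Xk d k.swap g)‖ * ‖toL2 (Xk d k g')‖ := by
    rw [Fintype.sum_sum_type, ← Finset.sum_add_distrib]
    refine norm_sum_le_of_le _ fun j _ => (norm_sub_le _ _).trans ?_
    exact add_le_add (norm_inner_le_norm _ _) (norm_inner_le_norm _ _)
  refine h4.trans (le_of_sq_le_sq ?_ (by positivity))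
  rw [mul_pow, norm_nab_sq, norm_nab_sq]
  refine (Finset.sum_mul_sq_le_sq_mul_sq _ _ _).trans (le_of_eq ?_)
  congr 1
  exact (Equiv.sumComm (Fin d) (Fin d)).sum_comp (fun k => ‖toL2 (Xk d k g)‖ ^ 2)

lemma Xk_comm_Jop (k : Fin d ⊕ Fin d) (r : ℝ) : Commute (Xk d k) (Jop d r) :=
  Jop_comm (Xk_mul_Tt k) r

lemma mu_comm_Jop (k : Fin d ⊕ Fin d) (r : ℝ) : Commute (mu (qf d k)) (Jop d r) :=
  Jop_comm (Tt_mul_mu _ (qf_tv k)).symm r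

/-- A dyadic piece in the vertical frequency. -/
def pc (d : ℕ) (a : ℝ) : Module.End ℂ (Sc d) := ((√15 / 3 : ℝ) : ℂ) • (Jop d a - Jop d (4 * a))

lemma pc_eq {a : ℝ} (ha : a ≠ 0) :
    pc d a = ((√15 / (4 * a) : ℝ) : ℂ) • (Tt d * (Jop d a * Jop d (4 * a))) := by
  have h4 : 4 * a ≠ 0 := by positivity
  have hne : a ≠ 4 * a := by
    intro h; apply ha; linarith
  have hc : (a : ℂ) ≠ 0 := by exact_mod_cast ha
  rw [Jop_mul_Jop ha h4 hne, mul_smul_comm, mul_sub, mul_smul_comm, mul_smul_comm, Tt_mul_Jop ha,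
    Tt_mul_Jop h4, pc]
  have e : ((4 * a - a : ℝ) : ℂ) = 3 * a := by push_cast; ring
  rw [e]
  have e2 : ((4 * a : ℝ) : ℂ) • (a : ℂ) • (Jop d a - 1) - (a : ℂ) • ((4 * a : ℝ) : ℂ) •
      (Jop d (4 * a) - 1) = (4 * a ^ 2 : ℂ) • (Jop d a - Jop d (4 * a)) := by
    push_cast; module
  rw [e2, smul_smul, smul_smul]
  congr 1
  push_cast
  field_simp

lemma sqrt_fifteen_le : √15 ≤ 4 := by
  rw [Real.sqrt_le_left (by norm_num)]; norm_num

lemma bddL2_pc {a : ℝ} (ha : a ≠ 0) : BddL2 (pc d a) 1 := by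
  rw [pc_eq ha, ← mul_assoc]
  refine (((bddL2_Tt_mul_Jop ha).mul (abs_nonneg a) (bddL2_Jop _)).smul _).mono ?_
  have h := sqrt_fifteen_le
  have : 0 < |a| := abs_pos.mpr ha
  rw [Complex.norm_real, Real.norm_eq_abs, abs_div, abs_mul, abs_of_nonneg (Real.sqrt_nonneg 15)]
  norm_num
  field_simp
  linarith

lemma bddL2_Tt_mul_pc {a : ℝ} (ha : a ≠ 0) : BddL2 (Tt d * pc d a) (4 * |a|) := by
  have e : Tt d * pc d a = ((√15 / (4 * a) : ℝ) : ℂ) • ((Tt d * Jop d a) * (Tt d * Jop d (4 * a))) := by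
    rw [pc_eq ha, mul_smul_comm]
    congr 1
    simp only [mul_assoc]
    rw [← mul_assoc (Jop d a), ← (Tt_comm_Jop a).eq, mul_assoc]
  rw [e]
  refine (((bddL2_Tt_mul_Jop ha).mul (abs_nonneg a)
    (bddL2_Tt_mul_Jop (r := 4 * a) (by positivity))).smul _).mono ?_
  have h := sqrt_fifteen_le
  have : 0 < |a| := abs_pos.mpr ha
  rw [Complex.norm_real, Real.norm_eq_abs, abs_div, abs_mul, abs_of_nonneg (Real.sqrt_nonneg 15)]
  norm_num
  field_simp
  linarith

lemma exists_pc_eq_Tt_mul {a : ℝ} (ha : a ≠ 0) : ∃ B : Module.End ℂ (Sc d),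
    pc d a = Tt d * B ∧ (∀ k, Commute (Xk d k) B) ∧ BddL2 B |a|⁻¹ := by
  refine ⟨((√15 / (4 * a) : ℝ) : ℂ) • (Jop d a * Jop d (4 * a)), ?_, fun k => ?_, ?_⟩
  · rw [pc_eq ha, mul_smul_comm]
  · exact ((Xk_comm_Jop k _).mul_right (Xk_comm_Jop k _)).smul_right _
  · refine (((bddL2_Jop a).mul zero_le_one (bddL2_Jop _)).smul _).mono ?_
    have h := sqrt_fifteen_le
    have : 0 < |a| := abs_pos.mpr ha
    rw [Complex.norm_real, Real.norm_eq_abs, abs_div, abs_mul, abs_of_nonneg (Real.sqrt_nonneg 15)]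
    norm_num
    field_simp
    linarith

lemma Xk_comm_pc (k : Fin d ⊕ Fin d) (a : ℝ) : Commute (Xk d k) (pc d a) :=
  ((Xk_comm_Jop k _).sub_right (Xk_comm_Jop k _)).smul_right _

/-- Commuting a function of `T` with the generator of dilations. -/
lemma exists_mul_Dop_Jop {r : ℝ} (hr : r ≠ 0) : ∃ C : Module.End ℂ (Sc d),
    Jop d r * Dop d = Dop d * Jop d r + (2 : ℂ) • C ∧ (∀ k, Commute (Xk d k) C) ∧ BddL2 C 1 := by
  refine ⟨Jop d r * (Jop d r - 1), ?_, fun k => ?_, ?_⟩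
  · have h1 : ∀ k, Jop d r * (mu (qf d k) * Xk d k) = mu (qf d k) * Xk d k * Jop d r := fun k =>
      (((mu_comm_Jop k r).mul_left (Xk_comm_Jop k r)).eq).symm
    have hc : (r : ℂ) ≠ 0 := by exact_mod_cast hr
    have h2 : Jop d r * (mu (tf d) * Tt d) = mu (tf d) * Tt d * Jop d r + Jop d r * (Jop d r - 1) := by
      have h3 : Jop d r * (Jop d r * Tt d) = (r : ℂ) • (Jop d r * (Jop d r - 1)) := by
        rw [← (Tt_comm_Jop r).eq, Tt_mul_Jop hr, mul_smul_comm]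
      rw [← mul_assoc, Jop_mul_tf, add_mul, smul_mul_assoc, mul_assoc (Jop d r), h3, smul_smul,
        inv_mul_cancel₀ hc, one_smul, mul_assoc, ← (Tt_comm_Jop r).eq, ← mul_assoc]
    rw [Dop, mul_add, add_mul, Finset.mul_sum, Finset.sum_mul, Finset.sum_congr rfl fun k _ => h1 k,
      mul_smul_comm, h2, smul_mul_assoc, smul_add, add_assoc]
  · exact (Xk_comm_Jop k r).mul_right ((Xk_comm_Jop k r).sub_right (Commute.one_right _))
  · simpa using (bddL2_Jop r).mul zero_le_one (bddL2_Jop_sub_one r)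

lemma exists_mul_Dop_pc {a : ℝ} (ha : a ≠ 0) : ∃ C : Module.End ℂ (Sc d),
    pc d a * Dop d = Dop d * pc d a + (2 : ℂ) • C ∧ (∀ k, Commute (Xk d k) C) ∧ BddL2 C 3 := by
  obtain ⟨C, hC, hx, hb⟩ := exists_mul_Dop_Jop (d := d) ha
  obtain ⟨C', hC', hx', hb'⟩ := exists_mul_Dop_Jop (d := d) (r := 4 * a) (by positivity)
  refine ⟨((√15 / 3 : ℝ) : ℂ) • (C - C'), ?_, fun k => ((hx k).sub_right (hx' k)).smul_right _, ?_⟩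
  · rw [pc, smul_mul_assoc, sub_mul, hC, hC', mul_smul_comm, mul_sub]; module
  · have h1 : BddL2 (C - C') 2 := fun f => by
      rw [LinearMap.sub_apply, map_sub]
      refine (norm_sub_le _ _).trans ?_
      linarith [hb f, hb' f]
    refine (h1.smul _).mono ?_
    rw [Complex.norm_real, Real.norm_eq_abs, abs_of_nonneg (by positivity)]
    linarith [sqrt_fifteen_le]

/-- The vertical frequency scales. -/
def Rs (j : ℕ) : ℝ := 4 ^ (j + 1)

lemma Rs_pos (j : ℕ) : 0 < Rs j := by unfold Rs; positivity

lemma Rs_succ (j : ℕ) : Rs (j + 1) = 4 * Rs j := by unfold Rs; ring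

/-- The pieces of a partition in vertical frequency. -/
def phi (d : ℕ) : ℕ → Module.End ℂ (Sc d)
  | 0 => Jop d (Rs 0)
  | j + 1 => pc d (Rs j)

/-- The adjoints of the pieces. -/
def phis (d : ℕ) : ℕ → Module.End ℂ (Sc d)
  | 0 => Jop d (-Rs 0)
  | j + 1 => pc d (-Rs j)

lemma inner_phis (j : ℕ) (f g : Sc d) : inner ℂ (toL2 (phis d j f)) (toL2 g)
    = inner ℂ (toL2 f) (toL2 (phi d j g)) := by
  cases j with
  | zero => exact inner_toL2_Jop _ _ _
  | succ j =>
    simp only [phis, phi, pc, LinearMap.smul_apply, LinearMap.sub_apply, map_smul, map_sub,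
      inner_smul_left, inner_smul_right, inner_sub_left, inner_sub_right, Complex.conj_ofReal,
      mul_neg, inner_toL2_Jop]

lemma sum_phis_mul_phi (N : ℕ) : ∑ j ∈ Finset.range (N + 1), phis d j * phi d j
    = Jop d (-Rs N) * Jop d (Rs N) := by
  induction N with
  | zero => simp [phis, phi]
  | succ N ih =>
    rw [Finset.sum_range_succ, ih, Rs_succ]
    simp only [phis, phi, pc]
    have hr := Rs_pos N
    generalize Rs N = r at hr
    have hc : (r : ℂ) ≠ 0 := by exact_mod_cast hr.ne'
    rw [show 4 * -r = -(4 * r) by ring, smul_mul_assoc, mul_smul_comm, smul_smul]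
    have e : ((√15 / 3 : ℝ) : ℂ) * ((√15 / 3 : ℝ) : ℂ) = 5 / 3 := by
      rw [← Complex.ofReal_mul, div_mul_div_comm, Real.mul_self_sqrt (by norm_num)]
      push_cast; norm_num
    rw [e]
    have p1 : Jop d (-r) * Jop d r = ((2 : ℂ)⁻¹) • (Jop d (-r) + Jop d r) := by
      rw [Jop_mul_Jop (by linarith) (by linarith) (by linarith)]
      match_scalars <;> grind
    have p2 : Jop d (-(4 * r)) * Jop d (4 * r)
        = ((2 : ℂ)⁻¹) • (Jop d (-(4 * r)) + Jop d (4 * r)) := by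
      rw [Jop_mul_Jop (by linarith) (by linarith) (by linarith)]
      match_scalars <;> grind
    have p3 : Jop d (-r) * Jop d (4 * r)
        = ((5 : ℂ)⁻¹) • ((4 : ℂ) • Jop d (-r) + Jop d (4 * r)) := by
      rw [Jop_mul_Jop (by linarith) (by linarith) (by linarith)]
      match_scalars <;> grind
    have p4 : Jop d (-(4 * r)) * Jop d r
        = ((5 : ℂ)⁻¹) • (Jop d (-(4 * r)) + (4 : ℂ) • Jop d r) := by
      rw [Jop_mul_Jop (by linarith) (by linarith) (by linarith)]
      match_scalars <;> grind
    rw [sub_mul, mul_sub, mul_sub, p1, p2, p3, p4]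
    module

lemma Xk_comm_phis (k : Fin d ⊕ Fin d) (j : ℕ) : Commute (Xk d k) (phis d j) := by
  cases j with
  | zero => exact Xk_comm_Jop k _
  | succ j => exact Xk_comm_pc k _

lemma Xk_comm_phi (k : Fin d ⊕ Fin d) (j : ℕ) : Commute (Xk d k) (phi d j) := by
  cases j with
  | zero => exact Xk_comm_Jop k _
  | succ j => exact Xk_comm_pc k _

lemma bddL2_phis (j : ℕ) : BddL2 (phis d j) 1 := by
  cases j with
  | zero => exact bddL2_Jop _
  | succ j => exact bddL2_pc (neg_ne_zero.mpr (Rs_pos j).ne')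

lemma bddL2_Tt_mul_phis (j : ℕ) : BddL2 (Tt d * phis d j) (Rs j) := by
  cases j with
  | zero => simpa [phis, abs_of_pos (Rs_pos 0)] using bddL2_Tt_mul_Jop (d := d) (neg_ne_zero.mpr (Rs_pos 0).ne')
  | succ j =>
    simpa [phis, abs_of_pos (Rs_pos j), ← Rs_succ] using bddL2_Tt_mul_pc (d := d) (neg_ne_zero.mpr (Rs_pos j).ne')

lemma exists_phis_succ_eq (j : ℕ) : ∃ B : Module.End ℂ (Sc d),
    phis d (j + 1) = Tt d * B ∧ (∀ k, Commute (Xk d k) B) ∧ BddL2 B (4 / Rs (j + 1)) := by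
  obtain ⟨B, h1, h2, h3⟩ := exists_pc_eq_Tt_mul (d := d) (neg_ne_zero.mpr (Rs_pos j).ne')
  refine ⟨B, h1, h2, h3.mono (le_of_eq ?_)⟩
  have := Rs_pos j
  rw [abs_neg, abs_of_pos this, Rs_succ]
  field_simp

lemma exists_phis_mul_Dop (j : ℕ) : ∃ C : Module.End ℂ (Sc d),
    phis d j * Dop d = Dop d * phis d j + (2 : ℂ) • C ∧ (∀ k, Commute (Xk d k) C) ∧ BddL2 C 3 := by
  cases j with
  | zero =>
    obtain ⟨C, h1, h2, h3⟩ := exists_mul_Dop_Jop (d := d) (neg_ne_zero.mpr (Rs_pos 0).ne')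
    exact ⟨C, h1, h2, h3.mono (by norm_num)⟩
  | succ j => exact exists_mul_Dop_pc (neg_ne_zero.mpr (Rs_pos j).ne')

lemma zsq_eq_sum (p : Hd d) : zsq d p = ∑ k, qf d k p ^ 2 := by
  rw [zsq, EuclideanSpace.norm_sq_eq, EuclideanSpace.norm_sq_eq, Fintype.sum_sum_type]
  simp [qf]

lemma sum_qc_sq (p : Hd d) : ∑ k, qc d k p ^ 2 = zsq d p := by
  rw [zsq_eq_sum, Fintype.sum_sum_type, Fintype.sum_sum_type, add_comm]
  simp [qc]

lemma sum_qf_mul_qc (p : Hd d) : ∑ k, qf d k p * qc d k p = 0 := by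
  rw [Fintype.sum_sum_type, ← Finset.sum_add_distrib]
  refine Finset.sum_eq_zero fun j _ => ?_
  simp [qc]; ring

lemma zsq_nonneg (p : Hd d) : 0 ≤ zsq d p := by unfold zsq; positivity

/-- The rational weight `(1 + |z|⁴ + t²)⁻¹`. -/
def rw4 (d : ℕ) (p : Hd d) : ℝ := (1 + zsq d p ^ 2 + tf d p ^ 2)⁻¹

lemma rw4_pos (p : Hd d) : 0 < rw4 d p := by unfold rw4; positivity

lemma hasTemperateGrowth_zsq : (zsq d).HasTemperateGrowth := by
  have : zsq d = fun p => ∑ k, qf d k p ^ 2 := funext zsq_eq_sum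
  rw [this]
  exact Function.HasTemperateGrowth.sum (s := Finset.univ) fun k _ => (qf d k).hasTemperateGrowth.pow 2

lemma hasTemperateGrowth_rw4 : (rw4 d).HasTemperateGrowth := by
  have h : (fun p : Hd d => ((zsq d p : ℂ) + (tf d p : ℂ) * Complex.I)).HasTemperateGrowth := by
    have h1 : (fun p : Hd d => (zsq d p : ℂ)).HasTemperateGrowth :=
      Function.Complex.hasTemperateGrowth_ofReal.comp hasTemperateGrowth_zsq
    have h2 : (fun p : Hd d => (tf d p : ℂ)).HasTemperateGrowth :=
      Function.Complex.hasTemperateGrowth_ofReal.comp (tf d).hasTemperateGrowth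
    exact h1.add (h2.mul (.const _))
  have hcomp := (Function.hasTemperateGrowth_one_add_norm_sq_rpow ℂ (-1)).comp h
  have e : rw4 d = (fun x : ℂ => (1 + ‖x‖ ^ 2) ^ (-1 : ℝ)) ∘
      fun p : Hd d => ((zsq d p : ℂ) + (tf d p : ℂ) * Complex.I) := by
    ext p
    rw [Function.comp_apply, Real.rpow_neg_one, rw4, ← Complex.normSq_eq_norm_sq,
      Complex.normSq_add_mul_I, add_assoc]
  rw [e]; exact hcomp

/-- Multiplication by a real function of temperate growth. -/
def mtg (v : Hd d → ℝ) : Module.End ℂ (Sc d) :=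
  (SchwartzMap.smulLeftCLM ℂ (fun p => (v p : ℂ))).toLinearMap

lemma mtg_apply {v : Hd d → ℝ} (hv : v.HasTemperateGrowth) (f : Sc d) (p : Hd d) :
    mtg v f p = v p * f p :=
  SchwartzMap.smulLeftCLM_apply_apply (Function.Complex.hasTemperateGrowth_ofReal.comp hv) f p

lemma inner_toL2_mtg {v : Hd d → ℝ} (hv : v.HasTemperateGrowth) (f g : Sc d) :
    inner ℂ (toL2 (mtg v f)) (toL2 g) = inner ℂ (toL2 f) (toL2 (mtg v g)) := by
  rw [inner_toL2, inner_toL2]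
  congr 1; ext p
  simp only [mtg_apply hv, map_mul, Complex.conj_ofReal]; ring

lemma Xk_mtg_apply (k : Fin d ⊕ Fin d) {v : Hd d → ℝ} (hv : v.HasTemperateGrowth) (f : Sc d)
    (p : Hd d) {v' : ℝ}
    (h : HasLineDerivAt ℝ v v' p (ev d k + (2 * qc d k p) • tv d)) :
    Xk d k (mtg v f) p - mtg v (Xk d k f) p = v' * f p := by
  set D := ev d k + (2 * qc d k p) • tv d with hD
  have hvd : DifferentiableAt ℝ v p := (hv.1.differentiable (by simp)).differentiableAt
  have hder : fderiv ℝ v p D = v' := (hvd.lineDeriv_eq_fderiv).symm.trans h.lineDeriv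
  have e : ⇑(mtg v f) = fun p => v p • f p := by
    ext q; rw [mtg_apply hv, Complex.real_smul]
  rw [mtg_apply hv, Xk_apply, Xk_apply, ← hD, e, fderiv_fun_smul hvd f.differentiableAt]
  simp [hder]

/-- The components of `∇_H (|z|⁴ + t²) / (4 (1 + |z|⁴ + t²))`. -/
def hv (d : ℕ) (k : Fin d ⊕ Fin d) (p : Hd d) : ℝ :=
  (zsq d p * qf d k p + qc d k p * tf d p) * rw4 d p

lemma hasTemperateGrowth_hv (k : Fin d ⊕ Fin d) : (hv d k).HasTemperateGrowth :=
  ((hasTemperateGrowth_zsq.mul (qf d k).hasTemperateGrowth).add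
    ((qc d k).hasTemperateGrowth.mul (tf d).hasTemperateGrowth)).mul hasTemperateGrowth_rw4

lemma qc_ev (k : Fin d ⊕ Fin d) : qc d k (ev d k) = 0 := by
  rcases k with k | k <;> simp [qc, qf_ev]

lemma hasLineDerivAt_hv (k : Fin d ⊕ Fin d) (p : Hd d) :
    HasLineDerivAt ℝ (hv d k) ((zsq d p + 2 * qf d k p ^ 2 + 2 * qc d k p ^ 2) * rw4 d p
      - 4 * (zsq d p * qf d k p + qc d k p * tf d p) ^ 2 * rw4 d p ^ 2) p
      (ev d k + (2 * qc d k p) • tv d) := by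
  rw [HasLineDerivAt]
  set a := qf d k p with ha
  set b := qc d k p with hb
  set t := tf d p with ht
  set q := zsq d p with hq
  have e1 : ∀ s : ℝ, qf d k (p + s • (ev d k + (2 * b) • tv d)) = a + s := fun s => by
    simp [qf_ev, qf_tv, ← ha]
  have e2 : ∀ s : ℝ, qc d k (p + s • (ev d k + (2 * b) • tv d)) = b := fun s => by
    simp [qc_ev, qc_tv, ← hb]
  have e3 : ∀ s : ℝ, tf d (p + s • (ev d k + (2 * b) • tv d)) = t + s * (2 * b) := fun s => by
    simp [tf_ev, tf_tv, ← ht]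
  have e4 : ∀ s : ℝ, zsq d (p + s • (ev d k + (2 * b) • tv d)) = q + 2 * s * a + s ^ 2 := fun s => by
    have : ∀ l, qf d l (p + s • (ev d k + (2 * b) • tv d)) ^ 2
        = qf d l p ^ 2 + (if k = l then 2 * s * qf d l p + s ^ 2 else 0) := fun l => by
      simp only [map_add, map_smul, qf_ev, qf_tv, smul_eq_mul, mul_zero, add_zero]
      split_ifs <;> ring
    rw [zsq_eq_sum, Finset.sum_congr rfl fun l _ => this l, Finset.sum_add_distrib,
      Finset.sum_ite_eq, if_pos (Finset.mem_univ _), ← zsq_eq_sum]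
    ring
  simp only [hv, rw4, e1, e2, e3, e4]
  have d4 : HasDerivAt (fun s : ℝ => q + 2 * s * a + s ^ 2) (2 * a) 0 := by
    have := (((hasDerivAt_id (0 : ℝ)).const_mul 2).mul_const a).const_add q |>.add
      ((hasDerivAt_id (0 : ℝ)).pow 2)
    refine (this.congr_deriv (by simp)).congr_of_eventuallyEq (.of_forall fun s => by simp)
  have d1 : HasDerivAt (fun s : ℝ => a + s) 1 0 := (hasDerivAt_id _).const_add a
  have d3 : HasDerivAt (fun s : ℝ => t + s * (2 * b)) (2 * b) 0 := by
    simpa using ((hasDerivAt_id (0 : ℝ)).mul_const (2 * b)).const_add t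
  have hpos : 1 + (q + 2 * 0 * a + 0 ^ 2) ^ 2 + (t + 0 * (2 * b)) ^ 2 ≠ 0 := by positivity
  have := ((d4.mul d1).add (d3.const_mul b)).mul ((((d4.pow 2).const_add 1).add (d3.pow 2)).inv hpos)
  refine this.congr_deriv ?_
  have hpos' : 1 + q ^ 2 + t ^ 2 ≠ 0 := by positivity
  simp
  field_simp
  ring

/-- A Hardy inequality, with the weight `|z|² / (1 + |z|⁴ + t²)`. -/
lemma hardy_aux (g : Sc d) :
    (d : ℝ) ^ 2 * (inner ℂ (toL2 (mtg (fun p => zsq d p * rw4 d p) g)) (toL2 g)).re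
      ≤ ‖nab g‖ ^ 2 := by
  have hQ : (fun p : Hd d => zsq d p * rw4 d p).HasTemperateGrowth :=
    hasTemperateGrowth_zsq.mul hasTemperateGrowth_rw4
  have hQ2 : (fun p : Hd d => zsq d p * rw4 d p ^ 2).HasTemperateGrowth :=
    hasTemperateGrowth_zsq.mul (hasTemperateGrowth_rw4.pow 2)
  set Q := mtg (fun p : Hd d => zsq d p * rw4 d p)
  set Q2 := mtg (fun p : Hd d => zsq d p * rw4 d p ^ 2)
  have hm : ∀ p : Hd d, rw4 d p * (1 + zsq d p ^ 2 + tf d p ^ 2) = 1 := fun p => by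
    rw [rw4]; exact inv_mul_cancel₀ (by positivity)
  have hsum : ∀ p : Hd d, ∑ k, (zsq d p * qf d k p + qc d k p * tf d p) ^ 2
      = zsq d p * (zsq d p ^ 2 + tf d p ^ 2) := fun p => by
    have : ∀ k, (zsq d p * qf d k p + qc d k p * tf d p) ^ 2 = zsq d p ^ 2 * qf d k p ^ 2
      + 2 * zsq d p * tf d p * (qf d k p * qc d k p) + tf d p ^ 2 * qc d k p ^ 2 := fun k => by ring
    simp only [this, Finset.sum_add_distrib, ← Finset.mul_sum, sum_qf_mul_qc, sum_qc_sq,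
      ← zsq_eq_sum]
    ring
  have h1 : ∑ k, (Xk d k (mtg (hv d k) g) - mtg (hv d k) (Xk d k g))
      = (2 * d : ℂ) • Q g + (4 : ℂ) • Q2 g := by
    ext p
    rw [sum_apply]
    simp only [add_apply, smul_apply, smul_eq_mul, sub_apply]
    rw [Finset.sum_congr rfl fun k _ => Xk_mtg_apply k (hasTemperateGrowth_hv k) g p
      (hasLineDerivAt_hv k p), ← Finset.sum_mul, ← Complex.ofReal_sum, mtg_apply hQ, mtg_apply hQ2,
      ← mul_assoc, ← mul_assoc, ← add_mul]
    congr 1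
    have : ∑ k : Fin d ⊕ Fin d, ((zsq d p + 2 * qf d k p ^ 2 + 2 * qc d k p ^ 2) * rw4 d p
      - 4 * (zsq d p * qf d k p + qc d k p * tf d p) ^ 2 * rw4 d p ^ 2)
      = 2 * d * (zsq d p * rw4 d p) + 4 * (zsq d p * rw4 d p ^ 2) := by
      rw [Finset.sum_sub_distrib, ← Finset.sum_mul, ← Finset.sum_mul, ← Finset.mul_sum, hsum,
        Finset.sum_add_distrib, Finset.sum_add_distrib, ← Finset.mul_sum, ← Finset.mul_sum,
        sum_qc_sq, ← zsq_eq_sum]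
      simp
      linear_combination (-4 * zsq d p * rw4 d p) * hm p
    rw [this]; push_cast; ring
  have h2 : ∑ k, mtg (hv d k) (mtg (hv d k) g) = Q g - Q2 g := by
    ext p
    rw [sum_apply, sub_apply, mtg_apply hQ, mtg_apply hQ2]
    simp only [mtg_apply (hasTemperateGrowth_hv _), ← mul_assoc, ← Complex.ofReal_mul]
    rw [← Finset.sum_mul, ← Complex.ofReal_sum, ← sub_mul, ← Complex.ofReal_sub]
    congr 2
    have := hsum p
    simp only [hv]
    simp only [show ∀ k, (zsq d p * qf d k p + qc d k p * tf d p) * rw4 d p *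
      ((zsq d p * qf d k p + qc d k p * tf d p) * rw4 d p)
      = (zsq d p * qf d k p + qc d k p * tf d p) ^ 2 * rw4 d p ^ 2 by intro k; ring]
    rw [← Finset.sum_mul, hsum]
    linear_combination (zsq d p * rw4 d p) * hm p
  have hpos : ∀ {v : Hd d → ℝ} (_ : v.HasTemperateGrowth) (_ : ∀ p, 0 ≤ v p),
      0 ≤ (inner ℂ (toL2 (mtg v g)) (toL2 g)).re := by
    intro v h h0
    have : inner ℂ (toL2 (mtg v g)) (toL2 g) = ((∫ p, v p * ‖g p‖ ^ 2 : ℝ) : ℂ) := by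
      rw [inner_toL2, ← integral_complex_ofReal]
      congr 1; ext p
      rw [mtg_apply h, map_mul, Complex.conj_ofReal, mul_assoc, Complex.conj_mul']
      push_cast; rfl
    rw [this, Complex.ofReal_re]
    exact integral_nonneg fun p => mul_nonneg (h0 p) (sq_nonneg _)
  have p2 := hpos hQ2 fun p => mul_nonneg (zsq_nonneg p) (sq_nonneg _)
  have p1 := hpos hQ fun p => mul_nonneg (zsq_nonneg p) (rw4_pos p).le
  set B := (inner ℂ (toL2 (Q g)) (toL2 g)).re
  set B2 := (inner ℂ (toL2 (Q2 g)) (toL2 g)).re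
  have e1 : 2 * d * B + 4 * B2
      = -2 * ∑ k, (inner ℂ (toL2 (mtg (hv d k) g)) (toL2 (Xk d k g))).re := by
    have := congrArg (fun f => (inner ℂ (toL2 f) (toL2 g)).re) h1
    simp only [map_add, map_smul, inner_add_left, inner_smul_left, map_sum, sum_inner, map_sub,
      inner_sub_left, inner_toL2_Xk, Complex.re_sum, Complex.sub_re, Complex.neg_re,
      Complex.add_re] at this
    have r : ∀ k, (inner ℂ (toL2 (mtg (hv d k) (Xk d k g))) (toL2 g)).re
        = (inner ℂ (toL2 (mtg (hv d k) g)) (toL2 (Xk d k g))).re := fun k => by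
      rw [inner_toL2_mtg (hasTemperateGrowth_hv k), ← inner_conj_symm, Complex.conj_re]
    simp only [r] at this
    rw [Finset.mul_sum, Finset.sum_congr rfl fun k _ => (by ring :
      -2 * (inner ℂ (toL2 (mtg (hv d k) g)) (toL2 (Xk d k g))).re
        = -(inner ℂ (toL2 (mtg (hv d k) g)) (toL2 (Xk d k g))).re
          - (inner ℂ (toL2 (mtg (hv d k) g)) (toL2 (Xk d k g))).re), this]
    simp [B, B2]
  have e2 : ∑ k, ‖toL2 (mtg (hv d k) g)‖ ^ 2 = B - B2 := by
    have := congrArg (fun f => (inner ℂ (toL2 f) (toL2 g)).re) h2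
    simp only [map_sum, sum_inner, map_sub, inner_sub_left, Complex.re_sum, Complex.sub_re,
      inner_toL2_mtg (hasTemperateGrowth_hv _) (mtg (hv d _) g)] at this
    rw [← this]
    refine Finset.sum_congr rfl fun k _ => ?_
    rw [← inner_self_eq_norm_sq (𝕜 := ℂ)]; rfl
  have e3 : (∑ k, (inner ℂ (toL2 (mtg (hv d k) g)) (toL2 (Xk d k g))).re) ^ 2
      ≤ (B - B2) * ‖nab g‖ ^ 2 := by
    rw [← e2, norm_nab_sq]
    refine le_trans ?_ (Finset.sum_mul_sq_le_sq_mul_sq _ _ _)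
    rw [← sq_abs]
    refine pow_le_pow_left₀ (abs_nonneg _) ?_ 2
    refine (Finset.abs_sum_le_sum_abs _ _).trans (Finset.sum_le_sum fun k _ => ?_)
    exact (Complex.abs_re_le_norm _).trans (norm_inner_le_norm _ _)
  have e4 : (d * B) ^ 2 ≤ B * ‖nab g‖ ^ 2 := by
    have e5 : (d * B) ^ 2 ≤ (∑ k, (inner ℂ (toL2 (mtg (hv d k) g)) (toL2 (Xk d k g))).re) ^ 2 := by
      rw [← neg_sq (∑ k, _)]
      refine pow_le_pow_left₀ (by positivity) ?_ 2
      linarith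
    nlinarith [sq_nonneg ‖nab g‖]
  rcases p1.eq_or_lt with h | h
  · rw [← h]; simp
  · nlinarith

lemma zn_sq (p : Hd d) : zn d p ^ 2 = zsq d p := Real.sq_sqrt (zsq_nonneg p)

lemma w1_nonneg (p : Hd d) : 0 ≤ w1 d p := by unfold w1 zn; positivity

lemma w1_sq (p : Hd d) : w1 d p ^ 2
    = zsq d p / (1 + zsq d p) / (1 + √(zsq d p ^ 2 + tf d p ^ 2)) ^ 2 := by
  have h : zn d p ^ 4 = zsq d p ^ 2 := by rw [← zn_sq]; ring
  have h2 : tf d p = p.2.2 := rfl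
  rw [w1, div_pow, div_pow, zn_sq, h, h2, Real.sq_sqrt (by have := zsq_nonneg p; linarith)]

lemma w1_sq_le (p : Hd d) : w1 d p ^ 2 ≤ zsq d p * rw4 d p := by
  have h := zsq_nonneg p
  have h1 := Real.sqrt_nonneg (zsq d p ^ 2 + tf d p ^ 2)
  have h2 := Real.sq_sqrt (show 0 ≤ zsq d p ^ 2 + tf d p ^ 2 by positivity)
  rw [w1_sq, rw4, div_div, div_eq_mul_inv]
  refine mul_le_mul_of_nonneg_left (inv_anti₀ (by positivity) ?_) h
  nlinarith [mul_nonneg h (sq_nonneg (1 + √(zsq d p ^ 2 + tf d p ^ 2)))]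

lemma w1_sq_le_aux (p : Hd d) : w1 d p ^ 2 ≤ zsq d p / (1 + zsq d p) ^ 3 := by
  have h := zsq_nonneg p
  have h1 : zsq d p ≤ √(zsq d p ^ 2 + tf d p ^ 2) :=
    Real.le_sqrt_of_sq_le (le_add_of_nonneg_right (sq_nonneg _))
  rw [w1_sq, div_div]
  refine div_le_div_of_nonneg_left h (by positivity) ?_
  rw [pow_succ']
  gcongr

lemma w1_le_half (p : Hd d) : w1 d p ≤ 1 / 2 := by
  have h := zsq_nonneg p
  refine le_of_sq_le_sq ((w1_sq_le_aux p).trans ?_) (by norm_num)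
  rw [div_le_iff₀ (by positivity)]
  nlinarith [sq_nonneg (zsq d p - 1 / 6), pow_nonneg h 3]

lemma w1_sq_mul_zsq_le (p : Hd d) : w1 d p ^ 2 * zsq d p ≤ 1 / 4 := by
  have h := zsq_nonneg p
  refine (mul_le_mul_of_nonneg_right (w1_sq_le_aux p) h).trans ?_
  rw [div_mul_eq_mul_div, div_le_iff₀ (by positivity)]
  nlinarith [mul_nonneg h (sq_nonneg (zsq d p - 1 / 2))]

lemma w1_mul_abs_tf_le (p : Hd d) : w1 d p * |tf d p| ≤ 1 := by
  have h := zsq_nonneg p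
  have h1 : tf d p ^ 2 ≤ √(zsq d p ^ 2 + tf d p ^ 2) ^ 2 := by
    rw [Real.sq_sqrt (by positivity)]; nlinarith
  have h2 := Real.sqrt_nonneg (zsq d p ^ 2 + tf d p ^ 2)
  refine le_of_sq_le_sq ?_ zero_le_one
  rw [mul_pow, w1_sq, sq_abs, div_div, div_mul_eq_mul_div, div_le_iff₀ (by positivity)]
  nlinarith [mul_nonneg h (sq_nonneg (1 + √(zsq d p ^ 2 + tf d p ^ 2))), mul_le_mul_of_nonneg_left h1 h]

lemma continuous_zsq : Continuous (zsq d) := hasTemperateGrowth_zsq.1.continuous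

lemma continuous_w1 : Continuous (w1 d) := by
  have h : Continuous (zn d) := Real.continuous_sqrt.comp continuous_zsq
  unfold w1
  refine Continuous.div (h.div (by fun_prop) fun p => ?_) ?_ fun p => ?_
  · positivity
  · exact continuous_const.add (((h.pow 4).add ((tf d).continuous.pow 2)).sqrt)
  · positivity

lemma memLp_w1_mul (f : Sc d) : MemLp (fun p => (w1 d p : ℂ) * f p) 2 (volume : Measure (Hd d)) := by
  refine (f.memLp 2 volume).of_le ?_ (.of_forall fun p => ?_)
  · exact ((Complex.continuous_ofReal.comp continuous_w1).mul f.continuous).aestronglyMeasurable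
  · rw [norm_mul, Complex.norm_real, Real.norm_eq_abs, abs_of_nonneg (w1_nonneg p)]
    exact mul_le_of_le_one_left (norm_nonneg _) ((w1_le_half p).trans (by norm_num))

/-- Multiplication by the weight, with values in `L²`. -/
def Wt : Sc d →ₗ[ℂ] Lp ℂ 2 (volume : Measure (Hd d)) where
  toFun f := (memLp_w1_mul f).toLp _
  map_add' f g := by
    rw [← MemLp.toLp_add]
    exact MemLp.toLp_congr _ _ (.of_forall fun p => by simp [mul_add])
  map_smul' c f := by
    rw [RingHom.id_apply, ← MemLp.toLp_const_smul]
    exact MemLp.toLp_congr _ _ (.of_forall fun p => by simp [mul_left_comm])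

lemma coeFn_Wt (f : Sc d) : Wt f =ᵐ[volume] fun p => (w1 d p : ℂ) * f p :=
  (memLp_w1_mul f).coeFn_toLp

lemma coeFn_toL2 (f : Sc d) : toL2 f =ᵐ[volume] f := f.coeFn_toLp 2 volume

lemma norm_sq_eq_integral (φ : Lp ℂ 2 (volume : Measure (Hd d))) : ‖φ‖ ^ 2 = ∫ p, ‖φ p‖ ^ 2 := by
  rw [← inner_self_eq_norm_sq (𝕜 := ℂ), L2.inner_def, ← integral_re (L2.integrable_inner _ _)]
  congr 1; ext p
  rw [inner_self_eq_norm_sq]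

lemma norm_toL2_sq (f : Sc d) : ‖toL2 f‖ ^ 2 = ∫ p, ‖f p‖ ^ 2 := by
  rw [norm_sq_eq_integral]
  refine integral_congr_ae ?_
  filter_upwards [coeFn_toL2 f] with p hp
  rw [hp]

lemma norm_Wt_sq (f : Sc d) : ‖Wt f‖ ^ 2 = ∫ p, w1 d p ^ 2 * ‖f p‖ ^ 2 := by
  rw [norm_sq_eq_integral]
  refine integral_congr_ae ?_
  filter_upwards [coeFn_Wt f] with p hp
  rw [hp, norm_mul, mul_pow, Complex.norm_real, Real.norm_eq_abs, sq_abs]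

lemma integrable_norm_sq (f : Sc d) : Integrable (fun p => ‖f p‖ ^ 2) (volume : Measure (Hd d)) :=
  (f.memLp 2 volume).integrable_norm_pow (by norm_num)

lemma norm_Wt_le_of {f g : Sc d} {c : ℝ} (hc : 0 ≤ c) (h : ∀ p, w1 d p * ‖f p‖ ≤ c * ‖g p‖) :
    ‖Wt f‖ ≤ c * ‖toL2 g‖ := by
  refine le_of_sq_le_sq ?_ (by positivity)
  rw [mul_pow, norm_Wt_sq, norm_toL2_sq, ← integral_const_mul]
  refine integral_mono_of_nonneg (.of_forall fun p => by positivity)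
    ((integrable_norm_sq g).const_mul _) (.of_forall fun p => ?_)
  show w1 d p ^ 2 * ‖f p‖ ^ 2 ≤ c ^ 2 * ‖g p‖ ^ 2
  rw [← mul_pow, ← mul_pow]
  exact pow_le_pow_left₀ (mul_nonneg (w1_nonneg p) (norm_nonneg _)) (h p) 2

lemma norm_Wt_le (f : Sc d) : ‖Wt f‖ ≤ 1 / 2 * ‖toL2 f‖ :=
  norm_Wt_le_of (by norm_num) fun p => mul_le_mul_of_nonneg_right (w1_le_half p) (norm_nonneg _)

lemma norm_Wt_mu_tf_le (f : Sc d) : ‖Wt (mu (tf d) f)‖ ≤ ‖toL2 f‖ := by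
  rw [← one_mul ‖toL2 f‖]
  refine norm_Wt_le_of zero_le_one fun p => ?_
  rw [mu_apply, norm_mul, Complex.norm_real, Real.norm_eq_abs, ← mul_assoc]
  exact mul_le_mul_of_nonneg_right (w1_mul_abs_tf_le p) (norm_nonneg _)

lemma norm_Wt_sum_le (f : Sc d) : ‖Wt (∑ k, mu (qf d k) (Xk d k f))‖ ≤ 1 / 2 * ‖nab f‖ := by
  refine le_of_sq_le_sq ?_ (by positivity)
  rw [mul_pow, norm_nab_sq, norm_Wt_sq]
  simp only [norm_toL2_sq]
  rw [← integral_finsetSum _ fun k _ => integrable_norm_sq _, ← integral_const_mul]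
  refine integral_mono_of_nonneg (.of_forall fun p => by positivity)
    ((integrable_finsetSum _ fun k _ => integrable_norm_sq _).const_mul _) (.of_forall fun p => ?_)
  show w1 d p ^ 2 * ‖(∑ k, mu (qf d k) (Xk d k f)) p‖ ^ 2 ≤ (1 / 2) ^ 2 * ∑ k, ‖Xk d k f p‖ ^ 2
  have h1 : ‖(∑ k, mu (qf d k) (Xk d k f)) p‖ ^ 2 ≤ zsq d p * ∑ k, ‖Xk d k f p‖ ^ 2 := by
    rw [zsq_eq_sum, sum_apply]
    simp only [← sq_abs (qf d _ p)]
    refine le_trans ?_ (Finset.sum_mul_sq_le_sq_mul_sq _ _ _)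
    refine pow_le_pow_left₀ (norm_nonneg _) (norm_sum_le_of_le _ fun k _ => ?_) 2
    rw [mu_apply, norm_mul, Complex.norm_real, Real.norm_eq_abs]
  have h2 : 0 ≤ ∑ k, ‖Xk d k f p‖ ^ 2 := by positivity
  calc _ ≤ w1 d p ^ 2 * (zsq d p * ∑ k, ‖Xk d k f p‖ ^ 2) := by gcongr
    _ = (w1 d p ^ 2 * zsq d p) * ∑ k, ‖Xk d k f p‖ ^ 2 := by ring
    _ ≤ _ := by
      refine mul_le_mul_of_nonneg_right ((w1_sq_mul_zsq_le p).trans (by norm_num)) h2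

/-- The weighted Hardy inequality. -/
lemma hardy (f : Sc d) : d * ‖Wt f‖ ≤ ‖nab f‖ := by
  refine le_of_sq_le_sq ?_ (norm_nonneg _)
  rw [mul_pow]
  refine le_trans (mul_le_mul_of_nonneg_left ?_ (sq_nonneg _)) (hardy_aux f)
  have hQ : (fun p : Hd d => zsq d p * rw4 d p).HasTemperateGrowth :=
    hasTemperateGrowth_zsq.mul hasTemperateGrowth_rw4
  rw [norm_Wt_sq, L2.inner_def, ← Complex.reCLM_apply, ← Complex.reCLM.integral_comp_comm
    (L2.integrable_inner _ _)]
  refine integral_mono_of_nonneg (.of_forall fun p => by positivity)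
    (Complex.reCLM.integrable_comp (L2.integrable_inner _ _)) ?_
  filter_upwards [coeFn_toL2 f, coeFn_toL2 (mtg (fun p : Hd d => zsq d p * rw4 d p) f)] with p h1 h2
  have e : inner ℂ (toL2 (mtg (fun p : Hd d => zsq d p * rw4 d p) f) p) (toL2 f p)
      = ((zsq d p * rw4 d p * ‖f p‖ ^ 2 : ℝ) : ℂ) := by
    rw [h1, h2, mtg_apply hQ, RCLike.inner_apply', map_mul, Complex.conj_ofReal, mul_assoc,
      Complex.conj_mul']
    push_cast; rfl
  rw [e, Complex.reCLM_apply, Complex.ofReal_re]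
  exact mul_le_mul_of_nonneg_right (w1_sq_le p) (sq_nonneg _)

lemma sum_half_pow_dist_le (n i : ℕ) :
    ∑ j ∈ Finset.range n, (1 / 2 : ℝ) ^ ((i - j) + (j - i)) ≤ 3 := by
  have h1 : ∑ j ∈ Finset.range n, (1 / 2 : ℝ) ^ ((i - j) + (j - i))
      ≤ ∑ j ∈ Finset.range ((i + 1) + n), (1 / 2 : ℝ) ^ ((i - j) + (j - i)) :=
    Finset.sum_le_sum_of_subset_of_nonneg (Finset.range_subset_range.mpr (by omega))
      fun _ _ _ => by positivity
  have h2 : ∑ j ∈ Finset.range (i + 1), (1 / 2 : ℝ) ^ ((i - j) + (j - i)) ≤ 2 := by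
    refine le_trans (le_of_eq ?_) (sum_geometric_two_le (i + 1))
    rw [← Finset.sum_range_reflect (fun k => (1 / 2 : ℝ) ^ k)]
    refine Finset.sum_congr rfl fun j hj => ?_
    have := Finset.mem_range.mp hj
    congr 1; omega
  have h3 : ∑ j ∈ Finset.range n, (1 / 2 : ℝ) ^ ((i - (i + 1 + j)) + (i + 1 + j - i)) ≤ 1 := by
    have := sum_geometric_two_le n
    have e : ∀ j ∈ Finset.range n, (1 / 2 : ℝ) ^ ((i - (i + 1 + j)) + (i + 1 + j - i))
        = (1 / 2) * (1 / 2 : ℝ) ^ j := fun j _ => by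
      rw [← pow_succ']; congr 1; omega
    rw [Finset.sum_congr rfl e, ← Finset.mul_sum]
    linarith
  rw [Finset.sum_range_add] at h1
  linarith

/-- Almost orthogonality. -/
lemma norm_sum_sq_le {H : Type*} [NormedAddCommGroup H] [InnerProductSpace ℂ H] (v : ℕ → H)
    (b : ℕ → ℝ) {c : ℝ} (hc : 0 ≤ c)
    (h : ∀ i j, ‖inner ℂ (v i) (v j)‖ ≤ c * (Rs j * (b i * b j))) (n : ℕ) :
    ‖∑ j ∈ Finset.range n, v j‖ ^ 2 ≤ 3 * c * ∑ j ∈ Finset.range n, Rs j * b j ^ 2 := by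
  have aux : ∀ i k, ‖inner ℂ (v (i + k)) (v i)‖
      ≤ c * ((1 / 2 : ℝ) ^ k * ((Rs i * b i ^ 2 + Rs (i + k) * b (i + k) ^ 2) / 2)) := fun i k => by
    refine (h _ _).trans (mul_le_mul_of_nonneg_left ?_ hc)
    have e : Rs (i + k) = Rs i * (2 ^ k) ^ 2 := by
      rw [Rs, Rs, ← pow_mul, mul_comm k 2, pow_mul]; norm_num; ring
    have hR := Rs_pos i
    have h2 : (0 : ℝ) < 2 ^ k := by positivity
    rw [e, one_div, inv_pow]
    field_simp
    nlinarith [sq_nonneg (b i - 2 ^ k * b (i + k))]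
  have key : ∀ i j, ‖inner ℂ (v i) (v j)‖
      ≤ c * ((1 / 2 : ℝ) ^ ((i - j) + (j - i)) * ((Rs i * b i ^ 2 + Rs j * b j ^ 2) / 2)) := fun i j => by
    rcases le_total i j with hij | hij
    · obtain ⟨k, rfl⟩ := Nat.exists_eq_add_of_le hij
      rw [norm_inner_symm, show i - (i + k) + (i + k - i) = k by omega]
      exact aux i k
    · obtain ⟨k, rfl⟩ := Nat.exists_eq_add_of_le hij
      rw [show (j + k) - j + (j - (j + k)) = k by omega, add_comm (Rs (j + k) * _)]
      exact aux j k
  have e1 : ‖∑ j ∈ Finset.range n, v j‖ ^ 2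
      ≤ ∑ i ∈ Finset.range n, ∑ j ∈ Finset.range n, ‖inner ℂ (v i) (v j)‖ := by
    rw [← inner_self_eq_norm_sq (𝕜 := ℂ), sum_inner]
    simp only [inner_sum]
    refine (Complex.re_le_norm _).trans (norm_sum_le_of_le _ fun i _ => norm_sum_le _ _)
  refine e1.trans ((Finset.sum_le_sum fun i _ => Finset.sum_le_sum fun j _ => key i j).trans ?_)
  set K : ℕ → ℕ → ℝ := fun i j => (1 / 2 : ℝ) ^ ((i - j) + (j - i)) with hK
  set A : ℕ → ℝ := fun i => Rs i * b i ^ 2 with hA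
  have hA0 : ∀ i, 0 ≤ A i := fun i => mul_nonneg (Rs_pos i).le (sq_nonneg _)
  have e2 : ∑ i ∈ Finset.range n, ∑ j ∈ Finset.range n, c * (K i j * ((A i + A j) / 2))
      = c * ∑ i ∈ Finset.range n, A i * ∑ j ∈ Finset.range n, K i j := by
    have s1 : ∑ i ∈ Finset.range n, ∑ j ∈ Finset.range n, K i j * A j
        = ∑ i ∈ Finset.range n, ∑ j ∈ Finset.range n, K i j * A i := by
      rw [Finset.sum_comm]
      refine Finset.sum_congr rfl fun i _ => Finset.sum_congr rfl fun j _ => ?_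
      simp only [hK, add_comm]
    have s2 : ∀ i j, c * (K i j * ((A i + A j) / 2)) = c / 2 * (K i j * A i) + c / 2 * (K i j * A j) :=
      fun i j => by ring
    simp only [s2, Finset.sum_add_distrib, ← Finset.mul_sum, s1]
    rw [← add_mul, add_halves]
    congr 1
    refine Finset.sum_congr rfl fun i _ => ?_
    rw [Finset.mul_sum]
    exact Finset.sum_congr rfl fun j _ => mul_comm _ _
  refine e2.le.trans ?_
  have e3 : ∑ i ∈ Finset.range n, A i * ∑ j ∈ Finset.range n, K i j ≤ 3 * ∑ i ∈ Finset.range n, A i := by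
    rw [Finset.mul_sum]
    refine Finset.sum_le_sum fun i _ => ?_
    rw [mul_comm]
    exact mul_le_mul_of_nonneg_right (sum_half_pow_dist_le n i) (hA0 i)
  nlinarith

lemma sum_norm_nab_le (g : ℕ → Sc d) (N : ℕ) : ∑ j ∈ Finset.range N, ‖nab (g j)‖
    ≤ 3 / 5 * √(∑ j ∈ Finset.range N, Rs j * ‖nab (g j)‖ ^ 2) := by
  set E := ∑ j ∈ Finset.range N, Rs j * ‖nab (g j)‖ ^ 2
  have hE : 0 ≤ E := Finset.sum_nonneg fun j _ => mul_nonneg (Rs_pos j).le (sq_nonneg _)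
  refine le_of_sq_le_sq ?_ (by positivity)
  rw [mul_pow, Real.sq_sqrt hE]
  have h1 : ∀ j ∈ Finset.range N, ‖nab (g j)‖ = (1 / 2 : ℝ) ^ (j + 1) * ((2 : ℝ) ^ (j + 1) * ‖nab (g j)‖) :=
    fun j _ => by rw [← mul_assoc, ← mul_pow]; norm_num
  rw [Finset.sum_congr rfl h1]
  refine (Finset.sum_mul_sq_le_sq_mul_sq _ _ _).trans ?_
  have h2 : ∑ j ∈ Finset.range N, ((2 : ℝ) ^ (j + 1) * ‖nab (g j)‖) ^ 2 = E :=
    Finset.sum_congr rfl fun j _ => by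
      rw [mul_pow, ← pow_mul, mul_comm (j + 1) 2, pow_mul, Rs]; norm_num
  rw [h2]
  refine mul_le_mul_of_nonneg_right ?_ hE
  have h3 : ∀ n : ℕ, ∑ j ∈ Finset.range n, ((1 / 2 : ℝ) ^ (j + 1)) ^ 2 = 1 / 3 * (1 - (1 / 4) ^ n) := by
    intro n
    induction n with
    | zero => simp
    | succ n ih =>
      rw [Finset.sum_range_succ, ih, ← pow_mul, mul_comm (n + 1) 2, pow_mul]
      norm_num [pow_succ]; ring
  rw [h3]
  have : (0 : ℝ) ≤ (1 / 4) ^ N := by positivity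
  linarith

/-- The basic weighted estimate. -/
lemma norm_Wt_sum_phis_le (hd : 1 ≤ d) (g : ℕ → Sc d) (N : ℕ) :
    ‖Wt (∑ j ∈ Finset.range (N + 1), phis d j (Dop d (g j) + ((Rs j + d : ℝ) : ℂ) • g j))‖
      ≤ (4 + 6 / d) * √(∑ j ∈ Finset.range (N + 1), Rs j * ‖nab (g j)‖ ^ 2) := by
  set E := ∑ j ∈ Finset.range (N + 1), Rs j * ‖nab (g j)‖ ^ 2 with hEdef
  have hE : 0 ≤ E := Finset.sum_nonneg fun j _ => mul_nonneg (Rs_pos j).le (sq_nonneg _)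
  have hd0 : (1 : ℝ) ≤ d := by exact_mod_cast hd
  have hd1 : (0 : ℝ) < d := by linarith
  choose C hC hCx hCb using fun j => exists_phis_mul_Dop (d := d) j
  choose B hB hBx hBb using fun j => exists_phis_succ_eq (d := d) j
  set G := ∑ j ∈ Finset.range (N + 1), phis d j (g j) with hG
  have hP := sum_norm_nab_le g (N + 1)
  rw [← hEdef] at hP
  have hnphis : ∀ j, ‖nab (phis d j (g j))‖ ≤ ‖nab (g j)‖ := fun j => by
    simpa using norm_nab_le (fun k => Xk_comm_phis k j) zero_le_one (bddL2_phis j) (g j)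
  have hnG : ‖nab G‖ ≤ 3 / 5 * √E := by
    rw [hG, map_sum]
    exact (norm_sum_le_of_le _ fun j _ => hnphis j).trans hP
  have hT : ‖toL2 (Tt d G)‖ ≤ 9 / 10 * √E := by
    have key : ∀ i j, ‖inner ℂ (toL2 (Tt d (phis d i (g i)))) (toL2 (Tt d (phis d j (g j))))‖
        ≤ 1 / (4 * d) * (Rs j * (‖nab (g i)‖ * ‖nab (g j)‖)) := fun i j => by
      have h1 := norm_inner_Tt_le (phis d i (g i)) (Tt d (phis d j (g j)))
      have h2 := norm_nab_le (B := Tt d * phis d j)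
        (fun k => Commute.mul_right (Xk_mul_Tt k) (Xk_comm_phis k j))
        (Rs_pos j).le (bddL2_Tt_mul_phis j) (g j)
      have h3 := mul_le_mul (hnphis i) h2 (norm_nonneg _) (norm_nonneg _)
      rw [one_div, inv_mul_eq_div, le_div_iff₀ (by positivity), mul_comm]
      refine h1.trans (h3.trans (le_of_eq ?_))
      ring
    have := norm_sum_sq_le _ (fun j => ‖nab (g j)‖) (by positivity) key (N + 1)
    refine le_of_sq_le_sq ?_ (by positivity)
    rw [hG, map_sum, map_sum, mul_pow, Real.sq_sqrt hE]
    refine this.trans (mul_le_mul_of_nonneg_right ?_ hE)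
    rw [mul_one_div, div_le_iff₀ (by positivity)]
    linarith
  have hH : ‖toL2 (∑ j ∈ Finset.range N, ((Rs (j + 1) : ℝ) : ℂ) • phis d (j + 1) (g (j + 1)))‖
      ≤ 9 / 5 * √E := by
    set v : ℕ → Lp ℂ 2 (volume : Measure (Hd d)) := fun j =>
      ((Rs (j + 1) : ℝ) : ℂ) • toL2 (phis d (j + 1) (g (j + 1))) with hv
    have key : ∀ i j, ‖inner ℂ (v i) (v j)‖
        ≤ 4 / d * (Rs j * (‖nab (g (i + 1))‖ * ‖nab (g (j + 1))‖)) := fun i j => by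
      have h1 := norm_inner_Tt_le (B i (g (i + 1))) (phis d (j + 1) (g (j + 1)))
      have h2 := norm_nab_le (hBx i) (by have := Rs_pos (i + 1); positivity) (hBb i) (g (i + 1))
      have h3 := h1.trans (mul_le_mul h2 (hnphis (j + 1)) (norm_nonneg _)
        (mul_nonneg (by have := Rs_pos (i + 1); positivity) (norm_nonneg _)))
      have e : Tt d (B i (g (i + 1))) = phis d (i + 1) (g (i + 1)) :=
        (congrArg (fun A : Module.End ℂ (Sc d) => A (g (i + 1))) (hB i)).symm
      rw [e] at h3
      have hp1 := Rs_pos (i + 1)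
      have hp2 := Rs_pos (j + 1)
      simp only [hv, inner_smul_left, inner_smul_right, norm_mul, Complex.conj_ofReal,
        Complex.norm_real, Real.norm_eq_abs, abs_of_pos hp1, abs_of_pos hp2]
      rw [div_mul_eq_mul_div, le_div_iff₀ hd1]
      have h4 := mul_le_mul_of_nonneg_left h3 (mul_pos hp1 hp2).le
      have e2 : Rs (i + 1) * Rs (j + 1) * (4 / Rs (i + 1) * ‖nab (g (i + 1))‖ * ‖nab (g (j + 1))‖)
          = 4 * (4 * (Rs j * (‖nab (g (i + 1))‖ * ‖nab (g (j + 1))‖))) := by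
        rw [Rs_succ j]; field_simp
      rw [e2] at h4
      linarith
    have h5 := norm_sum_sq_le v (fun j => ‖nab (g (j + 1))‖) (by positivity) key N
    have h6 : 4 * ∑ j ∈ Finset.range N, Rs j * ‖nab (g (j + 1))‖ ^ 2 ≤ E := by
      rw [hEdef, Finset.sum_range_succ', Finset.mul_sum]
      have : 0 ≤ Rs 0 * ‖nab (g 0)‖ ^ 2 := mul_nonneg (Rs_pos 0).le (sq_nonneg _)
      refine (le_of_eq (Finset.sum_congr rfl fun j _ => ?_)).trans (le_add_of_nonneg_right this)
      rw [Rs_succ]; ring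
    refine le_of_sq_le_sq ?_ (by positivity)
    rw [map_sum, mul_pow, Real.sq_sqrt hE]
    simp only [map_smul]
    refine h5.trans ?_
    have h7 : 4 / (d : ℝ) ≤ 4 := by rw [div_le_iff₀ hd1]; linarith
    have h8 : 0 ≤ ∑ j ∈ Finset.range N, Rs j * ‖nab (g (j + 1))‖ ^ 2 :=
      Finset.sum_nonneg fun j _ => mul_nonneg (Rs_pos j).le (sq_nonneg _)
    nlinarith
  have hCsum : ‖Wt (∑ j ∈ Finset.range (N + 1), C j (g j))‖ ≤ 3 / d * (3 / 5 * √E) := by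
    rw [map_sum]
    refine le_trans (norm_sum_le_of_le (f := fun j => Wt (C j (g j)))
      (n := fun j => 3 / d * ‖nab (g j)‖) _ fun j _ => ?_) ?_
    · have h1 := hardy (C j (g j))
      have h2 := norm_nab_le (hCx j) (by norm_num) (hCb j) (g j)
      rw [div_mul_eq_mul_div, le_div_iff₀ hd1]
      linarith
    · rw [← Finset.mul_sum]
      exact mul_le_mul_of_nonneg_left hP (by positivity)
  have h0 : ‖Wt (((Rs 0 : ℝ) : ℂ) • phis d 0 (g 0))‖ ≤ 2 / d * √E := by
    have h1 := hardy (phis d 0 (g 0))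
    have h2 := hnphis 0
    have h3 : 2 * ‖nab (g 0)‖ ≤ √E := by
      refine Real.le_sqrt_of_sq_le ?_
      have := Finset.single_le_sum (f := fun j => Rs j * ‖nab (g j)‖ ^ 2)
        (fun j _ => mul_nonneg (Rs_pos j).le (sq_nonneg _)) (Finset.mem_range.mpr N.succ_pos)
      refine le_trans (le_of_eq ?_) this
      simp only [Rs]; ring
    rw [map_smul, norm_smul, Complex.norm_real, Real.norm_eq_abs, abs_of_pos (Rs_pos 0),
      div_mul_eq_mul_div, le_div_iff₀ hd1]
    have h4 : Rs 0 = 4 := by norm_num [Rs]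
    rw [h4]; linarith
  have hdec : ∑ j ∈ Finset.range (N + 1), phis d j (Dop d (g j) + ((Rs j + d : ℝ) : ℂ) • g j)
      = ∑ k, mu (qf d k) (Xk d k G) + (2 : ℂ) • mu (tf d) (Tt d G)
        + (2 : ℂ) • ∑ j ∈ Finset.range (N + 1), C j (g j) + (d : ℂ) • G
        + ((Rs 0 : ℝ) : ℂ) • phis d 0 (g 0)
        + ∑ j ∈ Finset.range N, ((Rs (j + 1) : ℝ) : ℂ) • phis d (j + 1) (g (j + 1)) := by
    have e1 : ∀ j, phis d j (Dop d (g j) + ((Rs j + d : ℝ) : ℂ) • g j)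
        = Dop d (phis d j (g j)) + (2 : ℂ) • C j (g j) + (d : ℂ) • phis d j (g j)
          + ((Rs j : ℝ) : ℂ) • phis d j (g j) := fun j => by
      have := congrArg (fun A : Module.End ℂ (Sc d) => A (g j)) (hC j)
      simp only [Module.End.mul_apply, LinearMap.add_apply, LinearMap.smul_apply] at this
      rw [map_add, map_smul, this]
      push_cast; module
    have e2 : ∑ k, mu (qf d k) (Xk d k G) + (2 : ℂ) • mu (tf d) (Tt d G) = Dop d G := by
      simp only [Dop, LinearMap.add_apply, LinearMap.smul_apply, LinearMap.sum_apply,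
        Module.End.mul_apply]
    simp only [e1, Finset.sum_add_distrib, ← Finset.smul_sum]
    rw [e2, ← map_sum, ← hG, Finset.sum_range_succ' (fun j => ((Rs j : ℝ) : ℂ) • phis d j (g j))]
    abel
  have hGW := hardy G
  rw [hdec]
  simp only [map_add]
  have n1 := norm_Wt_sum_le G
  have n2 : ‖Wt ((2 : ℂ) • mu (tf d) (Tt d G))‖ ≤ 2 * ‖toL2 (Tt d G)‖ := by
    rw [map_smul, norm_smul]
    have := norm_Wt_mu_tf_le (Tt d G)
    norm_num; exact this
  have n3 : ‖Wt ((2 : ℂ) • ∑ j ∈ Finset.range (N + 1), C j (g j))‖ ≤ 2 * (3 / d * (3 / 5 * √E)) := by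
    rw [map_smul, norm_smul, Complex.norm_ofNat]
    exact mul_le_mul_of_nonneg_left hCsum (by norm_num)
  have n4 : ‖Wt ((d : ℂ) • G)‖ ≤ 3 / 5 * √E := by
    rw [map_smul, norm_smul, Complex.norm_natCast]; linarith
  have n6 := norm_Wt_le (∑ j ∈ Finset.range N, ((Rs (j + 1) : ℝ) : ℂ) • phis d (j + 1) (g (j + 1)))
  refine (norm_add_le_of_le (norm_add_le_of_le (norm_add_le_of_le (norm_add_le_of_le
    (norm_add_le_of_le n1 n2) n3) n4) h0) n6).trans ?_
  have hs : 0 ≤ √E := Real.sqrt_nonneg E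
  have hq : 0 ≤ √E / d := by positivity
  have e1 : 2 * (3 / d * (3 / 5 * √E)) = 18 / 5 * (√E / d) := by ring
  have e2 : 2 / d * √E = 2 * (√E / d) := by ring
  have e3 : (4 + 6 / d) * √E = 4 * √E + 6 * (√E / d) := by ring
  rw [e1, e2, e3]
  linarith

/-- The homogeneous dilations of the Heisenberg group. -/
def dil (d : ℕ) (s : ℝ) : Hd d ≃L[ℝ] Hd d :=
  (ContinuousLinearEquiv.smulLeft (Units.mk0 (Real.exp s) (Real.exp_ne_zero s))).prodCongr
    ((ContinuousLinearEquiv.smulLeft (Units.mk0 (Real.exp s) (Real.exp_ne_zero s))).prodCongr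
      (ContinuousLinearEquiv.smulLeft (Units.mk0 (Real.exp (2 * s)) (Real.exp_ne_zero _))))

lemma dil_apply (s : ℝ) (p : Hd d) :
    dil d s p = (Real.exp s • p.1, Real.exp s • p.2.1, Real.exp (2 * s) * p.2.2) := rfl

/-- The unitary action of dilations. -/
def Ud (d : ℕ) (s : ℝ) : Module.End ℂ (Sc d) :=
  ((Real.exp ((d + 1) * s) : ℝ) : ℂ) •
    (SchwartzMap.compCLMOfContinuousLinearEquiv ℂ (dil d s)).toLinearMap

lemma Ud_apply (s : ℝ) (f : Sc d) (p : Hd d) :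
    Ud d s f p = ((Real.exp ((d + 1) * s) : ℝ) : ℂ) * f (dil d s p) := rfl

lemma dil_add (s t : ℝ) (p : Hd d) : dil d (s + t) p = dil d t (dil d s p) := by
  simp only [dil_apply, smul_smul, ← Real.exp_add, ← mul_assoc]
  ring_nf

lemma dil_zero (p : Hd d) : dil d 0 p = p := by simp [dil_apply]

lemma Ud_add (s t : ℝ) (f : Sc d) : Ud d (s + t) f = Ud d s (Ud d t f) := by
  ext p
  simp only [Ud_apply, dil_add, ← mul_assoc, ← Complex.ofReal_mul, ← Real.exp_add, mul_add]

lemma Ud_zero (f : Sc d) : Ud d 0 f = f := by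
  ext p
  simp [Ud_apply, dil_zero]

lemma Ud_comm (s t : ℝ) (f : Sc d) : Ud d s (Ud d t f) = Ud d t (Ud d s f) := by
  rw [← Ud_add, add_comm, Ud_add]

lemma det_dil (s : ℝ) : LinearMap.det ((dil d s : Hd d →L[ℝ] Hd d) : Hd d →ₗ[ℝ] Hd d)
    = Real.exp ((d + 1) * s) ^ 2 := by
  have e : ((dil d s : Hd d →L[ℝ] Hd d) : Hd d →ₗ[ℝ] Hd d)
      = LinearMap.prodMap (Real.exp s • LinearMap.id)
        (LinearMap.prodMap (Real.exp s • LinearMap.id) (Real.exp (2 * s) • LinearMap.id)) := by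
    ext p <;> rfl
  rw [e, LinearMap.det_prodMap, LinearMap.det_prodMap]
  simp only [LinearMap.det_smul, LinearMap.det_id, mul_one, finrank_euclideanSpace_fin,
    Module.finrank_self, ← Real.exp_nat_mul, ← Real.exp_add]
  congr 1; push_cast; ring

lemma inner_Ud (s : ℝ) (f g : Sc d) :
    inner ℂ (toL2 (Ud d s f)) (toL2 (Ud d s g)) = inner ℂ (toL2 f) (toL2 g) := by
  have h := integral_image_eq_integral_abs_det_fderiv_smul (volume : Measure (Hd d))
    MeasurableSet.univ (f := dil d s) (f' := fun _ => (dil d s : Hd d →L[ℝ] Hd d))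
    (fun p _ => (dil d s).hasFDerivAt.hasFDerivWithinAt) (dil d s).injective.injOn
    (fun p => starRingEnd ℂ (f p) * g p)
  rw [Set.image_univ, (dil d s).surjective.range_eq, Measure.restrict_univ] at h
  rw [inner_toL2, inner_toL2, h]
  congr 1; ext p
  rw [ContinuousLinearMap.det, det_dil, abs_of_pos (by positivity), Ud_apply, Ud_apply, map_mul,
    Complex.conj_ofReal, Complex.real_smul]
  push_cast; ring

lemma inner_Ud_add (a s t : ℝ) (f g : Sc d) :
    inner ℂ (toL2 (Ud d (s + a) f)) (toL2 (Ud d (t + a) g))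
      = inner ℂ (toL2 (Ud d s f)) (toL2 (Ud d t g)) := by
  rw [add_comm s, add_comm t, Ud_add, Ud_add, inner_Ud]

lemma norm_toL2_Ud (s : ℝ) (f : Sc d) : ‖toL2 (Ud d s f)‖ = ‖toL2 f‖ := by
  have h := inner_Ud s f f
  rw [inner_self_eq_norm_sq_to_K, inner_self_eq_norm_sq_to_K] at h
  have h2 : ‖toL2 (Ud d s f)‖ ^ 2 = ‖toL2 f‖ ^ 2 := by exact_mod_cast h
  exact (pow_left_inj₀ (norm_nonneg _) (norm_nonneg _) two_ne_zero).mp h2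

lemma dil_ev (s : ℝ) (k : Fin d ⊕ Fin d) : dil d s (ev d k) = Real.exp s • ev d k := by
  rcases k with k | k <;> simp [dil_apply, ev]

lemma dil_tv (s : ℝ) : dil d s (tv d) = Real.exp (2 * s) • tv d := by
  simp [dil_apply, tv]

lemma qc_dil (s : ℝ) (k : Fin d ⊕ Fin d) (p : Hd d) :
    qc d k (dil d s p) = Real.exp s * qc d k p := by
  rcases k with k | k <;> simp [dil_apply, qc, qf]

lemma fderiv_Ud (s : ℝ) (f : Sc d) (p v : Hd d) : fderiv ℝ (Ud d s f) p v
    = ((Real.exp ((d + 1) * s) : ℝ) : ℂ) * fderiv ℝ f (dil d s p) (dil d s v) := by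
  have h : HasFDerivAt (Ud d s f) (((Real.exp ((d + 1) * s) : ℝ) : ℂ) •
      (fderiv ℝ f (dil d s p)).comp (dil d s : Hd d →L[ℝ] Hd d)) p :=
    ((f.differentiableAt.hasFDerivAt (x := dil d s p)).comp p (dil d s).hasFDerivAt).const_mul _
  rw [h.fderiv]; rfl

lemma Xk_Ud (s : ℝ) (k : Fin d ⊕ Fin d) (f : Sc d) :
    Xk d k (Ud d s f) = (Real.exp s : ℂ) • Ud d s (Xk d k f) := by
  ext p
  rw [smul_apply, Ud_apply, Xk_apply, Xk_apply, fderiv_Ud, map_add, map_smul, dil_ev, dil_tv, qc_dil]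
  have e : Real.exp s • ev d k + (2 * qc d k p) • Real.exp (2 * s) • tv d
      = Real.exp s • (ev d k + (2 * (Real.exp s * qc d k p)) • tv d) := by
    rw [smul_add, smul_smul, smul_smul, two_mul s, Real.exp_add]
    congr 2; ring
  rw [e, map_smul, Complex.real_smul, smul_eq_mul, Complex.ofReal_exp]
  ring

/-- The infinitesimal generator of dilations. -/
def Ad (d : ℕ) : Module.End ℂ (Sc d) := Dop d + ((d + 1 : ℝ) : ℂ) • 1

lemma sum_qf_smul_ev (p : Hd d) : ∑ k, qf d k p • ev d k = (p.1, p.2.1, 0) := by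
  rw [Fintype.sum_sum_type]
  refine Prod.ext ?_ (Prod.ext ?_ ?_)
  · ext j
    simp [qf, ev, Prod.fst_sum, Finset.sum_apply, Pi.single_apply]
  · ext j
    simp [qf, ev, Prod.fst_sum, Prod.snd_sum, Finset.sum_apply, Pi.single_apply]
  · simp [ev, Prod.snd_sum]

lemma Dop_apply (f : Sc d) (p : Hd d) :
    Dop d f p = fderiv ℝ f p (p.1, p.2.1, 2 * p.2.2) := by
  have e : ((p.1, p.2.1, 2 * p.2.2) : Hd d)
      = ∑ k, qf d k p • (ev d k + (2 * qc d k p) • tv d) + (2 * tf d p) • tv d := by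
    simp only [smul_add, Finset.sum_add_distrib, smul_smul]
    simp only [mul_left_comm _ (2 : ℝ)]
    rw [sum_qf_smul_ev, ← Finset.sum_smul, ← Finset.mul_sum, sum_qf_mul_qc]
    simp [tv, tf]
  rw [e, map_add, map_sum, map_smul]
  simp only [map_smul, Dop, LinearMap.add_apply, LinearMap.sum_apply, LinearMap.smul_apply,
    Module.End.mul_apply, add_apply, sum_apply, smul_apply, mu_apply, Tt_apply, Complex.real_smul,
    smul_eq_mul]
  simp only [Xk_apply, map_add, map_smul, Complex.real_smul]
  push_cast
  rw [mul_assoc]; rfl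

lemma Ad_apply (f : Sc d) (p : Hd d) : Ad d f p
    = fderiv ℝ f p (p.1, p.2.1, 2 * p.2.2) + ((d + 1 : ℝ) : ℂ) * f p := by
  rw [← Dop_apply]; rfl

lemma hasDerivAt_Ud_apply (f : Sc d) (p : Hd d) (s : ℝ) :
    HasDerivAt (fun s => Ud d s f p) (Ud d s (Ad d f) p) s := by
  have h1 : HasDerivAt (fun s => dil d s p)
      ((dil d s p).1, (dil d s p).2.1, 2 * (dil d s p).2.2) s := by
    simp only [dil_apply]
    refine ((Real.hasDerivAt_exp s).smul_const p.1).prodMk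
      (((Real.hasDerivAt_exp s).smul_const p.2.1).prodMk ?_)
    have := (((hasDerivAt_id s).const_mul 2).exp).mul_const p.2.2
    refine this.congr_deriv ?_
    simp; ring
  have h2 := (f.differentiableAt.hasFDerivAt (x := dil d s p)).comp_hasDerivAt s h1
  have h3 : HasDerivAt (fun s => ((Real.exp ((d + 1) * s) : ℝ) : ℂ))
      ((Real.exp ((d + 1) * s) * (d + 1) : ℝ) : ℂ) s := by
    refine HasDerivAt.ofReal_comp ?_
    have := ((hasDerivAt_id s).const_mul (d + 1 : ℝ)).exp
    simpa using this
  simp only [Ud_apply]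
  refine (h3.mul h2).congr_deriv ?_
  rw [Ad_apply]
  simp only [Function.comp]
  push_cast; ring

lemma Ad_Ud (s : ℝ) (f : Sc d) : Ad d (Ud d s f) = Ud d s (Ad d f) := by
  ext p
  have h1 := hasDerivAt_Ud_apply (Ud d s f) p 0
  have h2 := (hasDerivAt_Ud_apply f (dil d s p) 0).const_mul ((Real.exp ((d + 1) * s) : ℝ) : ℂ)
  have e : (fun t => Ud d t (Ud d s f) p)
      = fun t => ((Real.exp ((d + 1) * s) : ℝ) : ℂ) * Ud d t f (dil d s p) := by
    funext t; rw [Ud_comm]; rfl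
  rw [e] at h1
  have := h1.unique h2
  rw [Ud_zero, Ud_zero] at this
  exact this

lemma hasDerivAt_inner_Ud (g u : Sc d) (s : ℝ) :
    HasDerivAt (fun s => inner ℂ (toL2 g) (toL2 (Ud d s u)))
      (inner ℂ (toL2 g) (toL2 (Ud d s (Ad d u)))) s := by
  simp only [inner_toL2]
  set M := SchwartzMap.seminorm ℂ 0 0 (Ad d u)
  refine (hasDerivAt_integral_of_dominated_loc_of_deriv_le
    (F := fun s p => starRingEnd ℂ (g p) * Ud d s u p)
    (F' := fun s p => starRingEnd ℂ (g p) * Ud d s (Ad d u) p)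
    (bound := fun p => Real.exp ((d + 1) * (s + 1)) * M * ‖g p‖)
    (s := Set.Iio (s + 1)) (Iio_mem_nhds (by linarith)) ?_ ?_ ?_ ?_ ?_ ?_).2
  · refine .of_forall fun r => ?_
    exact ((Complex.continuous_conj.comp g.continuous).mul
      (Ud d r u).continuous).aestronglyMeasurable
  · have := L2.integrable_inner (𝕜 := ℂ) (toL2 g) (toL2 (Ud d s u))
    refine this.congr ?_
    filter_upwards [coeFn_toL2 g, coeFn_toL2 (Ud d s u)] with p h1 h2
    rw [h1, h2, RCLike.inner_apply, mul_comm]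
  · exact ((Complex.continuous_conj.comp g.continuous).mul
      (Ud d s (Ad d u)).continuous).aestronglyMeasurable
  · refine .of_forall fun p r hr => ?_
    have hr' : r < s + 1 := hr
    have h1 := SchwartzMap.norm_le_seminorm ℂ (Ad d u) (dil d r p)
    have h2 : Real.exp ((d + 1) * r) ≤ Real.exp ((d + 1) * (s + 1)) :=
      Real.exp_le_exp.mpr (by gcongr)
    rw [norm_mul, RCLike.norm_conj, Ud_apply, norm_mul, Complex.norm_real, Real.norm_eq_abs,
      abs_of_pos (Real.exp_pos _), mul_comm]
    gcongr
  · exact (g.integrable.norm).const_mul _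
  · exact .of_forall fun p r _ => (hasDerivAt_Ud_apply u p r).const_mul _

lemma continuous_toL2_Ud (u : Sc d) : Continuous fun s => toL2 (Ud d s u) := by
  have hc : Continuous fun s => inner ℂ (toL2 u) (toL2 (Ud d s u)) :=
    continuous_iff_continuousAt.mpr fun s => (hasDerivAt_inner_Ud u u s).continuousAt
  rw [continuous_iff_continuousAt]
  intro s
  rw [ContinuousAt, tendsto_iff_norm_sub_tendsto_zero]
  have e : ∀ t, ‖toL2 (Ud d t u) - toL2 (Ud d s u)‖
      = √(2 * ‖toL2 u‖ ^ 2 - 2 * (inner ℂ (toL2 u) (toL2 (Ud d (t - s) u))).re) := fun t => by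
    have h := norm_sub_sq (𝕜 := ℂ) (toL2 (Ud d s u)) (toL2 (Ud d t u))
    have h1 := inner_Ud_add s 0 (t - s) u u
    rw [zero_add, sub_add_cancel, Ud_zero] at h1
    rw [h1, norm_toL2_Ud, norm_toL2_Ud] at h
    rw [norm_sub_rev, ← Real.sqrt_sq (norm_nonneg (toL2 (Ud d s u) - toL2 (Ud d t u))), h]
    congr 1
    rw [RCLike.re_to_complex]; ring
  have h0 : √(2 * ‖toL2 u‖ ^ 2 - 2 * (inner ℂ (toL2 u) (toL2 (Ud d (s - s) u))).re) = 0 := by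
    rw [← e, sub_self, norm_zero]
  simp only [e]
  rw [← h0]
  refine Continuous.tendsto (Real.continuous_sqrt.comp (continuous_const.sub
    (continuous_const.mul (Complex.continuous_re.comp (hc.comp ?_))))) s
  fun_prop

lemma hasDerivAt_toL2_Ud (u : Sc d) (s : ℝ) :
    HasDerivAt (fun s => toL2 (Ud d s u)) (toL2 (Ud d s (Ad d u))) s := by
  have hc := continuous_toL2_Ud (Ad d u)
  have e : (fun s => toL2 (Ud d s u))
      = fun s => toL2 u + ∫ v in (0 : ℝ)..s, toL2 (Ud d v (Ad d u)) := by
    funext s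
    refine ext_inner_left ℂ fun φ => ?_
    refine denseRange_toL2.induction_on φ
      (isClosed_eq (by fun_prop) (by fun_prop)) fun g => ?_
    have h1 := intervalIntegral.integral_eq_sub_of_hasDerivAt
      (fun v _ => hasDerivAt_inner_Ud g u v) ((Continuous.inner continuous_const hc).intervalIntegrable 0 s)
    rw [Ud_zero] at h1
    have h2 := (innerSL ℂ (toL2 g)).intervalIntegral_comp_comm (hc.intervalIntegrable 0 s)
      (μ := volume)
    simp only [innerSL_apply_apply] at h2
    rw [inner_add_right, ← h2, h1]
    ring
  rw [e]
  exact (intervalIntegral.integral_hasDerivAt_right (hc.intervalIntegrable 0 s)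
    hc.aestronglyMeasurable.stronglyMeasurableAtFilter hc.continuousAt).const_add _

lemma hasDerivAt_functional_Ud {E : Type*} [NormedAddCommGroup E] [NormedSpace ℂ E]
    (L : Sc d →ₗ[ℂ] E) {C : ℝ} (hL : ∀ g, ‖L g‖ ≤ C * ‖toL2 g‖) (u : Sc d) (s : ℝ) :
    HasDerivAt (fun s => L (Ud d s u)) (L (Ud d s (Ad d u))) s := by
  have h := hasDerivAt_iff_isLittleO.mp (hasDerivAt_toL2_Ud u s)
  refine hasDerivAt_iff_isLittleO.mpr (Asymptotics.IsBigO.trans_isLittleO ?_ h)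
  refine Asymptotics.IsBigO.of_bound C (.of_forall fun t => ?_)
  have e1 : L (Ud d t u) - L (Ud d s u) - (t - s) • L (Ud d s (Ad d u))
      = L (Ud d t u - Ud d s u - ((t - s : ℝ) : ℂ) • Ud d s (Ad d u)) := by
    rw [map_sub, map_sub, map_smul]; rfl
  have e2 : toL2 (Ud d t u) - toL2 (Ud d s u) - (t - s) • toL2 (Ud d s (Ad d u))
      = toL2 (Ud d t u - Ud d s u - ((t - s : ℝ) : ℂ) • Ud d s (Ad d u)) := by
    rw [map_sub, map_sub, map_smul]; rfl
  rw [e1, e2]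
  exact hL _

section HilbertLemmas

variable {E : Type*} [NormedAddCommGroup E] [InnerProductSpace ℂ E] [CompleteSpace E]

/-- A linear functional dominated by the norm of a linear map factors through an inner product. -/
lemma exists_inner_eq_of_norm_le {V : Type*} [AddCommGroup V] [Module ℂ V] (A : V →ₗ[ℂ] E)
    (Λ : V →ₗ[ℂ] ℂ) {C : ℝ} (hC : 0 ≤ C) (h : ∀ v, ‖Λ v‖ ≤ C * ‖A v‖) :
    ∃ η : E, ‖η‖ ≤ C ∧ ∀ v, Λ v = inner ℂ η (A v) := by
  have hk : LinearMap.ker A ≤ LinearMap.ker Λ := fun v hv => by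
    have := h v
    rw [LinearMap.mem_ker.mp hv, norm_zero, mul_zero] at this
    exact LinearMap.mem_ker.mpr (norm_le_zero_iff.mp this)
  set f₀ : LinearMap.range A →ₗ[ℂ] ℂ :=
    (LinearMap.ker A).liftQ Λ hk ∘ₗ A.quotKerEquivRange.symm.toLinearMap with hf₀
  have hf : ∀ v, f₀ ⟨A v, v, rfl⟩ = Λ v := fun v => by
    have e : A.quotKerEquivRange.symm ⟨A v, v, rfl⟩ = (LinearMap.ker A).mkQ v := by
      rw [LinearEquiv.symm_apply_eq]; rfl
    simp [hf₀, e]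
  set f : LinearMap.range A →L[ℂ] ℂ := f₀.mkContinuous C (by
    rintro ⟨_, v, rfl⟩
    rw [hf]; exact h v) with hfdef
  obtain ⟨g, hg, hgn⟩ := exists_extension_norm_eq (LinearMap.range A) f
  refine ⟨(InnerProductSpace.toDual ℂ E).symm g, ?_, fun v => ?_⟩
  · rw [LinearIsometryEquiv.norm_map, hgn]
    exact LinearMap.mkContinuous_norm_le _ hC _
  · rw [InnerProductSpace.toDual_symm_apply, ← hf v]
    exact (hg ⟨A v, v, rfl⟩).symm

/-- The bounded solution of a first order equation is an average over the past. -/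
lemma eq_inner_pastAvg {R : ℝ} (hR : 1 < R) {x : ℝ → E} (hx : BddCurve x) (η : E) {H G : ℝ → ℂ}
    {C : ℝ} (hH : ∀ s, ‖H s‖ ≤ C) (hd : ∀ s, HasDerivAt H (G s) s)
    (hG : ∀ s, G s + (R - 1 : ℝ) * H s = Real.exp s * inner ℂ η (x s)) (s : ℝ) :
    H s = Real.exp s * inner ℂ η (pastAvg R x s) := by
  have hR0 : 0 < R := by linarith
  have hK : Integrable fun u => halfExp R 0 (-u) := (integrable_halfExp hR0 0).comp_neg
  have hi := (hx.integrable hK s)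
  have hi2 : Integrable fun u => halfExp R 0 (-u) * inner ℂ η (x (s + u)) := by
    have := hi.const_inner η (𝕜 := ℂ)
    simpa [inner_smul_right] using this
  have e : (fun u => halfExp R 0 (-u) * inner ℂ η (x (s + u)))
      = (Set.Iio (0 : ℝ)).indicator (fun u => (Real.exp (R * u) : ℂ) * inner ℂ η (x (s + u))) := by
    funext u
    by_cases hu : u < 0
    · rw [Set.indicator_of_mem (Set.mem_Iio.mpr hu), halfExp,
        Set.indicator_of_mem (Set.mem_Ioi.mpr (by linarith))]
      push_cast; simp
    · rw [Set.indicator_of_notMem (by simpa using hu), halfExp,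
        Set.indicator_of_notMem (by simp only [Set.mem_Ioi]; linarith), zero_mul]
  have hder : ∀ u : ℝ, HasDerivAt (fun u => (Real.exp ((R - 1) * u) : ℂ) * ((Real.exp (-s) : ℂ) * H (s + u)))
      ((Real.exp (R * u) : ℂ) * inner ℂ η (x (s + u))) u := fun u => by
    have h1 : HasDerivAt (fun u : ℝ => ((Real.exp ((R - 1) * u) : ℝ) : ℂ))
        ((Real.exp ((R - 1) * u) * (R - 1) : ℝ) : ℂ) u := by
      refine HasDerivAt.ofReal_comp ?_
      simpa using ((hasDerivAt_id u).const_mul (R - 1)).exp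
    have h2 : HasDerivAt (fun u => H (s + u)) (G (s + u)) u := (hd (s + u)).comp_const_add s u
    refine (h1.mul (h2.const_mul _)).congr_deriv ?_
    have h3 : (Real.exp (R * u) : ℂ)
        = Real.exp ((R - 1) * u) * (Real.exp (-s) * Real.exp (s + u)) := by
      simp only [← Complex.ofReal_mul, ← Real.exp_add]
      congr 2; ring
    rw [h3, mul_assoc, mul_assoc, ← hG]
    push_cast; ring
  have hlim : Filter.Tendsto
      (fun u => (Real.exp ((R - 1) * u) : ℂ) * ((Real.exp (-s) : ℂ) * H (s + u)))
      Filter.atBot (nhds 0) := by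
    have h1 : Filter.Tendsto (fun u : ℝ => Real.exp ((R - 1) * u) * (Real.exp (-s) * C))
        Filter.atBot (nhds 0) := by
      rw [← zero_mul (Real.exp (-s) * C)]
      refine Filter.Tendsto.mul_const _ (Real.tendsto_exp_atBot.comp ?_)
      exact Filter.tendsto_id.const_mul_atBot (by linarith)
    refine squeeze_zero_norm (fun u => ?_) h1
    rw [norm_mul, norm_mul, Complex.norm_real, Complex.norm_real, Real.norm_eq_abs,
      Real.norm_eq_abs, abs_of_pos (Real.exp_pos _), abs_of_pos (Real.exp_pos _)]
    have := hH (s + u)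
    gcongr
  have hu : IntegrableOn (fun u => (Real.exp (R * u) : ℂ) * inner ℂ η (x (s + u)))
      (Set.Iic 0) := by
    rw [integrableOn_Iic_iff_integrableOn_Iio, ← integrable_indicator_iff measurableSet_Iio, ← e]
    exact hi2
  have key := integral_Iic_of_hasDerivAt_of_tendsto (a := 0) (hder 0).continuousAt.continuousWithinAt
    (fun u _ => hder u) hu hlim
  rw [pastAvg, inner_curveAvg_right hx hK, e, integral_indicator measurableSet_Iio,
    ← integral_Iic_eq_integral_Iio, key]
  rw [mul_zero, add_zero, sub_zero, Real.exp_zero, Complex.ofReal_one, one_mul, ← mul_assoc,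
    ← Complex.ofReal_mul, ← Real.exp_add, add_neg_cancel, Real.exp_zero, Complex.ofReal_one, one_mul]

end HilbertLemmas

/-- The horizontal gradient transported along dilations. -/
def nabCurve (f : Sc d) (s : ℝ) : VL2 d := WithLp.toLp 2 fun k => toL2 (Ud d s (Xk d k f))

lemma nab_Ud (s : ℝ) (f : Sc d) : nab (Ud d s f) = (Real.exp s : ℂ) • nabCurve f s := by
  ext1 k
  rw [nab_apply, Xk_Ud, map_smul]; rfl

lemma nabCurve_zero (f : Sc d) : nabCurve f 0 = nab f := by
  simpa [Ud_zero] using (nab_Ud 0 f).symm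

lemma continuous_nabCurve (f : Sc d) : Continuous (nabCurve f) :=
  (PiLp.continuous_toLp 2 _).comp (continuous_pi fun _ => continuous_toL2_Ud _)

lemma jointlyStationary_nabCurve (f : Sc d) : JointlyStationary (nabCurve f) (nabCurve f) :=
  fun a s t => by
    simp only [PiLp.inner_apply]
    exact Finset.sum_congr rfl fun k _ => inner_Ud_add a s t _ _

lemma bddCurve_nabCurve (f : Sc d) : BddCurve (nabCurve f) :=
  (jointlyStationary_nabCurve f).bddCurve (continuous_nabCurve f)

lemma functional_Ud_eq {L : Sc d →ₗ[ℂ] ℂ} {C : ℝ} (hL : ∀ g, ‖L g‖ ≤ C * ‖toL2 g‖) {R : ℝ}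
    (hR : 1 < R) {η : VL2 d}
    (h : ∀ g, L (Dop d g + ((R + d : ℝ) : ℂ) • g) = inner ℂ η (nab g)) (f : Sc d) (s : ℝ) :
    L (Ud d s f) = Real.exp s * inner ℂ η (pastAvg R (nabCurve f) s) := by
  refine eq_inner_pastAvg hR (bddCurve_nabCurve f) η (H := fun s => L (Ud d s f))
    (C := C * ‖toL2 f‖) (fun s => ?_) (fun s => hasDerivAt_functional_Ud L hL f s) (fun s => ?_) s
  · rw [← norm_toL2_Ud s f]; exact hL _
  · rw [← inner_smul_right, ← nab_Ud, ← h, ← Ad_Ud, ← smul_eq_mul, ← map_smul, ← map_add]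
    congr 1
    simp only [Ad, LinearMap.add_apply, LinearMap.smul_apply, Module.End.one_apply]
    push_cast; module

lemma conj_inner_toL2_Ud (f : Sc d) (s : ℝ) :
    starRingEnd ℂ (inner ℂ (toL2 f) (toL2 (Ud d s f))) = inner ℂ (toL2 f) (toL2 (Ud d (-s) f)) := by
  rw [inner_conj_symm]
  have := inner_Ud_add s 0 (-s) f f
  rw [zero_add, neg_add_cancel, Ud_zero] at this
  exact this

lemma conj_inner_nabCurve (f : Sc d) (s : ℝ) :
    starRingEnd ℂ (inner ℂ (nabCurve f 0) (nabCurve f s))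
      = inner ℂ (nabCurve f 0) (nabCurve f (-s)) := by
  rw [inner_conj_symm]
  have := jointlyStationary_nabCurve f s 0 (-s)
  rwa [zero_add, neg_add_cancel] at this

/-- The past average is controlled by the resolvent equation. -/
lemma norm_pastAvg_nabCurve_le {σ : ℂ} (hσ : σ.im ≠ 0) {R : ℝ} (hR : 4 ≤ R) {f : Sc d} {η : VL2 d}
    {C : ℝ} {L : Sc d →ₗ[ℂ] ℂ} (hL : ∀ g, ‖L g‖ ≤ C * ‖toL2 g‖)
    (hLf : ∀ g, L g = inner ℂ (toL2 (Lap d f + σ • f)) (toL2 g))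
    (h : ∀ g, L (Dop d g + ((R + d : ℝ) : ℂ) • g) = inner ℂ η (nab g)) :
    R * ‖pastAvg R (nabCurve f) 0‖ ≤ 4 * ‖η‖ := by
  have key : ∀ s, (Real.exp s : ℂ) * inner ℂ η (pastAvg R (nabCurve f) s)
      = -(Real.exp s * inner ℂ (nabCurve f 0) (nabCurve f s))
        + starRingEnd ℂ σ * inner ℂ (toL2 f) (toL2 (Ud d s f)) := fun s => by
    have e : inner ℂ (toL2 (Lap d f)) (toL2 (Ud d s f))
        = -(Real.exp s * inner ℂ (nabCurve f 0) (nabCurve f s)) := by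
      rw [← inner_smul_right, ← nab_Ud, nabCurve_zero, ← inner_conj_symm (nab f),
        inner_nab_eq_Lap, map_neg, inner_conj_symm, neg_neg]
    rw [← functional_Ud_eq hL (by linarith) h, hLf, map_add, map_smul, inner_add_left,
      inner_smul_left, e]
  refine norm_pastAvg_le hR hσ (continuous_nabCurve f) (jointlyStationary_nabCurve f) η fun s => ?_
  have k2 := congrArg (starRingEnd ℂ) (key (-s))
  simp only [map_mul, map_add, map_neg, Complex.conj_ofReal, Complex.conj_conj,
    conj_inner_nabCurve, conj_inner_toL2_Ud, neg_neg] at k2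
  rw [key, k2]
  ring

lemma exists_dual (hd : 1 ≤ d) (N : ℕ) (Ψ : Lp ℂ 2 (volume : Measure (Hd d))) :
    ∃ η : Fin (N + 1) → VL2 d, √(∑ j, ‖η j‖ ^ 2) ≤ (4 + 6 / d) * ‖Ψ‖ ∧
      ∀ (j : Fin (N + 1)) f, inner ℂ Ψ (Wt (phis d j (Dop d f + ((Rs j + d : ℝ) : ℂ) • f)))
        = inner ℂ (((√(Rs j) : ℝ) : ℂ) • η j) (nab f) := by
  let F : (Fin (N + 1) → Sc d) →ₗ[ℂ] Sc d := ∑ j : Fin (N + 1),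
    (phis d j * (Dop d + ((Rs j + d : ℝ) : ℂ) • 1) : Module.End ℂ (Sc d)) ∘ₗ LinearMap.proj j
  have hF : ∀ g, F g = ∑ j : Fin (N + 1), phis d j (Dop d (g j) + ((Rs j + d : ℝ) : ℂ) • g j) :=
    fun g => by simp [F]
  let A : (Fin (N + 1) → Sc d) →ₗ[ℂ] PiLp 2 (fun _ : Fin (N + 1) => VL2 d) :=
    (WithLp.linearEquiv 2 ℂ _).symm.toLinearMap ∘ₗ
      LinearMap.pi (fun j => ((√(Rs j) : ℝ) : ℂ) • (nab ∘ₗ LinearMap.proj j))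
  have hA : ∀ g j, A g j = ((√(Rs j) : ℝ) : ℂ) • nab (g j) := fun g j => rfl
  obtain ⟨η, hη, hηA⟩ := exists_inner_eq_of_norm_le A
    ((innerSL ℂ Ψ).toLinearMap ∘ₗ Wt ∘ₗ F) (C := (4 + 6 / d) * ‖Ψ‖) (by positivity) fun g => by
      show ‖inner ℂ Ψ (Wt (F g))‖ ≤ _
      refine (norm_inner_le_norm _ _).trans ?_
      rw [mul_comm (4 + 6 / (d : ℝ)), mul_assoc]
      refine mul_le_mul_of_nonneg_left ?_ (norm_nonneg _)
      have := norm_Wt_sum_phis_le hd (fun j => if h : j < N + 1 then g ⟨j, h⟩ else 0) N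
      rw [Finset.sum_range, Finset.sum_range] at this
      simp only [Fin.is_lt, dite_true, Fin.eta] at this
      rw [hF, PiLp.norm_eq_of_L2]
      refine this.trans (le_of_eq ?_)
      congr 2
      refine Finset.sum_congr rfl fun j _ => ?_
      rw [hA, norm_smul, Complex.norm_real, mul_pow, Real.norm_eq_abs, sq_abs,
        Real.sq_sqrt (Rs_pos _).le]
  refine ⟨fun j => η j, ?_, fun j f => ?_⟩
  · rwa [PiLp.norm_eq_of_L2] at hη
  · have h1 : inner ℂ Ψ (Wt (F (Pi.single j f))) = inner ℂ η (A (Pi.single j f)) :=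
      hηA (Pi.single j f)
    rw [hF, PiLp.inner_apply, Finset.sum_eq_single j, Finset.sum_eq_single j] at h1
    · rw [Pi.single_eq_same, hA, Pi.single_eq_same, inner_smul_right] at h1
      rw [h1, inner_smul_left, Complex.conj_ofReal]
    · intro i _ hij
      rw [hA, Pi.single_eq_of_ne hij]; simp
    · simp
    · intro i _ hij
      rw [Pi.single_eq_of_ne hij]; simp
    · simp

lemma Lap_comm_phi (j : ℕ) : Commute (Lap d) (phi d j) :=
  Commute.sum_left _ _ _ fun k _ => (Xk_comm_phi k j).mul_left (Xk_comm_phi k j)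

lemma norm_inner_Wt_phis_le (Ψ : Lp ℂ 2 (volume : Measure (Hd d))) (j : ℕ) (g : Sc d) :
    ‖inner ℂ Ψ (Wt (phis d j g))‖ ≤ ‖Ψ‖ * (1 / 2) * ‖toL2 g‖ := by
  refine (norm_inner_le_norm _ _).trans ?_
  rw [mul_assoc]
  refine mul_le_mul_of_nonneg_left ((norm_Wt_le _).trans ?_) (norm_nonneg _)
  have := bddL2_phis j g
  rw [one_mul] at this
  gcongr

/-- The resolvent estimate for the low vertical frequencies. -/
lemma norm_Wt_Jop_le (hd : 1 ≤ d) {σ : ℂ} (hσ : σ.im ≠ 0) (u : Sc d)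
    {Ψ : Lp ℂ 2 (volume : Measure (Hd d))}
    (hΨ : ∀ g, inner ℂ Ψ (Wt g) = inner ℂ (toL2 (Lap d u + σ • u)) (toL2 g)) (N : ℕ) :
    ‖Wt (Jop d (-Rs N) (Jop d (Rs N) u))‖ ≤ 4 * (4 + 6 / d) ^ 2 * ‖Ψ‖ := by
  set v := Jop d (-Rs N) (Jop d (Rs N) u) with hv
  let L : Lp ℂ 2 (volume : Measure (Hd d)) → ℕ → Sc d →ₗ[ℂ] ℂ :=
    fun Φ j => (innerSL ℂ Φ).toLinearMap ∘ₗ Wt ∘ₗ phis d j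
  have hL : ∀ Φ j g, L Φ j g = inner ℂ Φ (Wt (phis d j g)) := fun _ _ _ => rfl
  have hLb : ∀ Φ j g, ‖L Φ j g‖ ≤ ‖Φ‖ * (1 / 2) * ‖toL2 g‖ := norm_inner_Wt_phis_le
  obtain ⟨η, hη, hηL⟩ := exists_dual hd N Ψ
  obtain ⟨θ, hθ, hθL⟩ := exists_dual hd N (Wt v)
  have hR : ∀ j, 4 ≤ Rs j := fun j => by
    rw [Rs, pow_succ]
    have : (1 : ℝ) ≤ 4 ^ j := one_le_pow₀ (by norm_num)
    linarith
  set y : Fin (N + 1) → VL2 d := fun j => pastAvg (Rs j) (nabCurve (phi d j u)) 0 with hy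
  have hyη : ∀ j : Fin (N + 1), √(Rs j) * ‖y j‖ ≤ 4 * ‖η j‖ := fun j => by
    have hcomm : Lap d (phi d j u) + σ • phi d j u = phi d j (Lap d u + σ • u) := by
      have := congrArg (fun A : Module.End ℂ (Sc d) => A u) (Lap_comm_phi (d := d) j).eq
      simp only [Module.End.mul_apply] at this
      rw [map_add, map_smul, this]
    have := norm_pastAvg_nabCurve_le hσ (hR j) (f := phi d j u) (hLb Ψ j) (fun g => by
      rw [hL, hΨ, hcomm, ← inner_conj_symm, inner_phis, inner_conj_symm]) (hηL j)
    rw [norm_smul, Complex.norm_real, Real.norm_eq_abs, abs_of_nonneg (Real.sqrt_nonneg _)] at this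
    have hpos : 0 < √(Rs j) := Real.sqrt_pos.mpr (Rs_pos j)
    have hsq := Real.mul_self_sqrt (Rs_pos j).le
    refine le_of_mul_le_mul_left ?_ hpos
    calc √(Rs j) * (√(Rs j) * ‖y j‖) = Rs j * ‖y j‖ := by rw [← mul_assoc, hsq]
      _ ≤ _ := this
      _ = _ := by ring
  have hsum : v = ∑ j : Fin (N + 1), phis d j (phi d j u) := by
    have := congrArg (fun A : Module.End ℂ (Sc d) => A u) (sum_phis_mul_phi (d := d) N)
    rw [Finset.sum_range] at this
    simpa [LinearMap.sum_apply] using this.symm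
  have e1 : inner ℂ (Wt v) (Wt v) = ∑ j : Fin (N + 1), L (Wt v) j (phi d j u) := by
    simp only [hL]
    rw [← inner_sum, ← map_sum, ← hsum]
  have e2 : ∀ j : Fin (N + 1), ‖L (Wt v) j (phi d j u)‖ ≤ ‖θ j‖ * (4 * ‖η j‖) := fun j => by
    have := functional_Ud_eq (hLb (Wt v) j) (by have := hR j; linarith) (hθL j) (phi d j u) 0
    rw [Ud_zero, Real.exp_zero, Complex.ofReal_one, one_mul, inner_smul_left,
      Complex.conj_ofReal] at this
    rw [this, norm_mul, Complex.norm_real, Real.norm_eq_abs, abs_of_nonneg (Real.sqrt_nonneg _)]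
    calc _ ≤ √(Rs j) * (‖θ j‖ * ‖y j‖) :=
          mul_le_mul_of_nonneg_left (norm_inner_le_norm _ _) (Real.sqrt_nonneg _)
      _ = ‖θ j‖ * (√(Rs j) * ‖y j‖) := by ring
      _ ≤ _ := mul_le_mul_of_nonneg_left (hyη j) (norm_nonneg _)
  have e3 : ‖Wt v‖ ^ 2 ≤ 4 * ((4 + 6 / d) * ‖Wt v‖) * ((4 + 6 / d) * ‖Ψ‖) := by
    calc ‖Wt v‖ ^ 2 = ‖inner ℂ (Wt v) (Wt v)‖ := by
          rw [inner_self_eq_norm_sq_to_K]; simp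
      _ ≤ ∑ j : Fin (N + 1), ‖θ j‖ * (4 * ‖η j‖) := by
          rw [e1]; exact norm_sum_le_of_le _ fun j _ => e2 j
      _ = 4 * ∑ j : Fin (N + 1), ‖θ j‖ * ‖η j‖ := by
          rw [Finset.mul_sum]; exact Finset.sum_congr rfl fun j _ => by ring
      _ ≤ 4 * (√(∑ j, ‖θ j‖ ^ 2) * √(∑ j, ‖η j‖ ^ 2)) :=
          mul_le_mul_of_nonneg_left (Real.sum_mul_le_sqrt_mul_sqrt _ _ _) (by norm_num)
      _ ≤ 4 * (((4 + 6 / d) * ‖Wt v‖) * ((4 + 6 / d) * ‖Ψ‖)) := by gcongr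
      _ = _ := by ring
  rcases (norm_nonneg (Wt v)).eq_or_lt with h0 | h0
  · rw [← h0]; positivity
  · refine le_of_mul_le_mul_left ?_ h0
    nlinarith

lemma norm_sub_Jop_le {r : ℝ} (hr : r ≠ 0) (f : Sc d) :
    ‖toL2 (f - Jop d r f)‖ ≤ |r|⁻¹ * ‖toL2 (Tt d f)‖ := by
  have h := congrArg (fun A : Module.End ℂ (Sc d) => A f) ((Tt_comm_Jop (d := d) r).symm.eq.trans
    (Tt_mul_Jop hr))
  simp only [Module.End.mul_apply, LinearMap.smul_apply, LinearMap.sub_apply,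
    Module.End.one_apply] at h
  have h1 := bddL2_Jop r (Tt d f)
  rw [h, map_smul, norm_smul, one_mul, Complex.norm_real, Real.norm_eq_abs, map_sub,
    norm_sub_rev, ← map_sub] at h1
  rwa [inv_mul_eq_div, le_div_iff₀' (abs_pos.mpr hr)]

/-- The resolvent estimate in terms of a representing element. -/
lemma norm_Wt_le_of_resolvent (hd : 1 ≤ d) {σ : ℂ} (hσ : σ.im ≠ 0) (u : Sc d)
    {Ψ : Lp ℂ 2 (volume : Measure (Hd d))}
    (hΨ : ∀ g, inner ℂ Ψ (Wt g) = inner ℂ (toL2 (Lap d u + σ • u)) (toL2 g)) :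
    ‖Wt u‖ ≤ 4 * (4 + 6 / d) ^ 2 * ‖Ψ‖ := by
  have h1 : ∀ N, ‖Wt u‖ ≤ 4 * (4 + 6 / d) ^ 2 * ‖Ψ‖ + (Rs N)⁻¹ * ‖toL2 (Tt d u)‖ := fun N => by
    have hR := Rs_pos N
    have a1 := norm_sub_Jop_le hR.ne' u
    have a2 := norm_sub_Jop_le (neg_ne_zero.mpr hR.ne') (Jop d (Rs N) u)
    rw [abs_neg] at a2
    rw [abs_of_pos hR] at a1 a2
    have a3 : ‖toL2 (Tt d (Jop d (Rs N) u))‖ ≤ ‖toL2 (Tt d u)‖ := by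
      have h := congrArg (fun A : Module.End ℂ (Sc d) => A u) (Tt_comm_Jop (d := d) (Rs N)).eq
      simp only [Module.End.mul_apply] at h
      have := bddL2_Jop (Rs N) (Tt d u)
      rwa [h, ← one_mul ‖toL2 (Tt d u)‖]
    have a4 := a2.trans (mul_le_mul_of_nonneg_left a3 (inv_nonneg.mpr hR.le))
    have b1 := (norm_Wt_le (u - Jop d (Rs N) u)).trans (mul_le_mul_of_nonneg_left a1 (by norm_num))
    have b2 := (norm_Wt_le (Jop d (Rs N) u - Jop d (-Rs N) (Jop d (Rs N) u))).trans
      (mul_le_mul_of_nonneg_left a4 (by norm_num))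
    have b3 := norm_Wt_Jop_le hd hσ u hΨ N
    have e : Wt u = Wt (Jop d (-Rs N) (Jop d (Rs N) u)) + Wt (u - Jop d (Rs N) u)
        + Wt (Jop d (Rs N) u - Jop d (-Rs N) (Jop d (Rs N) u)) := by
      simp only [map_sub]; abel
    rw [e]
    refine (norm_add₃_le).trans ?_
    linarith
  have h2 : Filter.Tendsto (fun N => 4 * (4 + 6 / (d : ℝ)) ^ 2 * ‖Ψ‖ + (Rs N)⁻¹ * ‖toL2 (Tt d u)‖)
      Filter.atTop (nhds (4 * (4 + 6 / (d : ℝ)) ^ 2 * ‖Ψ‖ + 0 * ‖toL2 (Tt d u)‖)) := by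
    refine tendsto_const_nhds.add (Filter.Tendsto.mul_const _ ?_)
    have h3 : Filter.Tendsto (fun N => Rs N) Filter.atTop Filter.atTop :=
      (tendsto_pow_atTop_atTop_of_one_lt (by norm_num : (1 : ℝ) < 4)).comp
        (Filter.tendsto_add_atTop_nat 1)
    exact h3.inv_tendsto_atTop
  rw [zero_mul, add_zero] at h2
  exact ge_of_tendsto' h2 h1

lemma constant_le (hd : 1 ≤ d) : 4 * (4 + 6 / (d : ℝ)) ^ 2
    ≤ 2 * (3 * Real.exp (1 / 4) - 2) ^ 2 * (5 + 3 / (d : ℝ)) ^ 2 := by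
  have he : 1 + 1 / 4 + (1 / 4) ^ 2 / 2 ≤ Real.exp (1 / 4) :=
    Real.quadratic_le_exp_of_nonneg (by norm_num)
  have h1 : (59 / 32 : ℝ) ≤ 3 * Real.exp (1 / 4) - 2 := by norm_num at he; linarith
  have hd1 : (1 : ℝ) ≤ d := by exact_mod_cast hd
  obtain ⟨q, hq⟩ : ∃ q, q = 1 / (d : ℝ) := ⟨_, rfl⟩
  have hq0 : 0 ≤ q := by rw [hq]; positivity
  have hq1 : q ≤ 1 := by rw [hq, div_le_one (by linarith)]; exact hd1
  have e1 : 6 / (d : ℝ) = 6 * q := by rw [hq]; ring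
  have e2 : 3 / (d : ℝ) = 3 * q := by rw [hq]; ring
  rw [e1, e2]
  have h2 : (59 / 32 : ℝ) ^ 2 ≤ (3 * Real.exp (1 / 4) - 2) ^ 2 := by gcongr
  have h3 : 2 * (59 / 32 : ℝ) ^ 2 * (5 + 3 * q) ^ 2
      ≤ 2 * (3 * Real.exp (1 / 4) - 2) ^ 2 * (5 + 3 * q) ^ 2 := by gcongr
  refine le_trans ?_ h3
  nlinarith

lemma ae_w1_ne_zero (hd : 1 ≤ d) : ∀ᵐ p ∂(volume : Measure (Hd d)), w1 d p ≠ 0 := by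
  let k : Fin d ⊕ Fin d := .inl ⟨0, hd⟩
  have hne : LinearMap.ker (qf d k : Hd d →ₗ[ℝ] ℝ) ≠ ⊤ := fun h => by
    have h1 : ev d k ∈ LinearMap.ker (qf d k : Hd d →ₗ[ℝ] ℝ) := h ▸ Submodule.mem_top
    have h2 : qf d k (ev d k) = 0 := h1
    rw [qf_ev] at h2
    simp at h2
  have h0 := Measure.addHaar_submodule (volume : Measure (Hd d)) _ hne
  refine measure_mono_null (fun p hp => ?_) h0
  have hp : w1 d p = 0 := not_not.mp hp
  have h1 : w1 d p ^ 2 = 0 := by rw [hp]; norm_num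
  have hz := zsq_nonneg p
  rw [w1_sq, _root_.div_eq_zero_iff, _root_.div_eq_zero_iff] at h1
  have h2 : zsq d p = 0 := by
    rcases h1 with (h1 | h1) | h1
    · exact h1
    · linarith
    · exact absurd h1 (by positivity)
  rw [zsq_eq_sum] at h2
  have h3 := (Finset.sum_eq_zero_iff_of_nonneg fun i _ => sq_nonneg _).mp h2 k (Finset.mem_univ k)
  exact pow_eq_zero_iff two_ne_zero |>.mp h3

lemma inner_toLp_w1_inv_mul_Wt (hd : 1 ≤ d) (h g : Sc d)
    (hψ : MemLp (fun p => (((w1 d p)⁻¹ : ℝ) : ℂ) * h p) 2 (volume : Measure (Hd d))) :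
    inner ℂ (hψ.toLp _) (Wt g) = inner ℂ (toL2 h) (toL2 g) := by
  rw [inner_toL2, L2.inner_def]
  refine integral_congr_ae ?_
  filter_upwards [hψ.coeFn_toLp, coeFn_Wt g, ae_w1_ne_zero hd] with p h1 h2 h3
  have h3' : (w1 d p : ℂ) ≠ 0 := Complex.ofReal_ne_zero.mpr h3
  rw [h1, h2, RCLike.inner_apply, map_mul, Complex.conj_ofReal, Complex.ofReal_inv]
  field_simp

lemma lintegral_w1_sq_le_of_memLp (hd : 1 ≤ d) {σ : ℂ} (hσ : σ.im ≠ 0) (f : Sc d)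
    (hψ : MemLp (fun p => (((w1 d p)⁻¹ : ℝ) : ℂ) * (Lap d f + σ • f) p) 2
      (volume : Measure (Hd d))) :
    ∫⁻ p, ENNReal.ofReal (w1 d p ^ 2 * ‖f p‖ ^ 2) ≤
      ENNReal.ofReal ((2 * (3 * Real.exp (1/4) - 2) ^ 2 * (5 + 3 / (d : ℝ)) ^ 2) ^ 2) *
        ∫⁻ p, ENNReal.ofReal (((w1 d p)⁻¹) ^ 2 * ‖(Lap d f + σ • f) p‖ ^ 2) := by
  have h1 := (norm_Wt_le_of_resolvent hd hσ f (Ψ := hψ.toLp _)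
    (fun g => inner_toLp_w1_inv_mul_Wt hd _ g hψ)).trans
    (mul_le_mul_of_nonneg_right (constant_le hd) (norm_nonneg _))
  have h2 := pow_le_pow_left₀ (norm_nonneg _) h1 2
  rw [mul_pow, norm_Wt_sq, norm_sq_eq_integral] at h2
  have h3 : ∫ p, ‖hψ.toLp _ p‖ ^ 2
      = ∫ p, ((w1 d p)⁻¹) ^ 2 * ‖(Lap d f + σ • f) p‖ ^ 2 := by
    refine integral_congr_ae ?_
    filter_upwards [hψ.coeFn_toLp] with p hp
    rw [hp, norm_mul, mul_pow, Complex.norm_real, Real.norm_eq_abs, sq_abs]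
  have h4 : Integrable (fun p => ((w1 d p)⁻¹) ^ 2 * ‖(Lap d f + σ • f) p‖ ^ 2)
      (volume : Measure (Hd d)) := by
    refine ((memLp_two_iff_integrable_sq_norm hψ.1).mp hψ).congr (.of_forall fun p => ?_)
    simp only [norm_mul, mul_pow, Complex.norm_real, Real.norm_eq_abs, sq_abs]
  have h5 : Integrable (fun p => w1 d p ^ 2 * ‖f p‖ ^ 2) (volume : Measure (Hd d)) := by
    refine ((memLp_two_iff_integrable_sq_norm (memLp_w1_mul f).1).mp (memLp_w1_mul f)).congr
      (.of_forall fun p => ?_)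
    simp only [norm_mul, mul_pow, Complex.norm_real, Real.norm_eq_abs, sq_abs]
  rw [h3] at h2
  rw [← ofReal_integral_eq_lintegral_ofReal h4 (.of_forall fun p => by positivity),
    ← ofReal_integral_eq_lintegral_ofReal h5 (.of_forall fun p => by positivity),
    ← ENNReal.ofReal_mul (by positivity)]
  exact ENNReal.ofReal_le_ofReal h2

end UniformResolvent

/-- Uniform resolvent estimate `‖w₁ (L - σ)⁻¹ w₁‖ ≤ C_d`,
`L = -Δ_H`, in a priori form on Schwartz functions, with
`C_d = 2 (3 e^{1/4} - 2)² (5 + 3/d)²`. -/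
theorem uniform_resolvent_estimate_w1 (d : ℕ) (hd : 1 ≤ d)
    (σ : ℂ) (hσ : σ.im ≠ 0) (f : SchwartzMap (Hd d) ℂ) :
    ∫⁻ p, ENNReal.ofReal (w1 d p ^ 2 * ‖f p‖ ^ 2) ≤
      ENNReal.ofReal ((2 * (3 * Real.exp (1/4) - 2) ^ 2 * (5 + 3 / (d : ℝ)) ^ 2) ^ 2) *
        ∫⁻ p, ENNReal.ofReal (((w1 d p)⁻¹) ^ 2 * ‖subLap d (⇑f) p + σ * f p‖ ^ 2) := by
  have e (p : Hd d) : subLap d (⇑f) p + σ * f p = (Lap d f + σ • f) p := by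
    rw [_root_.add_apply, Lap_apply, _root_.smul_apply, smul_eq_mul]
  simp only [e]
  by_cases hψ : MemLp (fun p => (((w1 d p)⁻¹ : ℝ) : ℂ) * (Lap d f + σ • f) p) 2
      (volume : Measure (Hd d))
  · exact lintegral_w1_sq_le_of_memLp hd hσ f hψ
  have hm : AEStronglyMeasurable (fun p => (((w1 d p)⁻¹ : ℝ) : ℂ) * (Lap d f + σ • f) p)
      (volume : Measure (Hd d)) :=
    ((Complex.measurable_ofReal.comp continuous_w1.measurable.inv).mul
      (Lap d f + σ • f).continuous.measurable).aestronglyMeasurable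
  have htop : ∫⁻ p, ENNReal.ofReal (((w1 d p)⁻¹) ^ 2 * ‖(Lap d f + σ • f) p‖ ^ 2)
      = (⊤ : ℝ≥0∞) := by
    by_contra hfin
    refine hψ ((memLp_two_iff_integrable_sq_norm hm).mpr ⟨(hm.norm.pow 2), ?_⟩)
    rw [hasFiniteIntegral_iff_ofReal (.of_forall fun p => by positivity)]
    refine lt_of_eq_of_lt (lintegral_congr fun p => ?_) (lt_top_iff_ne_top.mpr hfin)
    rw [norm_mul, mul_pow, Complex.norm_real, Real.norm_eq_abs, sq_abs]
  have hc : 0 < 2 * (3 * Real.exp (1/4) - 2) ^ 2 * (5 + 3 / (d : ℝ)) ^ 2 :=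
    lt_of_lt_of_le (by positivity) (constant_le hd)
  rw [htop, ENNReal.mul_top (ENNReal.ofReal_pos.mpr (pow_pos hc 2)).ne']
  exact le_top
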